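/- For a 3×3 matrix x define F₀(x), F₁(x), F₂(x) by the identity det(tI − x) = t³ − F₂(x)t² − F₁(x)t − F₀(x) (so F₂(x) is the trace and F₀(x) is the determinant of x). Let ℓ ∈ ℤ∖{0}, κ > 1 and ξ ∈ ℝ². Then for Haar-almost every pair (g₁, g₂) ∈ SL(3,ℝ) × SL(3,ℝ) there exists ε₀ > 0 such that for every ε ∈ (0, ε₀) there is an integer matrix x ∈ M₃(ℤ) with det x = ℓ, ‖(F₁(g₁⁻¹ x g₂), F₂(g₁⁻¹ x g₂)) − ξ‖ < ε and ‖x‖ < ε^{−κ}. -/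

import Mathlib

open MeasureTheory Matrix

instance : TopologicalSpace (Matrix.SpecialLinearGroup (Fin 3) ℝ) :=
  instTopologicalSpaceSubtype

instance : MeasurableSpace (Matrix.SpecialLinearGroup (Fin 3) ℝ) := borel _

/-- `F₁(x)` : minus the degree-1 coefficient of `det(tI − x) = t³ − F₂(x)t² − F₁(x)t − F₀(x)`. -/
noncomputable def charF1 (x : Matrix (Fin 3) (Fin 3) ℝ) : ℝ := -(x.charpoly.coeff 1)

/-- `F₂(x)` : minus the degree-2 coefficient of `det(tI − x) = t³ − F₂(x)t² − F₁(x)t − F₀(x)`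
(equivalently, the trace of `x`). -/
noncomputable def charF2 (x : Matrix (Fin 3) (Fin 3) ℝ) : ℝ := -(x.charpoly.coeff 2)

/-- Real `3 × 3` matrices. -/
abbrev M3 := Matrix (Fin 3) (Fin 3) ℝ

/-- Integral `3 × 3` matrices. -/
abbrev Z3 := Matrix (Fin 3) (Fin 3) ℤ

/-- The group `SL₃(ℤ)`. -/
abbrev SL3Z := Matrix.SpecialLinearGroup (Fin 3) ℤ

noncomputable instance : MeasureSpace M3 := inferInstanceAs (MeasureSpace (Fin 3 → Fin 3 → ℝ))
instance : BorelSpace M3 := inferInstanceAs (BorelSpace (Fin 3 → Fin 3 → ℝ))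
instance : SecondCountableTopology M3 :=
  inferInstanceAs (SecondCountableTopology (Fin 3 → Fin 3 → ℝ))
instance : SigmaFinite (volume : Measure M3) :=
  inferInstanceAs (SigmaFinite (volume : Measure (Fin 3 → Fin 3 → ℝ)))
instance : Countable Z3 := inferInstanceAs (Countable (Fin 3 → Fin 3 → ℤ))
instance : Countable SL3Z := Subtype.countable

/-- An integral matrix viewed as a real one. -/
def toR (x : Z3) : M3 := x.map fun a => (a : ℝ)

@[simp] lemma toR_apply (x : Z3) (i j : Fin 3) : toR x i j = (x i j : ℝ) := rfl

lemma toR_eq (x : Z3) : toR x = (Int.castRingHom ℝ).mapMatrix x := rfl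

@[simp] lemma toR_mul (x y : Z3) : toR (x * y) = toR x * toR y := by
  simp only [toR_eq, map_mul]

@[simp] lemma toR_one : toR 1 = 1 := by
  simp only [toR_eq, map_one]

lemma toR_det (x : Z3) : (toR x).det = (x.det : ℝ) := by
  rw [toR_eq, ← RingHom.map_det]; rfl

@[simp] lemma toR_det_SL (g : SL3Z) : (toR g.1).det = 1 := by
  rw [toR_det, g.2]; simp

@[simp] lemma toR_mul_inv (g : SL3Z) : toR g.1 * toR (g⁻¹).1 = 1 := by
  rw [← toR_mul, ← Matrix.SpecialLinearGroup.coe_mul, mul_inv_cancel]; simp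

@[simp] lemma toR_inv_mul (g : SL3Z) : toR (g⁻¹).1 * toR g.1 = 1 := by
  rw [← toR_mul, ← Matrix.SpecialLinearGroup.coe_mul, inv_mul_cancel]; simp

/-- All entries are bounded by `K`. -/
def EBdd (K : ℝ) (A : M3) : Prop := ∀ i j, |A i j| ≤ K

lemma EBdd.mono {K L : ℝ} {A : M3} (h : EBdd K A) (hKL : K ≤ L) : EBdd L A :=
  fun i j => (h i j).trans hKL

lemma EBdd.mul {K L : ℝ} {A B : M3} (hA : EBdd K A) (hB : EBdd L B) :
    EBdd (3 * K * L) (A * B) := by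
  intro i j
  have hK : 0 ≤ K := (abs_nonneg _).trans (hA i j)
  rw [Matrix.mul_apply]
  refine (Finset.abs_sum_le_sum_abs _ _).trans ?_
  have : ∀ k ∈ Finset.univ, |A i k * B k j| ≤ K * L := by
    intro k _
    rw [abs_mul]
    exact mul_le_mul (hA i k) (hB k j) (abs_nonneg _) hK
  refine (Finset.sum_le_card_nsmul _ _ _ this).trans ?_
  simp; linarith

lemma EBdd.adjugate {K : ℝ} {A : M3} (hA : EBdd K A) : EBdd (2 * K ^ 2) A.adjugate := by
  have key : ∀ a b c d : ℝ, |a| ≤ K → |b| ≤ K → |c| ≤ K → |d| ≤ K →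
      |a * b - c * d| ≤ 2 * K ^ 2 := by
    intro a b c d ha hb hc hd
    have hK : 0 ≤ K := (abs_nonneg _).trans ha
    have h1 : |a * b| ≤ K * K := by
      rw [abs_mul]; exact mul_le_mul ha hb (abs_nonneg _) hK
    have h2 : |c * d| ≤ K * K := by
      rw [abs_mul]; exact mul_le_mul hc hd (abs_nonneg _) hK
    have := abs_sub (a * b) (c * d)
    nlinarith
  have key' : ∀ a b c d : ℝ, |a| ≤ K → |b| ≤ K → |c| ≤ K → |d| ≤ K →
      |-(a * b) + c * d| ≤ 2 * K ^ 2 := by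
    intro a b c d ha hb hc hd
    rw [show -(a * b) + c * d = c * d - a * b by ring]
    exact key _ _ _ _ hc hd ha hb
  intro i j
  rw [Matrix.adjugate_fin_three]
  fin_cases i <;> fin_cases j <;> simp <;>
    first
    | exact key _ _ _ _ (hA _ _) (hA _ _) (hA _ _) (hA _ _)
    | exact key' _ _ _ _ (hA _ _) (hA _ _) (hA _ _) (hA _ _)

lemma measurePreserving_transpose : MeasurePreserving (fun A : M3 => Aᵀ) := by
  let T : (Fin 3 → Fin 3 → ℝ) →ₗ[ℝ] (Fin 3 → Fin 3 → ℝ) :=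
    { toFun := fun A i j => A j i
      map_add' := fun _ _ => rfl
      map_smul' := fun _ _ => rfl }
  have hT : T * T = 1 := by ext; rfl
  have hd : LinearMap.det T * LinearMap.det T = 1 := by
    rw [← map_mul, hT, map_one]
  have habs : |LinearMap.det T| = 1 := by
    rcases mul_self_eq_one_iff.mp hd with h | h <;> simp [h]
  have hne : LinearMap.det T ≠ 0 := by
    intro h; simp [h] at hd
  have : Measure.map T (volume : Measure (Fin 3 → Fin 3 → ℝ)) = volume := by
    rw [Measure.map_linearMap_addHaar_eq_smul_addHaar _ hne, abs_inv, habs]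
    simp
  exact ⟨T.continuous_of_finiteDimensional.measurable, this⟩

lemma measurePreserving_mul_right {g : M3} (hg : g.det = 1) :
    MeasurePreserving (fun A : M3 => A * g) := by
  have h1 : MeasurePreserving (fun v : Fin 3 → ℝ => v ᵥ* g) := by
    have hl : Measure.map (Matrix.toLin' gᵀ) (volume : Measure (Fin 3 → ℝ)) = volume := by
      rw [Real.map_matrix_volume_pi_eq_smul_volume_pi (by simp [hg])]
      simp [hg]
    have he : (fun v : Fin 3 → ℝ => v ᵥ* g) = Matrix.toLin' gᵀ := by
      ext v; simp [Matrix.mulVec_transpose]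
    rw [he]
    exact ⟨(Matrix.toLin' gᵀ).continuous_of_finiteDimensional.measurable, hl⟩
  exact volume_preserving_pi (fun _ : Fin 3 => h1)

lemma measurePreserving_mul_left {g : M3} (hg : g.det = 1) :
    MeasurePreserving (fun A : M3 => g * A) := by
  have h := measurePreserving_transpose.comp
    ((measurePreserving_mul_right (g := gᵀ) (by simpa using hg)).comp measurePreserving_transpose)
  have he : (fun A : M3 => g * A) = (fun A : M3 => Aᵀ) ∘ (fun A => A * gᵀ) ∘ fun A => Aᵀ := by
    funext A; simp [Matrix.transpose_mul]
  rw [he]; exact h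

lemma measurable_mul_left (g : M3) : Measurable (fun A : M3 => g * A) :=
  Continuous.measurable (by fun_prop)

lemma measurable_mul_right (g : M3) : Measurable (fun A : M3 => A * g) :=
  Continuous.measurable (by fun_prop)

lemma measurableSet_EBdd (K : ℝ) : MeasurableSet {A : M3 | EBdd K A} := by
  have : {A : M3 | EBdd K A} = ⋂ i, ⋂ j, {A : M3 | |A i j| ≤ K} := by
    ext; simp [EBdd]
  rw [this]
  refine MeasurableSet.iInter fun i => MeasurableSet.iInter fun j => ?_
  exact (isClosed_le (by fun_prop) (by fun_prop)).measurableSet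

lemma volume_EBdd {K : ℝ} (hK : 0 ≤ K) : volume {A : M3 | EBdd K A} = ENNReal.ofReal ((2 * K) ^ 9) := by
  have : {A : M3 | EBdd K A} = Set.pi Set.univ fun _ : Fin 3 => Set.pi Set.univ fun _ : Fin 3 =>
      Set.Icc (-K) K := by
    ext A
    exact ⟨fun h i _ j _ => abs_le.mp (h i j), fun h i j => abs_le.mpr (h i trivial j trivial)⟩
  rw [this]
  have h1 : volume (Set.pi Set.univ fun _ : Fin 3 => Set.Icc (-K) K) = ENNReal.ofReal ((2 * K) ^ 3) := by
    rw [volume_pi_pi]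
    simp only [Real.volume_Icc, Finset.prod_const, Finset.card_univ, Fintype.card_fin]
    rw [← ENNReal.ofReal_pow (by linarith)]; congr 1; ring
  have h2 := volume_pi_pi (fun _ : Fin 3 => Set.pi Set.univ fun _ : Fin 3 => Set.Icc (-K) K)
  refine h2.trans ?_
  simp only [h1, Finset.prod_const, Finset.card_univ, Fintype.card_fin]
  rw [← ENNReal.ofReal_pow (by positivity)]; congr 1; ring

/-- The unipotent matrix `1 + v nᵀ`, with `n = (n₀, n₁, 1)` and `v = (c₀, c₁, -(n₀ c₀ + n₁ c₁))`
orthogonal to it. -/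
def uni (n c : Fin 2 → ℝ) : M3 :=
  !![1 + c 0 * n 0, c 0 * n 1, c 0;
     c 1 * n 0, 1 + c 1 * n 1, c 1;
     -(n 0 * c 0 + n 1 * c 1) * n 0, -(n 0 * c 0 + n 1 * c 1) * n 1,
       1 - (n 0 * c 0 + n 1 * c 1)]

/-- The translation matrix with last column `(θ₀, θ₁, 1)`. -/
def ntr (θ : Fin 2 → ℝ) : M3 := !![1, 0, θ 0; 0, 1, θ 1; 0, 0, 1]

/-- Derivative of `c ↦ tr (uni n c * X)`. -/
def alphaC (n : Fin 2 → ℝ) (X : M3) (i : Fin 2) : ℝ :=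
  (n 0 * X 0 i.castSucc + n 1 * X 1 i.castSucc + X 2 i.castSucc) -
    n i * (n 0 * X 0 2 + n 1 * X 1 2 + X 2 2)

/-- Derivative of `c ↦ -tr (adj (uni n c * X))`. -/
def betaC (n : Fin 2 → ℝ) (X : M3) (i : Fin 2) : ℝ := alphaC n X.adjugate i

/-- The Jacobian of `c ↦ (tr (uni n c * X), tr (adj (uni n c * X)))`, up to sign. -/
def jacD (n : Fin 2 → ℝ) (X : M3) : ℝ :=
  alphaC n X 0 * betaC n X 1 - alphaC n X 1 * betaC n X 0

lemma det_uni (n c : Fin 2 → ℝ) : (uni n c).det = 1 := by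
  simp [uni, det_fin_three]; ring

lemma det_ntr (θ : Fin 2 → ℝ) : (ntr θ).det = 1 := by
  simp [ntr, det_fin_three]

lemma uni_mul_uni (n c d : Fin 2 → ℝ) : uni n c * uni n d = uni n (c + d) := by
  ext i j
  fin_cases i <;> fin_cases j <;> simp [uni, mul_apply, Fin.sum_univ_three] <;> ring

lemma ntr_mul_ntr (c d : Fin 2 → ℝ) : ntr c * ntr d = ntr (c + d) := by
  ext i j
  fin_cases i <;> fin_cases j <;> simp [ntr, mul_apply, Fin.sum_univ_three] <;> ring

lemma uni_zero (n : Fin 2 → ℝ) : uni n 0 = 1 := by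
  ext i j
  fin_cases i <;> fin_cases j <;> simp [uni]

lemma ntr_zero : ntr 0 = 1 := by
  ext i j
  fin_cases i <;> fin_cases j <;> simp [ntr]

lemma adjugate_uni (n c : Fin 2 → ℝ) : (uni n c).adjugate = uni n (-c) := by
  have h1 : uni n (-c) * uni n c = 1 := by rw [uni_mul_uni]; simp [uni_zero]
  have h2 : uni n c * (uni n c).adjugate = 1 := by rw [mul_adjugate, det_uni]; simp
  calc (uni n c).adjugate = (uni n (-c) * uni n c) * (uni n c).adjugate := by rw [h1, one_mul]
    _ = uni n (-c) := by rw [mul_assoc, h2, mul_one]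

lemma trace_uni_mul (n c : Fin 2 → ℝ) (X : M3) :
    (uni n c * X).trace = X.trace + (alphaC n X 0 * c 0 + alphaC n X 1 * c 1) := by
  rw [trace_fin_three, trace_fin_three]
  simp only [mul_apply, Fin.sum_univ_three]
  simp [uni, alphaC]
  ring

lemma trace_mul_uni (n c : Fin 2 → ℝ) (X : M3) :
    (X * uni n c).trace = X.trace + (alphaC n X 0 * c 0 + alphaC n X 1 * c 1) := by
  rw [trace_mul_comm, trace_uni_mul]

lemma trace_adjugate_uni_mul (n c : Fin 2 → ℝ) (X : M3) :
    (uni n c * X).adjugate.trace =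
      X.adjugate.trace - (betaC n X 0 * c 0 + betaC n X 1 * c 1) := by
  rw [adjugate_mul_distrib, adjugate_uni, trace_mul_uni]
  simp [betaC]; ring

lemma alphaC_uni_mul (n c : Fin 2 → ℝ) (X : M3) (i : Fin 2) :
    alphaC n (uni n c * X) i = alphaC n X i := by
  fin_cases i <;> simp [uni, alphaC, mul_apply, Fin.sum_univ_three] <;> ring

lemma alphaC_mul_uni (n c : Fin 2 → ℝ) (X : M3) (i : Fin 2) :
    alphaC n (X * uni n c) i = alphaC n X i := by
  fin_cases i <;> simp [uni, alphaC, mul_apply, Fin.sum_univ_three] <;> ring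

lemma betaC_uni_mul (n c : Fin 2 → ℝ) (X : M3) (i : Fin 2) :
    betaC n (uni n c * X) i = betaC n X i := by
  rw [betaC, adjugate_mul_distrib, adjugate_uni, alphaC_mul_uni, betaC]

lemma jacD_uni_mul (n c : Fin 2 → ℝ) (X : M3) : jacD n (uni n c * X) = jacD n X := by
  simp only [jacD, alphaC_uni_mul, betaC_uni_mul]

/-- The normalized last row of the adjugate. -/
noncomputable def nOf (g : M3) (i : Fin 2) : ℝ := g.adjugate 2 i.castSucc / g.adjugate 2 2

/-- The parameter with `g * ntr θ = uni (nOf g) (cOf g θ) * g`. -/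
noncomputable def cOf (g : M3) (θ : Fin 2 → ℝ) (i : Fin 2) : ℝ :=
  g.adjugate 2 2 * (g i.castSucc 0 * θ 0 + g i.castSucc 1 * θ 1)

lemma mul_ntr_eq_uni_mul {g : M3} (hg : g.det = 1) (hp : g.adjugate 2 2 ≠ 0) (θ : Fin 2 → ℝ) :
    g * ntr θ = uni (nOf g) (cOf g θ) * g := by
  have hadj : g.adjugate * g = 1 := by rw [adjugate_mul, hg, one_smul]
  have e : ∀ j, g.adjugate 2 0 * g 0 j + g.adjugate 2 1 * g 1 j + g.adjugate 2 2 * g 2 j =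
      (1 : M3) 2 j := by
    intro j
    rw [← hadj, mul_apply, Fin.sum_univ_three]
  have e0 := e 0
  have e1 := e 1
  have e2 := e 2
  simp only [one_apply] at e0 e1 e2
  simp at e0 e1 e2
  set p0 := g.adjugate 2 0
  set p1 := g.adjugate 2 1
  set p2 := g.adjugate 2 2
  have n0 : nOf g 0 = p0 / p2 := rfl
  have n1 : nOf g 1 = p1 / p2 := rfl
  have hc0 : cOf g θ 0 = p2 * (g 0 0 * θ 0 + g 0 1 * θ 1) := rfl
  have hc1 : cOf g θ 1 = p2 * (g 1 0 * θ 0 + g 1 1 * θ 1) := rfl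
  have f0 : nOf g 0 * g 0 0 + nOf g 1 * g 1 0 + g 2 0 = 0 := by
    rw [n0, n1]; field_simp; linarith
  have f1 : nOf g 0 * g 0 1 + nOf g 1 * g 1 1 + g 2 1 = 0 := by
    rw [n0, n1]; field_simp; linarith
  have f2 : p2 * (nOf g 0 * g 0 2 + nOf g 1 * g 1 2 + g 2 2) = 1 := by
    rw [n0, n1]; field_simp; linarith
  ext i j
  fin_cases i <;> fin_cases j <;>
    simp [uni, ntr, mul_apply, Fin.sum_univ_three, hc0, hc1]
  · linear_combination (-(p2 * (g 0 0 * θ 0 + g 0 1 * θ 1))) * f0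
  · linear_combination (-(p2 * (g 0 0 * θ 0 + g 0 1 * θ 1))) * f1
  · linear_combination (-((g 0 0 * θ 0 + g 0 1 * θ 1))) * f2
  · linear_combination (-(p2 * (g 1 0 * θ 0 + g 1 1 * θ 1))) * f0
  · linear_combination (-(p2 * (g 1 0 * θ 0 + g 1 1 * θ 1))) * f1
  · linear_combination (-((g 1 0 * θ 0 + g 1 1 * θ 1))) * f2
  · linear_combination ((nOf g 0 * (p2 * (g 0 0 * θ 0 + g 0 1 * θ 1)) +
      nOf g 1 * (p2 * (g 1 0 * θ 0 + g 1 1 * θ 1)))) * f0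
  · linear_combination ((nOf g 0 * (p2 * (g 0 0 * θ 0 + g 0 1 * θ 1)) +
      nOf g 1 * (p2 * (g 1 0 * θ 0 + g 1 1 * θ 1)))) * f1
  · linear_combination ((nOf g 0 * ((g 0 0 * θ 0 + g 0 1 * θ 1)) +
      nOf g 1 * ((g 1 0 * θ 0 + g 1 1 * θ 1)))) * f2 + θ 0 * f0 + θ 1 * f1

lemma volume_affine_box {L : Matrix (Fin 2) (Fin 2) ℝ} (hL : L.det ≠ 0) (v : Fin 2 → ℝ) {ε : ℝ}
    (hε : 0 < ε) :
    volume {c : Fin 2 → ℝ | ∀ i, |(L *ᵥ c) i + v i| < ε} =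
      ENNReal.ofReal (4 * ε ^ 2 / |L.det|) := by
  have h1 : {c : Fin 2 → ℝ | ∀ i, |(L *ᵥ c) i + v i| < ε} =
      (Matrix.toLin' L) ⁻¹' ((fun y => y + v) ⁻¹' (Set.pi Set.univ fun _ => Set.Ioo (-ε) ε)) := by
    ext c
    exact ⟨fun h i _ => abs_lt.mp (h i), fun h i => abs_lt.mpr (h i trivial)⟩
  rw [h1, Measure.addHaar_preimage_linearMap _ (by rwa [LinearMap.det_toLin']),
    measure_preimage_add_right, volume_pi_pi, LinearMap.det_toLin']
  simp only [Real.volume_Ioo, Finset.prod_const, Finset.card_univ, Fintype.card_fin]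
  rw [← ENNReal.ofReal_pow (by linarith), ← ENNReal.ofReal_mul (by positivity), abs_inv]
  congr 1; ring

/-- The matrix of the linear system solved by `c`. -/
def sysL (n : Fin 2 → ℝ) (X : M3) : Matrix (Fin 2) (Fin 2) ℝ :=
  !![alphaC n X 0, alphaC n X 1; -betaC n X 0, -betaC n X 1]

lemma det_sysL (n : Fin 2 → ℝ) (X : M3) : (sysL n X).det = -jacD n X := by
  simp [sysL, det_fin_two, jacD]; ring

lemma setOf_trace_eq_affine (n : Fin 2 → ℝ) (X : M3) (a b ε : ℝ) :
    {c : Fin 2 → ℝ | |(uni n c * X).trace - a| < ε ∧ |(uni n c * X).adjugate.trace - b| < ε} =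
      {c | ∀ i, |(sysL n X *ᵥ c) i + ![X.trace - a, X.adjugate.trace - b] i| < ε} := by
  ext c
  simp only [Fin.forall_fin_two, trace_uni_mul, trace_adjugate_uni_mul, sysL, mulVec,
    dotProduct, Fin.sum_univ_two, Set.mem_ofPred_eq, of_apply, cons_val_zero, cons_val_one]
  rw [show X.trace + (alphaC n X 0 * c 0 + alphaC n X 1 * c 1) - a =
    alphaC n X 0 * c 0 + alphaC n X 1 * c 1 + (X.trace - a) by ring,
    show X.adjugate.trace - (betaC n X 0 * c 0 + betaC n X 1 * c 1) - b =
    -betaC n X 0 * c 0 + -betaC n X 1 * c 1 + (X.adjugate.trace - b) by ring]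

lemma volume_trace_set {n : Fin 2 → ℝ} {X : M3} (hD : jacD n X ≠ 0) (a b : ℝ) {ε : ℝ}
    (hε : 0 < ε) :
    volume {c : Fin 2 → ℝ | |(uni n c * X).trace - a| < ε ∧
      |(uni n c * X).adjugate.trace - b| < ε} = ENNReal.ofReal (4 * ε ^ 2 / |jacD n X|) := by
  rw [setOf_trace_eq_affine, volume_affine_box (by rwa [det_sysL, neg_ne_zero]) _ hε, det_sysL,
    abs_neg]

lemma card_filter_dvd_affine_le (a b e₀ : ℤ) (h q : ℕ) (hq : q.Prime) (hqa : ¬ (q : ℤ) ∣ a) :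
    ((Finset.Ico e₀ (e₀ + h)).filter fun e => (q : ℤ) ∣ a * e + b).card ≤ h / q + 1 := by
  have hqp : (0 : ℤ) < q := by exact_mod_cast hq.pos
  have hprime : Prime (q : ℤ) := Nat.prime_iff_prime_int.mp hq
  rw [← Finset.card_range (h / q + 1)]
  refine Finset.card_le_card_of_injOn (fun e => ((e - e₀) / q).toNat) ?_ ?_
  · intro e he
    simp only [Finset.coe_filter, Finset.mem_Ico, Set.mem_ofPred_eq] at he
    simp only [Finset.coe_range, Set.mem_Iio]
    have h1 : (e - e₀) / q ≤ ((h / q : ℕ) : ℤ) := by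
      push_cast
      exact Int.ediv_le_ediv hqp (by omega)
    rw [Nat.lt_succ_iff, Int.toNat_le]
    exact h1
  · intro x hx y hy hxy
    simp only [Finset.coe_filter, Finset.mem_Ico, Set.mem_ofPred_eq] at hx hy hxy
    have hd : (q : ℤ) ∣ a * (x - y) := by
      have := dvd_sub hx.2 hy.2
      rwa [show a * x + b - (a * y + b) = a * (x - y) by ring] at this
    have hd' : (q : ℤ) ∣ (x - e₀) - (y - e₀) := by
      rcases hprime.dvd_or_dvd hd with h' | h'
      · exact absurd h' hqa
      · rwa [show (x - e₀) - (y - e₀) = x - y by ring]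
    have hx0 : 0 ≤ (x - e₀) / q := Int.ediv_nonneg (by omega) hqp.le
    have hy0 : 0 ≤ (y - e₀) / q := Int.ediv_nonneg (by omega) hqp.le
    have hdiv : (x - e₀) / q = (y - e₀) / q := by omega
    have hm : (x - e₀) % q = (y - e₀) % q := Int.emod_eq_emod_iff_emod_sub_eq_zero.mpr (Int.emod_eq_zero_of_dvd hd')
    have e1 := Int.mul_ediv_add_emod (x - e₀) q
    have e2 := Int.mul_ediv_add_emod (y - e₀) q
    rw [hdiv, hm] at e1
    linarith

lemma sum_inv_sq_le (h : ℕ) (hh : 2 ≤ h) :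
    ∑ q ∈ Finset.Icc 2 h, (1 : ℝ) / (q : ℝ) ^ 2 ≤ 3 / 4 - 1 / h := by
  induction h, hh using Nat.le_induction with
  | base => norm_num
  | succ n hn ih =>
    rw [Finset.sum_Icc_succ_top (by omega)]
    have hn' : (0 : ℝ) < n := by positivity
    have : (1 : ℝ) / ((n + 1 : ℕ) : ℝ) ^ 2 ≤ 1 / n - 1 / ((n + 1 : ℕ) : ℝ) := by
      push_cast
      rw [div_sub_div _ _ hn'.ne' (by positivity), div_le_div_iff₀ (by positivity) (by positivity)]
      nlinarith
    linarith

lemma card_large_primeFactors_le {h m : ℕ} (hh : 1 < h) (hm : m ≠ 0) (hmh : m < h ^ 3) :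
    (m.primeFactors.filter fun q => h < q).card ≤ 2 := by
  by_contra! hc
  have h1 : h ^ 3 ≤ h ^ (m.primeFactors.filter fun q => h < q).card :=
    Nat.pow_le_pow_right (by omega) hc
  have h2 : h ^ (m.primeFactors.filter fun q => h < q).card ≤
      ∏ q ∈ m.primeFactors.filter (fun q => h < q), q := by
    refine Finset.pow_card_le_prod _ _ _ ?_
    intro q hq
    exact (Finset.mem_filter.mp hq).2.le
  have h3 : ∏ q ∈ m.primeFactors.filter (fun q => h < q), q ∣ m :=
    (Finset.prod_dvd_prod_of_subset _ _ _ (Finset.filter_subset _ _)).trans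
      (Nat.prod_primeFactors_dvd m)
  have h4 := Nat.le_of_dvd (by omega) h3
  omega

/-- Among the values of two affine functions on intervals of length `h`, a positive proportion of
the pairs is coprime, provided that no prime dividing a slope divides a pair of values. -/
lemma coprime_count (a b a' b' e₀ f₀ : ℤ) (h : ℕ) (hh : 118 ≤ h)
    (hne : ∀ e ∈ Finset.Ico e₀ (e₀ + h), a * e + b ≠ 0)
    (hlt : ∀ e ∈ Finset.Ico e₀ (e₀ + h), |a * e + b| < (h : ℤ) ^ 3)
    (hq : ∀ q : ℕ, q.Prime → ∀ e ∈ Finset.Ico e₀ (e₀ + h), ∀ f ∈ Finset.Ico f₀ (f₀ + h),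
      (q : ℤ) ∣ a * e + b → (q : ℤ) ∣ a' * f + b' → ¬ (q : ℤ) ∣ a ∧ ¬ (q : ℤ) ∣ a') :
    h ^ 2 ≤ 16 * ((Finset.Ico e₀ (e₀ + h) ×ˢ Finset.Ico f₀ (f₀ + h)).filter
      fun x => IsCoprime (a * x.1 + b) (a' * x.2 + b')).card := by
  classical
  set E := Finset.Ico e₀ (e₀ + h)
  set F := Finset.Ico f₀ (f₀ + h)
  set u : ℤ → ℤ := fun e => a * e + b
  set v : ℤ → ℤ := fun f => a' * f + b'
  have hE : E.card = h := by simp [E]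
  have hF : F.card = h := by simp [F]
  let Eq : ℕ → Finset ℤ := fun q => E.filter fun e => (q : ℤ) ∣ u e
  let Fq : ℕ → Finset ℤ := fun q => F.filter fun f => (q : ℤ) ∣ v f
  let small : Finset (ℤ × ℤ) := (Finset.Icc 2 h).biUnion fun q =>
    if q.Prime then Eq q ×ˢ Fq q else ∅
  let large : Finset (ℤ × ℤ) := E.biUnion fun e =>
    ((u e).natAbs.primeFactors.filter fun q => h < q).biUnion fun q => {e} ×ˢ Fq q
  have hcard : ∀ q : ℕ, q.Prime → (Eq q ×ˢ Fq q).card ≤ (h / q + 1) ^ 2 := by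
    intro q hqp
    rw [Finset.card_product]
    rcases (Eq q).eq_empty_or_nonempty with h0 | ⟨e, he⟩
    · simp [h0]
    rcases (Fq q).eq_empty_or_nonempty with h0 | ⟨f, hf⟩
    · simp [h0]
    have he' := Finset.mem_filter.mp he
    have hf' := Finset.mem_filter.mp hf
    obtain ⟨h1, h2⟩ := hq q hqp e he'.1 f hf'.1 he'.2 hf'.2
    rw [pow_two]
    exact Nat.mul_le_mul (card_filter_dvd_affine_le a b e₀ h q hqp h1)
      (card_filter_dvd_affine_le a' b' f₀ h q hqp h2)
  have hsmall : (small.card : ℝ) ≤ 27 / 32 * (h : ℝ) ^ 2 + 9 * h := by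
    have h1 : small.card ≤ ∑ q ∈ Finset.Icc 2 h, (h / q + 1) ^ 2 := by
      refine Finset.card_biUnion_le.trans (Finset.sum_le_sum fun q _ => ?_)
      split_ifs with hp
      · exact hcard q hp
      · simp
    have h2 : (small.card : ℝ) ≤ ∑ q ∈ Finset.Icc 2 h, (9 / 8 * (h : ℝ) ^ 2 * (1 / (q : ℝ) ^ 2) + 9) := by
      refine (Nat.cast_le.mpr h1).trans ?_
      push_cast
      refine Finset.sum_le_sum fun q _ => ?_
      have : ((h / q : ℕ) : ℝ) ≤ h / q := Nat.cast_div_le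
      have h0 : (0 : ℝ) ≤ ((h / q : ℕ) : ℝ) := by positivity
      have e : (9 / 8 * (h : ℝ) ^ 2 * (1 / (q : ℝ) ^ 2) + 9) = 9 / 8 * ((h : ℝ) / q) ^ 2 + 9 := by ring
      rw [e]
      nlinarith [sq_nonneg ((h : ℝ) / q - 8)]
    refine h2.trans ?_
    rw [Finset.sum_add_distrib, ← Finset.mul_sum]
    have h3 := sum_inv_sq_le h (by omega)
    have h5 : (0 : ℝ) ≤ 1 / h := by positivity
    have h4 : (9 / 8 * (h : ℝ) ^ 2) * ∑ q ∈ Finset.Icc 2 h, (1 : ℝ) / (q : ℝ) ^ 2 ≤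
        (9 / 8 * (h : ℝ) ^ 2) * (3 / 4) :=
      mul_le_mul_of_nonneg_left (by linarith) (by positivity)
    have h6 : ∑ q ∈ Finset.Icc 2 h, (9 : ℝ) ≤ 9 * h := by
      simp only [Finset.sum_const, Nat.card_Icc, nsmul_eq_mul]
      have : ((h + 1 - 2 : ℕ) : ℝ) ≤ h := by exact_mod_cast (by omega)
      linarith
    linarith
  have hlarge : large.card ≤ 2 * h := by
    refine Finset.card_biUnion_le.trans ?_
    rw [show 2 * h = E.card • 2 by rw [hE, smul_eq_mul, mul_comm]]
    refine Finset.sum_le_card_nsmul _ _ _ fun e he => ?_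
    refine Finset.card_biUnion_le.trans ?_
    have h1 : ∀ q ∈ ((u e).natAbs.primeFactors.filter fun q => h < q),
        (({e} : Finset ℤ) ×ˢ Fq q).card ≤ 1 := by
      intro q hq'
      obtain ⟨hq1, hq2⟩ := Finset.mem_filter.mp hq'
      have hqp := Nat.prime_of_mem_primeFactors hq1
      rw [Finset.card_product, Finset.card_singleton, one_mul]
      rcases (Fq q).eq_empty_or_nonempty with h0 | ⟨f, hf⟩
      · simp [h0]
      have hf' := Finset.mem_filter.mp hf
      have hqe : (q : ℤ) ∣ u e := Int.natCast_dvd.mpr (Nat.dvd_of_mem_primeFactors hq1)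
      have := card_filter_dvd_affine_le a' b' f₀ h q hqp (hq q hqp e he f hf'.1 hqe hf'.2).2
      rwa [Nat.div_eq_of_lt hq2] at this
    refine (Finset.sum_le_card_nsmul _ _ _ h1).trans ?_
    rw [smul_eq_mul, mul_one]
    refine card_large_primeFactors_le (by omega) (Int.natAbs_ne_zero.mpr (hne e he)) ?_
    have := hlt e he
    rw [Int.abs_eq_natAbs] at this
    exact_mod_cast this
  have hcover : E ×ˢ F ⊆ ((E ×ˢ F).filter fun x => IsCoprime (u x.1) (v x.2)) ∪ (small ∪ large) := by
    rintro ⟨e, f⟩ hx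
    obtain ⟨he, hf⟩ := Finset.mem_product.mp hx
    by_cases hco : IsCoprime (u e) (v f)
    · exact Finset.mem_union_left _ (Finset.mem_filter.mpr ⟨hx, hco⟩)
    refine Finset.mem_union_right _ ?_
    rw [Int.isCoprime_iff_gcd_eq_one] at hco
    obtain ⟨q, hqp, hqd⟩ := Nat.exists_prime_and_dvd hco
    have d1 : (q : ℤ) ∣ u e := (Int.natCast_dvd_natCast.mpr hqd).trans (Int.gcd_dvd_left ..)
    have d2 : (q : ℤ) ∣ v f := (Int.natCast_dvd_natCast.mpr hqd).trans (Int.gcd_dvd_right ..)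
    by_cases hqh : q ≤ h
    · refine Finset.mem_union_left _ (Finset.mem_biUnion.mpr ⟨q, ?_, ?_⟩)
      · exact Finset.mem_Icc.mpr ⟨hqp.two_le, hqh⟩
      · rw [if_pos hqp]
        exact Finset.mem_product.mpr ⟨Finset.mem_filter.mpr ⟨he, d1⟩, Finset.mem_filter.mpr ⟨hf, d2⟩⟩
    · refine Finset.mem_union_right _ (Finset.mem_biUnion.mpr ⟨e, he,
        Finset.mem_biUnion.mpr ⟨q, ?_, ?_⟩⟩)
      · refine Finset.mem_filter.mpr ⟨?_, by omega⟩
        exact Nat.mem_primeFactors.mpr ⟨hqp, Int.natCast_dvd.mp d1,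
          Int.natAbs_ne_zero.mpr (hne e he)⟩
      · exact Finset.mem_product.mpr ⟨Finset.mem_singleton_self _, Finset.mem_filter.mpr ⟨hf, d2⟩⟩
  have hc := (Finset.card_le_card hcover).trans (Finset.card_union_le _ _)
  have hc2 := Finset.card_union_le small large
  rw [Finset.card_product, hE, hF] at hc
  have hc' : ((h : ℝ) * h) ≤ (((E ×ˢ F).filter fun x => IsCoprime (u x.1) (v x.2)).card : ℝ)
      + small.card + large.card := by
    exact_mod_cast (by omega)
  have hl' : (large.card : ℝ) ≤ 2 * h := by exact_mod_cast hlarge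
  have hh' : (118 : ℝ) ≤ h := by exact_mod_cast hh
  have : (h : ℝ) ^ 2 ≤ 16 * (((E ×ˢ F).filter fun x => IsCoprime (u x.1) (v x.2)).card : ℝ) := by
    nlinarith
  exact_mod_cast this

/-- Integral matrices of size about `h` whose upper left `2 × 2` block is well conditioned. -/
structure ColBox (h : ℕ) (g : Z3) : Prop where
  l00 : 4 * (h : ℤ) ≤ g 0 0
  u00 : g 0 0 ≤ 5 * h
  l10 : (h : ℤ) ≤ g 1 0
  u10 : g 1 0 ≤ 2 * h
  l20 : (h : ℤ) ≤ g 2 0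
  u20 : g 2 0 ≤ 2 * h
  l01 : (h : ℤ) ≤ g 0 1
  u01 : g 0 1 ≤ 2 * h
  l11 : 4 * (h : ℤ) ≤ g 1 1
  u11 : g 1 1 ≤ 5 * h
  l21 : (h : ℤ) ≤ g 2 1
  u21 : g 2 1 ≤ 2 * h
  b02 : |g 0 2| ≤ 7 * h
  b12 : |g 1 2| ≤ 7 * h
  b22 : |g 2 2| ≤ 15 * h

lemma exists_SL3Z_of_columns {h : ℕ} (hh : 1 ≤ h) {a b c d e f : ℤ}
    (la : 4 * (h : ℤ) ≤ a) (ua : a ≤ 5 * h) (lb : (h : ℤ) ≤ b) (ub : b ≤ 2 * h)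
    (lc : (h : ℤ) ≤ c) (uc : c ≤ 2 * h) (ld : (h : ℤ) ≤ d) (ud : d ≤ 2 * h)
    (le : 4 * (h : ℤ) ≤ e) (ue : e ≤ 5 * h) (lf : (h : ℤ) ≤ f) (uf : f ≤ 2 * h)
    (hco : IsCoprime (a * e - b * d) (c * d - a * f)) :
    ∃ g : SL3Z, ColBox h g.1 ∧ g.1 0 0 = a ∧ g.1 1 0 = b ∧ g.1 2 0 = c ∧ g.1 0 1 = d ∧
      g.1 1 1 = e ∧ g.1 2 1 = f := by
  obtain ⟨s, t, hst⟩ := hco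
  have hh' : (1 : ℤ) ≤ h := by exact_mod_cast hh
  set H : ℤ := (h : ℤ)
  set p := a * e - b * d with hp
  have hp12 : 12 * H ^ 2 ≤ p := by
    have h1 : (4 * H) * (4 * H) ≤ a * e := mul_le_mul la le (by linarith) (by linarith)
    have h2 : b * d ≤ (2 * H) * (2 * H) := mul_le_mul ub ud (by linarith) (by linarith)
    nlinarith
  have hpos : 0 < p := by nlinarith
  set m := (-(d * t)) / p
  set n := (a * t) / p
  obtain ⟨r1, hr1⟩ : ∃ r, r = (-(d * t)) % p := ⟨_, rfl⟩
  obtain ⟨r2, hr2⟩ : ∃ r, r = (a * t) % p := ⟨_, rfl⟩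
  have e1 : p * m + r1 = -(d * t) := by rw [hr1]; exact Int.mul_ediv_add_emod _ _
  have e2 : p * n + r2 = a * t := by rw [hr2]; exact Int.mul_ediv_add_emod _ _
  have l1 : 0 ≤ r1 := by rw [hr1]; exact Int.emod_nonneg _ hpos.ne'
  have l2 : 0 ≤ r2 := by rw [hr2]; exact Int.emod_nonneg _ hpos.ne'
  have u1 : r1 < p := by rw [hr1]; exact Int.emod_lt_of_pos _ hpos
  have u2 : r2 < p := by rw [hr2]; exact Int.emod_lt_of_pos _ hpos
  obtain ⟨x, hx⟩ : ∃ x, x = -m * a - n * d := ⟨_, rfl⟩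
  obtain ⟨y, hy⟩ : ∃ y, y = t - m * b - n * e := ⟨_, rfl⟩
  obtain ⟨z, hz⟩ : ∃ z, z = s - m * c - n * f := ⟨_, rfl⟩
  have px : p * x = a * r1 + d * r2 := by
    rw [hx]; linear_combination (-a) * e1 - d * e2
  have py : p * y = b * r1 + e * r2 := by
    rw [hy]; linear_combination (-b) * e1 - e * e2 + t * hp
  have bx : ∀ w α β : ℤ, p * w = α * r1 + β * r2 → 0 ≤ α → 0 ≤ β → α + β ≤ 7 * H →
      |w| ≤ 7 * H := by
    intro w α β hw hα hβ hs
    have i1 : 0 ≤ p * w := by rw [hw]; positivity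
    have i2 : p * w ≤ p * (7 * H) := by
      rw [hw]
      have j1 : α * r1 ≤ α * p := mul_le_mul_of_nonneg_left u1.le hα
      have j2 : β * r2 ≤ β * p := mul_le_mul_of_nonneg_left u2.le hβ
      have j3 : (α + β) * p ≤ 7 * H * p := mul_le_mul_of_nonneg_right hs hpos.le
      linarith
    rw [abs_of_nonneg (nonneg_of_mul_nonneg_right i1 hpos)]
    exact le_of_mul_le_mul_left i2 hpos
  have hbx := bx x a d px (by linarith) (by linarith) (by linarith)
  have hby := bx y b e py (by linarith) (by linarith) (by linarith)
  have hdet : (b * f - c * e) * x + (c * d - a * f) * y + p * z = 1 := by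
    rw [hx, hy, hz, hp]; linear_combination hst
  have hq : ∀ a' b' c' d' : ℤ, 0 ≤ a' → 0 ≤ b' → 0 ≤ c' → 0 ≤ d' → a' ≤ 2 * H → b' ≤ 2 * H →
      c' ≤ 2 * H → d' ≤ 5 * H → |a' * b' - c' * d'| ≤ p := by
    intro a' b' c' d' h1 h2 h3 h4 k1 k2 k3 k4
    have i1 : a' * b' ≤ (2 * H) * (2 * H) := mul_le_mul k1 k2 h2 (by linarith)
    have i2 : c' * d' ≤ (2 * H) * (5 * H) := mul_le_mul k3 k4 h4 (by linarith)
    have i3 : 0 ≤ a' * b' := mul_nonneg h1 h2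
    have i4 : 0 ≤ c' * d' := mul_nonneg h3 h4
    have i5 := sq_nonneg H
    rw [abs_le]; constructor <;> linarith
  have hp0 := hq b f c e (by linarith) (by linarith) (by linarith) (by linarith) ub uf uc ue
  have hp1 : |c * d - a * f| ≤ p := by
    have := hq c d f a (by linarith) (by linarith) (by linarith) (by linarith) uc ud uf ua
    rwa [mul_comm f a] at this
  have hbz : |z| ≤ 15 * H := by
    have i1 : |(b * f - c * e) * x| ≤ p * (7 * H) := by
      rw [abs_mul]; exact mul_le_mul hp0 hbx (abs_nonneg _) hpos.le
    have i2 : |(c * d - a * f) * y| ≤ p * (7 * H) := by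
      rw [abs_mul]; exact mul_le_mul hp1 hby (abs_nonneg _) hpos.le
    rw [abs_le] at i1 i2 ⊢
    constructor
    · refine le_of_mul_le_mul_left ?_ hpos
      have := mul_le_mul_of_nonneg_left hh' hpos.le
      linarith [i1.1, i1.2, i2.1, i2.2]
    · refine le_of_mul_le_mul_left ?_ hpos
      have := mul_le_mul_of_nonneg_left hh' hpos.le
      linarith [i1.1, i1.2, i2.1, i2.2]
  have hD : (!![a, d, x; b, e, y; c, f, z] : Z3).det = 1 := by
    rw [det_fin_three]; simp
    rw [← hdet, hp]; ring
  refine ⟨⟨!![a, d, x; b, e, y; c, f, z], hD⟩, ?_, rfl, rfl, rfl, rfl, rfl, rfl⟩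
  exact ⟨la, ua, lb, ub, lc, uc, ld, ud, le, ue, lf, uf, hbx, hby, hbz⟩

lemma exists_many_SL3Z (h : ℕ) (hh : 118 ≤ h) :
    ∃ S : Finset SL3Z, h ^ 6 ≤ 4096 * S.card ∧ ∀ g ∈ S, ColBox h g.1 := by
  classical
  have hh' : (118 : ℤ) ≤ h := by exact_mod_cast hh
  have hsq : 118 * (h : ℤ) ≤ (h : ℤ) ^ 2 := by nlinarith
  have hcu : 118 * (h : ℤ) ^ 2 ≤ (h : ℤ) ^ 3 := by nlinarith [sq_nonneg (h : ℤ)]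
  set P₁ := (Finset.Ico (4 * (h : ℤ)) (4 * (h : ℤ) + h) ×ˢ Finset.Ico (h : ℤ) ((h : ℤ) + h)).filter
      fun x => IsCoprime (1 * x.1 + 0) (1 * x.2 + 0) with hP₁
  set P₂ := (Finset.Ico (h : ℤ) ((h : ℤ) + h) ×ˢ Finset.Ico (h : ℤ) ((h : ℤ) + h)).filter
      fun x => IsCoprime (1 * x.1 + 0) (1 * x.2 + 0) with hP₂
  set P₃ : (ℤ × ℤ) × (ℤ × ℤ) → Finset (ℤ × ℤ) := fun w =>
    (Finset.Ico (4 * (h : ℤ)) (4 * (h : ℤ) + h) ×ˢ Finset.Ico (h : ℤ) ((h : ℤ) + h)).filter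
      fun x => IsCoprime (w.1.1 * x.1 + -(w.2.1 * w.1.2)) ((-w.1.1) * x.2 + w.2.2 * w.1.2) with hP₃
  have hone : ∀ q : ℕ, q.Prime → ¬ (q : ℤ) ∣ 1 := fun q hq h1 =>
    hq.one_lt.ne' (by exact_mod_cast Int.eq_one_of_dvd_one (by positivity) h1)
  have c₁ : h ^ 2 ≤ 16 * P₁.card := by
    refine coprime_count 1 0 1 0 _ _ h hh ?_ ?_ ?_
    · intro e he; rw [Finset.mem_Ico] at he; linarith
    · intro e he; rw [Finset.mem_Ico] at he
      rw [abs_lt]; constructor <;> linarith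
    · intro q hq _ _ _ _ _ _; exact ⟨hone q hq, hone q hq⟩
  have c₂ : h ^ 2 ≤ 16 * P₂.card := by
    refine coprime_count 1 0 1 0 _ _ h hh ?_ ?_ ?_
    · intro e he; rw [Finset.mem_Ico] at he; linarith
    · intro e he; rw [Finset.mem_Ico] at he
      rw [abs_lt]; constructor <;> linarith
    · intro q hq _ _ _ _ _ _; exact ⟨hone q hq, hone q hq⟩
  have m₁ : ∀ w ∈ P₁, (4 * (h : ℤ) ≤ w.1 ∧ w.1 ≤ 5 * (h : ℤ)) ∧ ((h : ℤ) ≤ w.2 ∧ w.2 ≤ 2 * (h : ℤ)) ∧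
      IsCoprime w.1 w.2 := by
    intro w hw
    simp only [hP₁, Finset.mem_filter, Finset.mem_product, Finset.mem_Ico, one_mul,
      add_zero] at hw
    exact ⟨⟨hw.1.1.1, by linarith [hw.1.1.2]⟩, ⟨hw.1.2.1, by linarith [hw.1.2.2]⟩, hw.2⟩
  have m₂ : ∀ w ∈ P₂, ((h : ℤ) ≤ w.1 ∧ w.1 ≤ 2 * (h : ℤ)) ∧ ((h : ℤ) ≤ w.2 ∧ w.2 ≤ 2 * (h : ℤ)) ∧
      IsCoprime w.1 w.2 := by
    intro w hw
    simp only [hP₂, Finset.mem_filter, Finset.mem_product, Finset.mem_Ico, one_mul,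
      add_zero] at hw
    exact ⟨⟨hw.1.1.1, by linarith [hw.1.1.2]⟩, ⟨hw.1.2.1, by linarith [hw.1.2.2]⟩, hw.2⟩
  have c₃ : ∀ w ∈ P₁ ×ˢ P₂, h ^ 2 ≤ 16 * (P₃ w).card := by
    rintro ⟨⟨a, d⟩, ⟨b, c⟩⟩ hw
    obtain ⟨w1, w2⟩ := Finset.mem_product.mp hw
    obtain ⟨⟨a1, a2⟩, ⟨d1, d2⟩, had⟩ := m₁ _ w1
    obtain ⟨⟨b1, b2⟩, ⟨c1, c2⟩, hbc⟩ := m₂ _ w2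
    simp only at a1 a2 d1 d2 had b1 b2 c1 c2 hbc
    refine coprime_count a (-(b * d)) (-a) (c * d) _ _ h hh ?_ ?_ ?_
    · intro e he; rw [Finset.mem_Ico] at he
      have h1 : (4 * (h : ℤ)) * (4 * (h : ℤ)) ≤ a * e := mul_le_mul a1 he.1 (by linarith) (by linarith)
      have h2 : b * d ≤ (2 * (h : ℤ)) * (2 * (h : ℤ)) := mul_le_mul b2 d2 (by linarith) (by linarith)
      nlinarith
    · intro e he; rw [Finset.mem_Ico] at he
      have h1 : (4 * (h : ℤ)) * (4 * (h : ℤ)) ≤ a * e := mul_le_mul a1 he.1 (by linarith) (by linarith)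
      have h2 : b * d ≤ (2 * (h : ℤ)) * (2 * (h : ℤ)) := mul_le_mul b2 d2 (by linarith) (by linarith)
      have h3 : a * e ≤ (5 * (h : ℤ)) * (5 * (h : ℤ)) :=
        mul_le_mul a2 (by linarith [he.2]) (by linarith) (by linarith)
      have h4 : 0 ≤ b * d := mul_nonneg (by linarith) (by linarith)
      rw [abs_lt]; constructor <;> linarith
    · intro q hq e _ f _ hd1 hd2
      have hpr : Prime (q : ℤ) := Nat.prime_iff_prime_int.mp hq
      have key : ¬ (q : ℤ) ∣ a := by
        intro hqa
        have hqd : ¬ (q : ℤ) ∣ d := fun hqd => hpr.not_isUnit (had.isUnit_of_dvd' hqa hqd)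
        have hb : (q : ℤ) ∣ b := by
          have : (q : ℤ) ∣ b * d := by
            have := dvd_sub (hqa.mul_right e) hd1
            rwa [show a * e - (a * e + -(b * d)) = b * d by ring] at this
          exact (hpr.dvd_or_dvd this).resolve_right hqd
        have hc : (q : ℤ) ∣ c := by
          have : (q : ℤ) ∣ c * d := by
            have := dvd_add (hqa.mul_right f) hd2
            rwa [show a * f + (-a * f + c * d) = c * d by ring] at this
          exact (hpr.dvd_or_dvd this).resolve_right hqd
        exact hpr.not_isUnit (hbc.isUnit_of_dvd' hb hc)
      exact ⟨key, fun h' => key ((dvd_neg).mp h')⟩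
  set G := (P₁ ×ˢ P₂).sigma P₃ with hG
  have hGc : h ^ 6 ≤ 4096 * G.card := by
    rw [hG, Finset.card_sigma]
    have h1 : (P₁ ×ˢ P₂).card • h ^ 2 ≤ ∑ w ∈ P₁ ×ˢ P₂, 16 * (P₃ w).card :=
      Finset.card_nsmul_le_sum _ _ _ c₃
    rw [← Finset.mul_sum, Finset.card_product, smul_eq_mul] at h1
    have h2 : h ^ 2 * h ^ 2 ≤ (16 * P₁.card) * (16 * P₂.card) := Nat.mul_le_mul c₁ c₂
    calc h ^ 6 = (h ^ 2 * h ^ 2) * h ^ 2 := by ring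
      _ ≤ ((16 * P₁.card) * (16 * P₂.card)) * h ^ 2 := Nat.mul_le_mul_right _ h2
      _ = 256 * (P₁.card * P₂.card * h ^ 2) := by ring
      _ ≤ 256 * (16 * ∑ w ∈ P₁ ×ˢ P₂, (P₃ w).card) := Nat.mul_le_mul_left _ h1
      _ = _ := by ring
  have hex : ∀ w ∈ G, ∃ g : SL3Z, ColBox h g.1 ∧ g.1 0 0 = w.1.1.1 ∧ g.1 1 0 = w.1.2.1 ∧
      g.1 2 0 = w.1.2.2 ∧ g.1 0 1 = w.1.1.2 ∧ g.1 1 1 = w.2.1 ∧ g.1 2 1 = w.2.2 := by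
    rintro ⟨⟨⟨a, d⟩, ⟨b, c⟩⟩, ⟨e, f⟩⟩ hw
    obtain ⟨w0, w3⟩ := Finset.mem_sigma.mp hw
    obtain ⟨w1, w2⟩ := Finset.mem_product.mp w0
    obtain ⟨⟨a1, a2⟩, ⟨d1, d2⟩, had⟩ := m₁ _ w1
    obtain ⟨⟨b1, b2⟩, ⟨c1, c2⟩, hbc⟩ := m₂ _ w2
    simp only [hP₃, Finset.mem_filter, Finset.mem_product, Finset.mem_Ico] at w3
    obtain ⟨⟨⟨e1, e2⟩, ⟨f1, f2⟩⟩, hco⟩ := w3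
    refine exists_SL3Z_of_columns (by omega) a1 a2 b1 b2 c1 c2 d1 d2 e1 (by linarith) f1
      (by linarith) ?_
    rwa [show a * e + -(b * d) = a * e - b * d by ring,
      show -a * f + c * d = c * d - a * f by ring] at hco
  choose! φ hφ using hex
  refine ⟨G.image φ, ?_, ?_⟩
  · rwa [Finset.card_image_of_injOn]
    intro w hw w' hw' hww
    obtain ⟨_, h1, h2, h3, h4, h5, h6⟩ := hφ w hw
    obtain ⟨_, k1, k2, k3, k4, k5, k6⟩ := hφ w' hw'
    rw [hww] at h1 h2 h3 h4 h5 h6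
    obtain ⟨⟨⟨a, d⟩, ⟨b, c⟩⟩, ⟨e, f⟩⟩ := w
    obtain ⟨⟨⟨a', d'⟩, ⟨b', c'⟩⟩, ⟨e', f'⟩⟩ := w'
    simp only at h1 h2 h3 h4 h5 h6 k1 k2 k3 k4 k5 k6
    rw [h1] at k1
    rw [h2] at k2
    rw [h3] at k3
    rw [h4] at k4
    rw [h5] at k5
    rw [h6] at k6
    subst k1 k2 k3 k4 k5 k6
    rfl
  · intro g hg
    obtain ⟨w, hw, rfl⟩ := Finset.mem_image.mp hg
    exact (hφ w hw).1

lemma third_row_close {a b c c' : Fin 3 → ℤ} {d : ℤ} (hd : d * d = 1)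
    (h1 : (of ![a, b, c]).det = d) (h2 : (of ![a, b, c']).det = d)
    (hb : |b 2| ≤ |a 2|) (hc : |c 2| ≤ |a 2|) (hc' : |c' 2| ≤ |a 2|)
    (hw : max |c 0 * a 2 - c 2 * a 0| |c 1 * a 2 - c 2 * a 1| ≤
      max |b 0 * a 2 - b 2 * a 0| |b 1 * a 2 - b 2 * a 1|)
    (hw' : max |c' 0 * a 2 - c' 2 * a 0| |c' 1 * a 2 - c' 2 * a 1| ≤
      max |b 0 * a 2 - b 2 * a 0| |b 1 * a 2 - b 2 * a 1|) :
    ∃ m n : ℤ, c' = c + m • a + n • b ∧ |m| ≤ 4 ∧ |n| ≤ 2 := by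
  simp [det_fin_three] at h1 h2
  have hd0 : d ≠ 0 := by rintro rfl; simp at hd
  obtain ⟨x, hx⟩ : ∃ x, x = c' - c := ⟨_, rfl⟩
  have hx' : c' = c + x := by rw [hx]; ring
  have ex : ∀ i, c' i = c i + x i := fun i => by rw [hx']; rfl
  rw [ex, ex, ex] at h2
  -- the component of `x` transverse to `a, b` vanishes
  have h3 : a 0 * b 1 * x 2 - a 0 * b 2 * x 1 - a 1 * b 0 * x 2 + a 1 * b 2 * x 0 +
      a 2 * b 0 * x 1 - a 2 * b 1 * x 0 = 0 := by linear_combination h2 - h1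
  obtain ⟨m, hm⟩ : ∃ m, m = d * (x 0 * b 1 * c 2 - x 0 * b 2 * c 1 - x 1 * b 0 * c 2 +
    x 1 * b 2 * c 0 + x 2 * b 0 * c 1 - x 2 * b 1 * c 0) := ⟨_, rfl⟩
  obtain ⟨n, hn⟩ : ∃ n, n = d * (a 0 * x 1 * c 2 - a 0 * x 2 * c 1 - a 1 * x 0 * c 2 +
    a 1 * x 2 * c 0 + a 2 * x 0 * c 1 - a 2 * x 1 * c 0) := ⟨_, rfl⟩
  have e0 : x 0 = m * a 0 + n * b 0 := by
    rw [hm, hn]; linear_combination (-(x 0)) * hd - d * x 0 * h1 + d * c 0 * h3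
  have e1 : x 1 = m * a 1 + n * b 1 := by
    rw [hm, hn]; linear_combination (-(x 1)) * hd - d * x 1 * h1 + d * c 1 * h3
  have e2 : x 2 = m * a 2 + n * b 2 := by
    rw [hm, hn]; linear_combination (-(x 2)) * hd - d * x 2 * h1 + d * c 2 * h3
  have ha2 : 0 < |a 2| := by
    rw [abs_pos]; intro h0
    rw [h0, abs_zero] at hb hc
    have b0 := abs_nonpos_iff.mp hb
    have c0 := abs_nonpos_iff.mp hc
    apply hd0; rw [← h1, h0, b0, c0]; ring
  have key0 : n * (b 0 * a 2 - b 2 * a 0) = (c' 0 * a 2 - c' 2 * a 0) - (c 0 * a 2 - c 2 * a 0) := by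
    rw [ex, ex, e0, e2]; ring
  have key1 : n * (b 1 * a 2 - b 2 * a 1) = (c' 1 * a 2 - c' 2 * a 1) - (c 1 * a 2 - c 2 * a 1) := by
    rw [ex, ex, e1, e2]; ring
  have hpos : 0 < max |b 0 * a 2 - b 2 * a 0| |b 1 * a 2 - b 2 * a 1| := by
    by_contra! h0
    have z0 : b 0 * a 2 - b 2 * a 0 = 0 := abs_nonpos_iff.mp ((le_max_left _ _).trans h0)
    have z1 : b 1 * a 2 - b 2 * a 1 = 0 := abs_nonpos_iff.mp ((le_max_right _ _).trans h0)
    have z : d * a 2 = 0 := by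
      rw [← h1]
      linear_combination (c 1 * a 2 - a 1 * c 2) * z0 + (a 0 * c 2 - a 2 * c 0) * z1
    rcases mul_eq_zero.mp z with z | z
    · exact hd0 z
    · rw [z] at ha2; simp at ha2
  have hn2 : |n| ≤ 2 := by
    have aux : ∀ u v w : ℤ, n * u = v - w →
        |v| ≤ max |b 0 * a 2 - b 2 * a 0| |b 1 * a 2 - b 2 * a 1| →
        |w| ≤ max |b 0 * a 2 - b 2 * a 0| |b 1 * a 2 - b 2 * a 1| →
        max |b 0 * a 2 - b 2 * a 0| |b 1 * a 2 - b 2 * a 1| = |u| → |n| ≤ 2 := by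
      intro u v w h hv hw hu
      have : |n| * |u| ≤ 2 * |u| := by
        rw [← abs_mul, h]
        have := abs_sub v w
        rw [hu] at hv hw; linarith
      exact le_of_mul_le_mul_right this (hu ▸ hpos)
    rcases max_cases |b 0 * a 2 - b 2 * a 0| |b 1 * a 2 - b 2 * a 1| with h | h
    · exact aux _ _ _ key0 ((le_max_left _ _).trans hw') ((le_max_left _ _).trans hw) h.1
    · exact aux _ _ _ key1 ((le_max_right _ _).trans hw') ((le_max_right _ _).trans hw) h.1
  refine ⟨m, n, ?_, ?_, hn2⟩
  · rw [hx', add_assoc]; congr 1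
    ext i; fin_cases i
    · simpa using e0
    · simpa using e1
    · simpa using e2
  · refine le_of_mul_le_mul_right ?_ ha2
    rw [← abs_mul, show m * a 2 = c' 2 - c 2 - n * b 2 by rw [ex, e2]; ring]
    have i1 := abs_sub (c' 2 - c 2) (n * b 2)
    have i2 := abs_sub (c' 2) (c 2)
    have i3 : |n * b 2| ≤ 2 * |a 2| := by
      rw [abs_mul]; exact mul_le_mul hn2 hb (abs_nonneg _) (by norm_num)
    linarith

/-- The rows of `z` indexed by `σ` are in good order for `third_row_close`. -/
def RowsOrdered (σ : Equiv.Perm (Fin 3)) (z : Z3) : Prop :=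
  (∀ i, |z i 2| ≤ |z (σ 0) 2|) ∧
  max |z (σ 2) 0 * z (σ 0) 2 - z (σ 2) 2 * z (σ 0) 0| |z (σ 2) 1 * z (σ 0) 2 - z (σ 2) 2 * z (σ 0) 1|
    ≤ max |z (σ 1) 0 * z (σ 0) 2 - z (σ 1) 2 * z (σ 0) 0|
      |z (σ 1) 1 * z (σ 0) 2 - z (σ 1) 2 * z (σ 0) 1|

lemma exists_rowsOrdered (z : Z3) : ∃ σ, RowsOrdered σ z := by
  obtain ⟨i, hi⟩ := Finite.exists_max fun i => |z i 2|
  set σ : Equiv.Perm (Fin 3) := Equiv.swap 0 i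
  have h0 : σ 0 = i := Equiv.swap_apply_left _ _
  by_cases h : max |z (σ 2) 0 * z (σ 0) 2 - z (σ 2) 2 * z (σ 0) 0|
      |z (σ 2) 1 * z (σ 0) 2 - z (σ 2) 2 * z (σ 0) 1|
    ≤ max |z (σ 1) 0 * z (σ 0) 2 - z (σ 1) 2 * z (σ 0) 0|
      |z (σ 1) 1 * z (σ 0) 2 - z (σ 1) 2 * z (σ 0) 1|
  · exact ⟨σ, by rwa [h0], h⟩
  · refine ⟨σ * Equiv.swap 1 2, ?_, ?_⟩
    · simp only [Equiv.Perm.mul_apply]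
      rw [Equiv.swap_apply_of_ne_of_ne (a := (1 : Fin 3)) (b := 2) (x := 0) (by decide) (by decide), h0]; exact hi
    · simp only [Equiv.Perm.mul_apply]
      rw [Equiv.swap_apply_of_ne_of_ne (a := (1 : Fin 3)) (b := 2) (x := 0) (by decide) (by decide),
        Equiv.swap_apply_left, Equiv.swap_apply_right]
      exact (not_le.mp h).le

lemma card_le_of_rows_mem (T : Finset (Fin 3 → ℤ)) (Z : Finset SL3Z)
    (hZ : ∀ z ∈ Z, ∀ i, z.1 i ∈ T) : Z.card ≤ 45 * (6 * T.card ^ 2) := by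
  classical
  choose σ hσ using fun z : SL3Z => exists_rowsOrdered z.1
  have hcard : (Finset.univ ×ˢ (T ×ˢ T) : Finset (Equiv.Perm (Fin 3) × _)).card = 6 * T.card ^ 2 := by
    rw [Finset.card_product, Finset.card_product, Finset.card_univ, Fintype.card_perm]
    simp [Nat.factorial]; ring
  rw [← hcard]
  refine Finset.card_le_mul_card_image_of_maps_to
    (f := fun z => (σ z, (z.1 (σ z 0), z.1 (σ z 1)))) ?_ 45 ?_
  · intro z hz
    simp [hZ z hz]
  · rintro ⟨τ, a, b⟩ -
    set F := Z.filter fun z => (σ z, (z.1 (σ z 0), z.1 (σ z 1))) = (τ, (a, b)) with hF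
    rcases F.eq_empty_or_nonempty with h0 | ⟨z₀, hz₀⟩
    · rw [h0]; simp
    have hmem : ∀ z ∈ F, σ z = τ ∧ z.1 (τ 0) = a ∧ z.1 (τ 1) = b := by
      intro z hz
      have := (Finset.mem_filter.mp hz).2
      simp only [Prod.mk.injEq] at this
      obtain ⟨h1, h2, h3⟩ := this
      rw [h1] at h2 h3
      exact ⟨h1, h2, h3⟩
    have hdet : ∀ z ∈ F, (of ![a, b, z.1 (τ 2)]).det = (Equiv.Perm.sign τ : ℤ) := by
      intro z hz
      obtain ⟨-, h1, h2⟩ := hmem z hz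
      have : (of ![a, b, z.1 (τ 2)]) = z.1.submatrix τ id := by
        ext i j
        fin_cases i
        · simp [← h1]
        · simp [← h2]
        · simp
      rw [this, det_permute]
      simp [z.2]
    have hex : ∀ z ∈ F, ∃ p : ℤ × ℤ, z.1 (τ 2) = z₀.1 (τ 2) + p.1 • a + p.2 • b ∧
        p ∈ Finset.Icc (-4 : ℤ) 4 ×ˢ Finset.Icc (-2 : ℤ) 2 := by
      intro z hz
      obtain ⟨k0, k1, k2⟩ := hmem z hz
      obtain ⟨l0, l1, l2⟩ := hmem z₀ hz₀
      have o := hσ z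
      have o' := hσ z₀
      rw [k0] at o
      rw [l0] at o'
      unfold RowsOrdered at o o'
      rw [k1, k2] at o
      rw [l1, l2] at o'
      obtain ⟨m, n, h, hm, hn⟩ := third_row_close (d := (Equiv.Perm.sign τ : ℤ))
        (by rw [← Units.val_mul, Int.units_mul_self]; rfl) (hdet z₀ hz₀) (hdet z hz)
        (by rw [← k2]; exact o.1 _) (o'.1 _) (o.1 _) o'.2 o.2
      refine ⟨(m, n), h, ?_⟩
      rw [Finset.mem_product, Finset.mem_Icc, Finset.mem_Icc]
      exact ⟨abs_le.mp hm, abs_le.mp hn⟩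
    choose! p hp hp' using hex
    have h45 : (Finset.Icc (-4 : ℤ) 4 ×ˢ Finset.Icc (-2 : ℤ) 2).card = 45 := by simp
    rw [← h45]
    refine Finset.card_le_card_of_injOn p hp' ?_
    intro z hz z' hz' hzz
    obtain ⟨-, k1, k2⟩ := hmem z hz
    obtain ⟨-, l1, l2⟩ := hmem z' hz'
    have e2 : z.1 (τ 2) = z'.1 (τ 2) := by rw [hp z hz, hp z' hz', hzz]
    apply Subtype.ext
    ext i j
    obtain ⟨i, rfl⟩ := τ.surjective i
    fin_cases i
    · exact congrFun (k1.trans l1.symm) j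
    · exact congrFun (k2.trans l2.symm) j
    · exact congrFun e2 j

lemma sum_inv_sq_le_of_card_le {ι : Type*} (S : Finset ι) (Q : ι → ℕ) (C L : ℕ)
    (h1 : ∀ i ∈ S, 1 ≤ Q i) (hL : ∀ i ∈ S, Q i < 2 ^ L)
    (hC : ∀ R : ℕ, 1 ≤ R → (S.filter fun i => Q i ≤ R).card ≤ C * R ^ 2) :
    ∑ i ∈ S, (1 : ℝ) / (Q i : ℝ) ^ 2 ≤ 4 * C * L := by
  classical
  have hmaps : ∀ i ∈ S, Nat.log 2 (Q i) ∈ Finset.range L := by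
    intro i hi
    rw [Finset.mem_range]
    exact Nat.log_lt_of_lt_pow (by have := h1 i hi; omega) (hL i hi)
  rw [← Finset.sum_fiberwise_of_maps_to hmaps]
  have : ∀ k ∈ Finset.range L, ∑ i ∈ S with Nat.log 2 (Q i) = k, (1 : ℝ) / (Q i : ℝ) ^ 2 ≤ 4 * C := by
    intro k _
    have hb : ∀ i ∈ S.filter (fun i => Nat.log 2 (Q i) = k),
        (1 : ℝ) / (Q i : ℝ) ^ 2 ≤ 1 / ((2 : ℝ) ^ k) ^ 2 := by
      intro i hi
      obtain ⟨hi, hk⟩ := Finset.mem_filter.mp hi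
      have : 2 ^ k ≤ Q i := hk ▸ Nat.pow_log_le_self 2 (by have := h1 i hi; omega)
      have : (2 : ℝ) ^ k ≤ Q i := by exact_mod_cast this
      gcongr
    refine (Finset.sum_le_card_nsmul _ _ _ hb).trans ?_
    have hc : ((S.filter fun i => Nat.log 2 (Q i) = k).card : ℝ) ≤ C * ((2 : ℝ) ^ (k + 1)) ^ 2 := by
      have := (Finset.card_le_card (s := S.filter fun i => Nat.log 2 (Q i) = k)
        (t := S.filter fun i => Q i ≤ 2 ^ (k + 1)) ?_).trans (hC (2 ^ (k + 1)) Nat.one_le_two_pow)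
      · exact_mod_cast this
      · intro i hi
        obtain ⟨hi, hk⟩ := Finset.mem_filter.mp hi
        exact Finset.mem_filter.mpr ⟨hi, (hk ▸ Nat.lt_pow_succ_log_self (by norm_num) _).le⟩
    rw [nsmul_eq_mul]
    calc _ ≤ C * ((2 : ℝ) ^ (k + 1)) ^ 2 * (1 / ((2 : ℝ) ^ k) ^ 2) := by gcongr
      _ = 4 * C := by rw [pow_succ]; field_simp; ring
  refine (Finset.sum_le_card_nsmul _ _ _ this).trans ?_
  rw [Finset.card_range, nsmul_eq_mul]; linarith

lemma toR_adjugate (x : Z3) : (toR x).adjugate = toR x.adjugate := by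
  rw [toR_eq, toR_eq, RingHom.map_adjugate]

lemma toR_inv (g : SL3Z) : toR (g⁻¹).1 = (toR g.1).adjugate := by
  rw [toR_adjugate, Matrix.SpecialLinearGroup.coe_inv]

namespace ColBox
variable {h : ℕ} {g : Z3}

lemma adj22_ge (H : ColBox h g) : 12 * (h : ℤ) ^ 2 ≤ g.adjugate 2 2 := by
  have hh : (0 : ℤ) ≤ h := by positivity
  have e : g.adjugate 2 2 = g 0 0 * g 1 1 - g 0 1 * g 1 0 := by simp [adjugate_fin_three]
  have a1 : (4 * (h : ℤ)) * (4 * h) ≤ g 0 0 * g 1 1 :=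
    mul_le_mul H.l00 H.l11 (by positivity) (by linarith [H.l00])
  have a2 : g 0 1 * g 1 0 ≤ (2 * (h : ℤ)) * (2 * h) :=
    mul_le_mul H.u01 H.u10 (by linarith [H.l10]) (by positivity)
  rw [e]; linarith

lemma abs_adj2_le (H : ColBox h g) (i : Fin 2) : |g.adjugate 2 i.castSucc| ≤ 12 * (h : ℤ) ^ 2 := by
  have hh : (0 : ℤ) ≤ h := by positivity
  have b1 : 0 ≤ g 1 0 * g 2 1 := mul_nonneg (by linarith [H.l10]) (by linarith [H.l21])
  have b2 : g 1 0 * g 2 1 ≤ (2 * (h : ℤ)) * (2 * h) :=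
    mul_le_mul H.u10 H.u21 (by linarith [H.l21]) (by positivity)
  have b3 : 0 ≤ g 1 1 * g 2 0 := mul_nonneg (by linarith [H.l11]) (by linarith [H.l20])
  have b4 : g 1 1 * g 2 0 ≤ (5 * (h : ℤ)) * (2 * h) :=
    mul_le_mul H.u11 H.u20 (by linarith [H.l20]) (by positivity)
  have c1 : 0 ≤ g 0 1 * g 2 0 := mul_nonneg (by linarith [H.l01]) (by linarith [H.l20])
  have c2 : g 0 1 * g 2 0 ≤ (2 * (h : ℤ)) * (2 * h) :=
    mul_le_mul H.u01 H.u20 (by linarith [H.l20]) (by positivity)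
  have c3 : 0 ≤ g 0 0 * g 2 1 := mul_nonneg (by linarith [H.l00]) (by linarith [H.l21])
  have c4 : g 0 0 * g 2 1 ≤ (5 * (h : ℤ)) * (2 * h) :=
    mul_le_mul H.u00 H.u21 (by linarith [H.l21]) (by positivity)
  have hp : 0 ≤ (h : ℤ) ^ 2 := by positivity
  fin_cases i
  · have e : g.adjugate 2 0 = g 1 0 * g 2 1 - g 1 1 * g 2 0 := by simp [adjugate_fin_three]
    change |g.adjugate 2 0| ≤ _
    rw [e, abs_le]; constructor <;> linarith
  · have e : g.adjugate 2 1 = -(g 0 0 * g 2 1) + g 0 1 * g 2 0 := by simp [adjugate_fin_three]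
    change |g.adjugate 2 1| ≤ _
    rw [e, abs_le]; constructor <;> linarith

lemma real_adj22_ge (H : ColBox h g) : 12 * (h : ℝ) ^ 2 ≤ (toR g).adjugate 2 2 := by
  rw [toR_adjugate, toR_apply]; exact_mod_cast H.adj22_ge

lemma abs_nOf_le (H : ColBox h g) (hh : 1 ≤ h) (i : Fin 2) : |nOf (toR g) i| ≤ 1 := by
  have h1 := H.real_adj22_ge
  have h2 : |(toR g).adjugate 2 i.castSucc| ≤ 12 * (h : ℝ) ^ 2 := by
    rw [toR_adjugate, toR_apply]; exact_mod_cast H.abs_adj2_le i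
  have hp : 0 < (h : ℝ) := by exact_mod_cast hh
  have h3 : 0 < (toR g).adjugate 2 2 := lt_of_lt_of_le (by positivity) h1
  rw [nOf, abs_div, abs_of_pos h3, div_le_one h3]
  linarith

lemma eBdd (H : ColBox h g) : EBdd (15 * h) (toR g) := by
  have hh : (0 : ℤ) ≤ h := by positivity
  have : ∀ i j, |g i j| ≤ 15 * (h : ℤ) := by
    intro i j
    fin_cases i <;> fin_cases j <;> simp only [Fin.reduceFinMk, Fin.zero_eta, Fin.mk_one, Fin.isValue]
    · rw [abs_le]; constructor <;> linarith [H.l00, H.u00]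
    · rw [abs_le]; constructor <;> linarith [H.l01, H.u01]
    · linarith [H.b02]
    · rw [abs_le]; constructor <;> linarith [H.l10, H.u10]
    · rw [abs_le]; constructor <;> linarith [H.l11, H.u11]
    · linarith [H.b12]
    · rw [abs_le]; constructor <;> linarith [H.l20, H.u20]
    · rw [abs_le]; constructor <;> linarith [H.l21, H.u21]
    · linarith [H.b22]
  intro i j
  rw [toR_apply]; exact_mod_cast this i j

lemma abs_col_le (H : ColBox h g) (k : Fin 3) (i : Fin 2) : |g k i.castSucc| ≤ 5 * (h : ℤ) := by
  have hh : (0 : ℤ) ≤ h := by positivity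
  fin_cases k <;> fin_cases i <;>
    simp only [Fin.reduceFinMk, Fin.zero_eta, Fin.mk_one, Fin.isValue, Fin.castSucc_zero, Fin.castSucc_one] <;>
    rw [abs_le] <;> constructor <;>
    linarith [H.l00, H.u00, H.l01, H.u01, H.l10, H.u10, H.l11, H.u11, H.l20, H.u20, H.l21, H.u21]

end ColBox

lemma quot_row_identity (r g : Z3) (hg : g.det = 1) (k : Fin 3) :
    (r * g.adjugate) k 0 * g.adjugate 2 2 - (r * g.adjugate) k 2 * g.adjugate 2 0 =
        r k 0 * g 1 1 - r k 1 * g 1 0 ∧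
    (r * g.adjugate) k 1 * g.adjugate 2 2 - (r * g.adjugate) k 2 * g.adjugate 2 1 =
        -(r k 0 * g 0 1) + r k 1 * g 0 0 := by
  rw [det_fin_three] at hg
  simp only [mul_apply, Fin.sum_univ_three, adjugate_fin_three]
  simp
  constructor
  · linear_combination (r k 0 * g 1 1 - r k 1 * g 1 0) * hg
  · linear_combination (-(r k 0 * g 0 1) + r k 1 * g 0 0) * hg

/-- The rows of `γ * γ'⁻¹` are nearly proportional to `(nOf γ', 1)`. -/
lemma quot_row_close {h : ℕ} (hh : 1 ≤ h) {γ γ' : SL3Z} (H : ColBox h γ.1) (H' : ColBox h γ'.1)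
    (k : Fin 3) (i : Fin 2) :
    |toR (γ * γ'⁻¹).1 k i.castSucc - toR (γ * γ'⁻¹).1 k 2 * nOf (toR γ'.1) i| ≤ 5 := by
  have hp : 0 < (h : ℝ) := by exact_mod_cast hh
  have h1 := H'.real_adj22_ge
  have h3 : 0 < (toR γ'.1).adjugate 2 2 := lt_of_lt_of_le (by positivity) h1
  have e : toR (γ * γ'⁻¹).1 k i.castSucc - toR (γ * γ'⁻¹).1 k 2 * nOf (toR γ'.1) i =
    (toR (γ * γ'⁻¹).1 k i.castSucc * (toR γ'.1).adjugate 2 2 -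
      toR (γ * γ'⁻¹).1 k 2 * (toR γ'.1).adjugate 2 i.castSucc) / (toR γ'.1).adjugate 2 2 := by
    rw [nOf]; field_simp
  rw [e, abs_div, abs_of_pos h3, div_le_iff₀ h3]
  refine le_trans ?_ (mul_le_mul_of_nonneg_left h1 (by norm_num))
  have q := quot_row_identity γ.1 γ'.1 γ'.2 k
  rw [Matrix.SpecialLinearGroup.coe_mul, Matrix.SpecialLinearGroup.coe_inv]
  have ex : ∀ a b c d : ℤ, |a| ≤ 5 * h → |b| ≤ 5 * h → |c| ≤ 5 * h → |d| ≤ 5 * h →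
      |a * b| + |c * d| ≤ 60 * (h : ℤ) ^ 2 := by
    intro a b c d ha hb hc hd
    rw [abs_mul, abs_mul]
    have := mul_le_mul ha hb (abs_nonneg _) (by positivity)
    have := mul_le_mul hc hd (abs_nonneg _) (by positivity)
    have : 0 ≤ (h : ℤ) ^ 2 := by positivity
    linarith
  rw [toR_adjugate]
  simp only [toR_apply]
  fin_cases i
  · have : |(γ.1 * γ'.1.adjugate) k 0 * γ'.1.adjugate 2 2 -
      (γ.1 * γ'.1.adjugate) k 2 * γ'.1.adjugate 2 0| ≤ 60 * (h : ℤ) ^ 2 := by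
      rw [q.1]
      refine (abs_sub _ _).trans (ex _ _ _ _ (H.abs_col_le k 0) (H'.abs_col_le 1 1)
        (H.abs_col_le k 1) (H'.abs_col_le 1 0))
    have h2 : |(((γ.1 * γ'.1.adjugate) k 0 * γ'.1.adjugate 2 2 -
      (γ.1 * γ'.1.adjugate) k 2 * γ'.1.adjugate 2 0 : ℤ) : ℝ)| ≤ 60 * (h : ℝ) ^ 2 := by
      exact_mod_cast this
    push_cast at h2
    refine h2.trans (le_of_eq ?_); ring
  · have : |(γ.1 * γ'.1.adjugate) k 1 * γ'.1.adjugate 2 2 -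
      (γ.1 * γ'.1.adjugate) k 2 * γ'.1.adjugate 2 1| ≤ 60 * (h : ℤ) ^ 2 := by
      rw [q.2]
      refine (abs_add_le _ _).trans ?_
      rw [abs_neg]
      exact ex _ _ _ _ (H.abs_col_le k 0) (H'.abs_col_le 0 1)
        (H.abs_col_le k 1) (H'.abs_col_le 0 0)
    have h2 : |(((γ.1 * γ'.1.adjugate) k 1 * γ'.1.adjugate 2 2 -
      (γ.1 * γ'.1.adjugate) k 2 * γ'.1.adjugate 2 1 : ℤ) : ℝ)| ≤ 60 * (h : ℝ) ^ 2 := by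
      exact_mod_cast this
    push_cast at h2
    refine h2.trans (le_of_eq ?_); ring

/-- The size of the last column. -/
def colQ (z : Z3) : ℕ := Finset.univ.sup fun k => (z k 2).natAbs

lemma natAbs_le_colQ (z : Z3) (k : Fin 3) : (z k 2).natAbs ≤ colQ z :=
  Finset.le_sup (f := fun k => (z k 2).natAbs) (Finset.mem_univ k)

lemma exists_natAbs_eq_colQ (z : Z3) : ∃ k, (z k 2).natAbs = colQ z := by
  obtain ⟨k, -, hk⟩ := Finset.exists_mem_eq_sup Finset.univ Finset.univ_nonempty
    fun k => (z k 2).natAbs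
  exact ⟨k, hk.symm⟩

lemma one_le_colQ (g : SL3Z) : 1 ≤ colQ g.1 := by
  by_contra h
  have h0 : ∀ k, g.1 k 2 = 0 := fun k => by
    have := natAbs_le_colQ g.1 k; omega
  have := g.2
  rw [det_eq_zero_of_column_eq_zero 2 h0] at this
  exact zero_ne_one this

lemma card_tube_le (n : Fin 2 → ℝ) (R : ℕ) (hR : 1 ≤ R) : ∃ T : Finset (Fin 3 → ℤ), T.card ≤ 432 * R ∧
    ∀ q : Fin 3 → ℤ, |q 2| ≤ R → (∀ i : Fin 2, |(q i.castSucc : ℝ) - q 2 * n i| ≤ 5) → q ∈ T := by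
  classical
  refine ⟨(Finset.Icc (-(R : ℤ)) R ×ˢ (Finset.Icc (0 : ℤ) 11 ×ˢ Finset.Icc (0 : ℤ) 11)).image
    fun p => ![⌊p.1 * n 0⌋ - 5 + p.2.1, ⌊p.1 * n 1⌋ - 5 + p.2.2, p.1], ?_, ?_⟩
  · refine Finset.card_image_le.trans ?_
    simp only [Finset.card_product, Int.card_Icc]
    have e1 : ((R : ℤ) + 1 - -(R : ℤ)).toNat = 2 * R + 1 := by omega
    have e2 : ((11 : ℤ) + 1 - 0).toNat = 12 := rfl
    rw [e1, e2]; omega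
  · intro q h2 hi
    have aux : ∀ (a : ℤ) (x : ℝ), |(a : ℝ) - x| ≤ 5 → 0 ≤ a - ⌊x⌋ + 5 ∧ a - ⌊x⌋ + 5 ≤ 11 := by
      intro a x hx
      rw [abs_le] at hx
      have f1 := Int.floor_le x
      have f2 := Int.lt_floor_add_one x
      constructor
      · have : (-5 : ℝ) ≤ ((a - ⌊x⌋ : ℤ) : ℝ) := by push_cast; linarith
        have : (-5 : ℤ) ≤ a - ⌊x⌋ := by exact_mod_cast this
        omega
      · have : ((a - ⌊x⌋ : ℤ) : ℝ) < 6 + 1 := by push_cast; linarith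
        have : a - ⌊x⌋ < 6 + 1 := by exact_mod_cast this
        omega
    have a0 := aux (q 0) (q 2 * n 0) (by simpa using hi 0)
    have a1 := aux (q 1) (q 2 * n 1) (by simpa using hi 1)
    rw [Finset.mem_image]
    refine ⟨(q 2, (q 0 - ⌊q 2 * n 0⌋ + 5, q 1 - ⌊q 2 * n 1⌋ + 5)), ?_, ?_⟩
    · simp only [Finset.mem_product, Finset.mem_Icc]
      rw [abs_le] at h2
      exact ⟨h2, a0, a1⟩
    · ext i; fin_cases i <;> simp

lemma card_colQ_le {h : ℕ} (hh : 1 ≤ h) (S : Finset SL3Z) (hS : ∀ g ∈ S, ColBox h g.1)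
    {γ' : SL3Z} (H' : ColBox h γ'.1) (R : ℕ) (hR : 1 ≤ R) :
    (S.filter fun γ => colQ (γ * γ'⁻¹).1 ≤ R).card ≤ (270 * 432 ^ 2) * R ^ 2 := by
  classical
  obtain ⟨T, hT, hmem⟩ := card_tube_le (nOf (toR γ'.1)) R hR
  have h1 := card_le_of_rows_mem T ((S.filter fun γ => colQ (γ * γ'⁻¹).1 ≤ R).image
    fun γ => γ * γ'⁻¹) ?_
  · rw [Finset.card_image_of_injective _ (mul_left_injective _)] at h1
    refine h1.trans ?_
    have : T.card ^ 2 ≤ (432 * R) ^ 2 := Nat.pow_le_pow_left hT 2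
    calc 45 * (6 * T.card ^ 2) ≤ 45 * (6 * (432 * R) ^ 2) := by gcongr
      _ = _ := by ring
  · intro z hz i
    obtain ⟨γ, hγ, rfl⟩ := Finset.mem_image.mp hz
    obtain ⟨hγS, hγQ⟩ := Finset.mem_filter.mp hγ
    apply hmem
    · have := (natAbs_le_colQ (γ * γ'⁻¹).1 i).trans hγQ
      rw [Int.abs_eq_natAbs]; exact_mod_cast this
    · intro k
      exact quot_row_close hh (hS γ hγS) H' i k

lemma colQ_quot_le {h : ℕ} {γ γ' : SL3Z} (H : ColBox h γ.1) (H' : ColBox h γ'.1) :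
    (colQ (γ * γ'⁻¹).1 : ℝ) ≤ 20250 * (h : ℝ) ^ 3 := by
  obtain ⟨k, hk⟩ := exists_natAbs_eq_colQ (γ * γ'⁻¹).1
  have h1 := (H.eBdd.mul H'.eBdd.adjugate) k 2
  rw [← toR_inv, ← toR_mul, ← Matrix.SpecialLinearGroup.coe_mul, toR_apply] at h1
  rw [← hk, Nat.cast_natAbs, Int.cast_abs]
  refine h1.trans (le_of_eq ?_); ring

lemma sum_inv_colQ_le {j : ℕ} (S : Finset SL3Z) (hS : ∀ g ∈ S, ColBox (2 ^ j) g.1)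
    {γ' : SL3Z} (H' : ColBox (2 ^ j) γ'.1) :
    ∑ γ ∈ S, (1 : ℝ) / (colQ (γ * γ'⁻¹).1 : ℝ) ^ 2 ≤ 4 * (270 * 432 ^ 2) * (3 * j + 15) := by
  have := sum_inv_sq_le_of_card_le S (fun γ => colQ (γ * γ'⁻¹).1) (270 * 432 ^ 2) (3 * j + 15)
    (fun γ _ => one_le_colQ _) ?_ (card_colQ_le Nat.one_le_two_pow S hS H')
  · push_cast at this; refine this.trans (le_of_eq ?_); norm_num
  · intro γ hγ
    have h1 := colQ_quot_le (hS γ hγ) H'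
    have h2 : colQ (γ * γ'⁻¹).1 ≤ 20250 * (2 ^ j) ^ 3 := by exact_mod_cast h1
    refine h2.trans_lt ?_
    rw [pow_add, pow_mul', mul_comm]
    gcongr; norm_num

/-- Squared Euclidean length of a vector in three dimensions. -/
def nsq (a : Fin 3 → ℝ) : ℝ := a 0 ^ 2 + a 1 ^ 2 + a 2 ^ 2

set_option maxHeartbeats 1000000 in
lemma nsq_le_of_nearly_reduced {a b c : Fin 3 → ℝ} {κ η d : ℝ} (hκ : 0 < κ) (hκ1 : κ ≤ 1)
    (hη : η = κ ^ 2 / 10) (ha : κ ^ 2 ≤ nsq a) (hb : κ ^ 2 ≤ nsq b) (hac : nsq a ≤ nsq c)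
    (hbc : nsq b ≤ nsq c)
    (ma : ∀ m : ℤ, nsq a ≤ nsq (a + (m : ℝ) • b) + η) (mb : ∀ m : ℤ, nsq b ≤ nsq (b + (m : ℝ) • a) + η)
    (mc : ∀ m n : ℤ, nsq c ≤ nsq (c + (m : ℝ) • a + (n : ℝ) • b) + η)
    (hd : d = a 0 * (b 1 * c 2 - b 2 * c 1) - a 1 * (b 0 * c 2 - b 2 * c 0) +
      a 2 * (b 0 * c 1 - b 1 * c 0)) (hd1 : d ^ 2 ≤ 1) : nsq c ≤ 8 / κ ^ 4 := by
  have hκ2 : 0 < κ ^ 2 := by positivity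
  obtain ⟨t, ht⟩ : ∃ t, t = a 0 * b 0 + a 1 * b 1 + a 2 * b 2 := ⟨_, rfl⟩
  have hexp : ∀ (x y : Fin 3 → ℝ) (m : ℝ), nsq (x + m • y) =
      nsq x + 2 * m * (x 0 * y 0 + x 1 * y 1 + x 2 * y 2) + m ^ 2 * nsq y := by
    intro x y m; simp [nsq]; ring
  have a1 := ma 1
  have a2 := ma (-1)
  have b1 := mb 1
  have b2 := mb (-1)
  rw [hexp] at a1 a2 b1 b2
  push_cast at a1 a2 b1 b2
  rw [← ht] at a1 a2
  rw [show b 0 * a 0 + b 1 * a 1 + b 2 * a 2 = t by rw [ht]; ring] at b1 b2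
  have htb : 2 * |t| ≤ nsq b + η := by
    rcases abs_cases t with h | h <;> linarith
  have hta : 2 * |t| ≤ nsq a + η := by
    rcases abs_cases t with h | h <;> linarith
  -- the Gram determinant
  obtain ⟨D, hD⟩ : ∃ D, D = nsq a * nsq b - t ^ 2 := ⟨_, rfl⟩
  have hDlow : 69 / 100 * κ ^ 4 ≤ D := by
    have e1 : (2 * |t|) * (2 * |t|) ≤ (nsq a + η) * (nsq b + η) :=
      mul_le_mul hta htb (by positivity) (by linarith)
    have e2 : (nsq a + η) * (nsq b + η) ≤ (11 / 10 * nsq a) * (11 / 10 * nsq b) :=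
      mul_le_mul (by linarith) (by linarith) (by linarith) (by linarith)
    have e3 : |t| * |t| = t ^ 2 := by rw [abs_mul_abs_self]; ring
    have e4 : κ ^ 2 * κ ^ 2 ≤ nsq a * nsq b := mul_le_mul ha hb hκ2.le (by linarith)
    rw [hD]; nlinarith
  have hDpos : 0 < D := lt_of_lt_of_le (by positivity) hDlow
  obtain ⟨u, hu⟩ : ∃ u, u = ((c 0 * a 0 + c 1 * a 1 + c 2 * a 2) * nsq b -
    (c 0 * b 0 + c 1 * b 1 + c 2 * b 2) * t) / D := ⟨_, rfl⟩
  obtain ⟨v, hv⟩ : ∃ v, v = ((c 0 * b 0 + c 1 * b 1 + c 2 * b 2) * nsq a -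
    (c 0 * a 0 + c 1 * a 1 + c 2 * a 2) * t) / D := ⟨_, rfl⟩
  have hmain : ∀ x y : ℝ, nsq (c + x • a + y • b) =
      (u + x) ^ 2 * nsq a + 2 * (u + x) * (v + y) * t + (v + y) ^ 2 * nsq b + d ^ 2 / D := by
    intro x y
    have hu' : u * D = (c 0 * a 0 + c 1 * a 1 + c 2 * a 2) * nsq b -
      (c 0 * b 0 + c 1 * b 1 + c 2 * b 2) * t := by rw [hu]; field_simp
    have hv' : v * D = (c 0 * b 0 + c 1 * b 1 + c 2 * b 2) * nsq a -
      (c 0 * a 0 + c 1 * a 1 + c 2 * a 2) * t := by rw [hv]; field_simp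
    have k1 : u * nsq a + v * t = c 0 * a 0 + c 1 * a 1 + c 2 * a 2 := by
      apply mul_right_cancel₀ hDpos.ne'
      linear_combination nsq a * hu' + t * hv' - (c 0 * a 0 + c 1 * a 1 + c 2 * a 2) * hD
    have k2 : u * t + v * nsq b = c 0 * b 0 + c 1 * b 1 + c 2 * b 2 := by
      apply mul_right_cancel₀ hDpos.ne'
      linear_combination t * hu' + nsq b * hv' - (c 0 * b 0 + c 1 * b 1 + c 2 * b 2) * hD
    have k3 : nsq c = u ^ 2 * nsq a + 2 * u * v * t + v ^ 2 * nsq b + d ^ 2 / D := by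
      have g : nsq c * D = u * D * (c 0 * a 0 + c 1 * a 1 + c 2 * a 2) +
          v * D * (c 0 * b 0 + c 1 * b 1 + c 2 * b 2) + d ^ 2 := by
        rw [hu', hv', hd, hD, ht]; simp only [nsq]; ring
      field_simp
      linear_combination g - u * D * k1 - v * D * k2
    have k4 : nsq (c + x • a + y • b) = nsq c + x ^ 2 * nsq a + y ^ 2 * nsq b + 2 * x * y * t +
        2 * x * (c 0 * a 0 + c 1 * a 1 + c 2 * a 2) + 2 * y * (c 0 * b 0 + c 1 * b 1 + c 2 * b 2) := by
      rw [ht]; simp [nsq]; ring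
    rw [k4, k3, ← k1, ← k2]; ring
  have h5 := mc (-round u) (-round v)
  rw [hmain] at h5
  have ru := abs_sub_round u
  have rv := abs_sub_round v
  push_cast at h5
  obtain ⟨x, hx⟩ : ∃ x, x = u + -(round u : ℝ) := ⟨_, rfl⟩
  obtain ⟨y, hy⟩ : ∃ y, y = v + -(round v : ℝ) := ⟨_, rfl⟩
  rw [← hx, ← hy] at h5
  have hx1 : |x| ≤ 1 / 2 := by rw [hx, ← sub_eq_add_neg]; exact ru
  have hy1 : |y| ≤ 1 / 2 := by rw [hy, ← sub_eq_add_neg]; exact rv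
  have q1 : x ^ 2 * nsq a ≤ 1 / 4 * nsq c := by
    have : x ^ 2 ≤ 1 / 4 := by rw [← sq_abs]; nlinarith [abs_nonneg x]
    exact mul_le_mul this hac (by linarith) (by norm_num)
  have q2 : y ^ 2 * nsq b ≤ 1 / 4 * nsq c := by
    have : y ^ 2 ≤ 1 / 4 := by rw [← sq_abs]; nlinarith [abs_nonneg y]
    exact mul_le_mul this hbc (by linarith) (by norm_num)
  have q3 : 2 * x * y * t ≤ 1 / 4 * (nsq c + η) := by
    have w1 : |x| * |y| ≤ 1 / 2 * (1 / 2) := mul_le_mul hx1 hy1 (abs_nonneg _) (by norm_num)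
    have w2 : (|x| * |y|) * (2 * |t|) ≤ (1 / 2 * (1 / 2)) * (nsq a + η) :=
      mul_le_mul w1 hta (by positivity) (by norm_num)
    have w3 : 2 * x * y * t ≤ (|x| * |y|) * (2 * |t|) := by
      refine (le_abs_self _).trans (le_of_eq ?_)
      simp only [abs_mul]; rw [abs_of_pos (by norm_num : (0:ℝ) < 2)]; ring
    linarith
  have q4 : d ^ 2 / D ≤ 100 / (69 * κ ^ 4) := by
    rw [div_le_div_iff₀ hDpos (by positivity)]
    have : d ^ 2 * (69 * κ ^ 4) ≤ 1 * (69 * κ ^ 4) := mul_le_mul_of_nonneg_right hd1 (by positivity)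
    linarith
  have q5 : η ≤ 1 / 10 * (1 / κ ^ 4) := by
    have : κ ^ 2 ≤ 1 := pow_le_one₀ hκ.le hκ1
    have : 1 ≤ 1 / κ ^ 4 := by rw [le_div_iff₀ (by positivity)]; rw [one_mul]; exact pow_le_one₀ hκ.le hκ1
    linarith
  have q6 : 100 / (69 * κ ^ 4) = 100 / 69 * (1 / κ ^ 4) := by field_simp
  have q7 : 8 / κ ^ 4 = 8 * (1 / κ ^ 4) := by ring
  have q8 : 0 < 1 / κ ^ 4 := by positivity
  linarith

/-- The elementary move adding `m`, `n` times the two other columns to column `k`. -/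
lemma exists_column_move (k : Fin 3) (m n : ℤ) : ∃ γ : SL3Z, ∀ B : M3,
    (∀ i, (B * toR γ.1) i k = B i k + m * B i (k + 1) + n * B i (k + 2)) ∧
    (∀ i, (B * toR γ.1) i (k + 1) = B i (k + 1)) ∧ ∀ i, (B * toR γ.1) i (k + 2) = B i (k + 2) := by
  fin_cases k
  · refine ⟨⟨!![1, 0, 0; m, 1, 0; n, 0, 1], by simp [det_fin_three]⟩, fun B => ⟨?_, ?_, ?_⟩⟩ <;>
      intro i <;> simp [mul_apply, Fin.sum_univ_three] <;> ring
  · refine ⟨⟨!![1, n, 0; 0, 1, 0; 0, m, 1], by simp [det_fin_three]⟩, fun B => ⟨?_, ?_, ?_⟩⟩ <;>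
      intro i <;> simp [mul_apply, Fin.sum_univ_three] <;> ring
  · refine ⟨⟨!![1, 0, m; 0, 1, n; 0, 0, 1], by simp [det_fin_three]⟩, fun B => ⟨?_, ?_, ?_⟩⟩ <;>
      intro i <;> simp [mul_apply, Fin.sum_univ_three] <;> ring

/-- Some nonzero integral combination of the columns of `B` is shorter than `κ`. -/
def Cusp (κ : ℝ) (B : M3) : Prop :=
  ∃ q : Fin 3 → ℤ, q ≠ 0 ∧ ∀ i, |(B *ᵥ fun j => (q j : ℝ)) i| < κ

lemma sum_nsq_cyclic (B : M3) (k : Fin 3) :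
    ∑ l, nsq (fun i => B i l) = nsq (fun i => B i k) + nsq (fun i => B i (k + 1)) +
      nsq (fun i => B i (k + 2)) := by
  rw [Fin.sum_univ_three]
  fin_cases k <;> simp <;> ring

lemma exists_reduced {B : M3} (hdet : B.det ^ 2 ≤ 1) {κ : ℝ} (hκ : 0 < κ) (hκ1 : κ ≤ 1)
    (hB : ¬ Cusp κ B) : ∃ γ : SL3Z, EBdd (3 / κ ^ 2) (B * toR γ.1) := by
  set f : SL3Z → ℝ := fun γ => ∑ l, nsq (fun i => (B * toR γ.1) i l) with hf
  have hf0 : ∀ γ, 0 ≤ f γ := fun γ => Finset.sum_nonneg fun l _ => by unfold nsq; positivity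
  obtain ⟨η, hη⟩ : ∃ η, η = κ ^ 2 / 10 := ⟨_, rfl⟩
  have hηpos : 0 < η := by rw [hη]; positivity
  have hbdd : BddBelow (Set.range f) := ⟨0, by rintro _ ⟨γ, rfl⟩; exact hf0 γ⟩
  obtain ⟨γ, hγ⟩ := exists_lt_of_ciInf_lt (lt_add_of_pos_right (⨅ γ, f γ) hηpos)
  have hmin : ∀ γ', f γ ≤ f γ' + η := fun γ' => by
    have := ciInf_le hbdd γ'; linarith
  refine ⟨γ, ?_⟩
  set X := B * toR γ.1 with hX
  have hmove : ∀ (k : Fin 3) (m n : ℤ), nsq (fun i => X i k) ≤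
      nsq ((fun i => X i k) + (m : ℝ) • (fun i => X i (k + 1)) + (n : ℝ) • fun i => X i (k + 2)) + η := by
    intro k m n
    obtain ⟨δ, hδ⟩ := exists_column_move k m n
    have h1 := hmin (γ * δ)
    rw [hf] at h1
    simp only [sum_nsq_cyclic _ k] at h1
    rw [Matrix.SpecialLinearGroup.coe_mul, toR_mul, ← Matrix.mul_assoc, ← hX] at h1
    obtain ⟨e1, e2, e3⟩ := hδ X
    simp only [e1, e2, e3] at h1
    have e4 : ((fun i => X i k) + (m : ℝ) • (fun i => X i (k + 1)) + (n : ℝ) • fun i => X i (k + 2)) =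
      fun i => X i k + m * X i (k + 1) + n * X i (k + 2) := by ext i; simp
    rw [e4]; linarith
  have hlow : ∀ k, κ ^ 2 ≤ nsq (fun i => X i k) := by
    intro k
    have hq : (fun i => γ.1 i k) ≠ 0 := by
      intro h0
      have := γ.2
      rw [det_eq_zero_of_column_eq_zero k (fun i => congrFun h0 i)] at this
      exact zero_ne_one this
    have : ∃ i, κ ≤ |X i k| := by
      by_contra! hall
      exact hB ⟨_, hq, fun i => by simpa [hX, mul_apply, mulVec, dotProduct] using hall i⟩
    obtain ⟨i, hi⟩ := this
    have h2 : κ ^ 2 ≤ (X i k) ^ 2 := by rw [← sq_abs (X i k)]; gcongr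
    unfold nsq
    fin_cases i <;> simp only [Fin.reduceFinMk, Fin.zero_eta, Fin.mk_one, Fin.isValue] at h2 <;>
      linarith [sq_nonneg (X 0 k), sq_nonneg (X 1 k), sq_nonneg (X 2 k)]
  have hdX : X.det ^ 2 ≤ 1 := by rw [hX, det_mul, toR_det_SL, mul_one]; exact hdet
  obtain ⟨k, hk⟩ := Finite.exists_max fun k => nsq (fun i => X i k)
  have hfin : nsq (fun i => X i k) ≤ 8 / κ ^ 4 := by
    refine nsq_le_of_nearly_reduced (a := fun i => X i (k + 1)) (b := fun i => X i (k + 2)) (d := X.det)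
      hκ hκ1 hη (hlow _) (hlow _) (hk _) (hk _) ?_ ?_ ?_ ?_ hdX
    · intro m
      have := hmove (k + 1) m 0
      rw [show k + 1 + 1 = k + 2 by fin_cases k <;> rfl] at this
      simpa using this
    · intro m
      have := hmove (k + 2) 0 m
      rw [show k + 2 + 2 = k + 1 by fin_cases k <;> rfl] at this
      simpa using this
    · exact hmove k
    · rw [det_fin_three]
      fin_cases k <;> simp <;> ring
  intro i l
  have h3 : (X i l) ^ 2 ≤ (3 / κ ^ 2) ^ 2 := by
    have h4 : nsq (fun i => X i l) ≤ 8 / κ ^ 4 := (hk l).trans hfin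
    have h5 : (X i l) ^ 2 ≤ nsq (fun i => X i l) := by
      unfold nsq
      fin_cases i <;> simp only [Fin.reduceFinMk, Fin.zero_eta, Fin.mk_one, Fin.isValue] <;>
        linarith [sq_nonneg (X 0 l), sq_nonneg (X 1 l), sq_nonneg (X 2 l)]
    have h6 : (3 / κ ^ 2) ^ 2 = 9 / κ ^ 4 := by rw [div_pow, ← pow_mul]; norm_num
    have h7 : 8 / κ ^ 4 ≤ 9 / κ ^ 4 := by gcongr; norm_num
    linarith
  exact abs_le_of_sq_le_sq h3 (by positivity)

lemma EBdd.nonneg {K : ℝ} {A : M3} (h : EBdd K A) : 0 ≤ K := (abs_nonneg _).trans (h 0 0)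

lemma exists_finset_SL3Z_eBdd (N : ℕ) : ∃ Z : Finset SL3Z, Z.card ≤ (2 * N + 1) ^ 9 ∧
    ∀ γ : SL3Z, EBdd N (toR γ.1) → γ ∈ Z := by
  classical
  set P : Finset (Fin 3 → Fin 3 → ℤ) :=
    Fintype.piFinset fun _ => Fintype.piFinset fun _ => Finset.Icc (-(N : ℤ)) N
  have hinj : Function.Injective fun γ : SL3Z => (γ.1 : Fin 3 → Fin 3 → ℤ) := Subtype.val_injective
  refine ⟨P.preimage (fun γ : SL3Z => (γ.1 : Fin 3 → Fin 3 → ℤ)) hinj.injOn, ?_, ?_⟩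
  · refine (Finset.card_preimage _ _ _).le.trans ((Finset.card_filter_le _ _).trans ?_)
    rw [Fintype.card_piFinset]
    simp only [Fintype.card_piFinset, Int.card_Icc, Finset.prod_const, Finset.card_univ, Fintype.card_fin]
    have : ((N : ℤ) + 1 - -(N : ℤ)).toNat = 2 * N + 1 := by omega
    rw [this, ← pow_mul]
  · intro γ hγ
    refine Finset.mem_preimage.mpr (Fintype.mem_piFinset.mpr ?_)
    intro i
    rw [Fintype.mem_piFinset]
    intro j
    have := hγ i j
    rw [toR_apply] at this
    have h2 : |γ.1 i j| ≤ (N : ℤ) := by exact_mod_cast this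
    rw [Finset.mem_Icc]; exact abs_le.mp h2

/-- Recover a right factor: `Y = adj(X) (X Y) / det X`. -/
lemma EBdd.of_mul {K L : ℝ} {X Y : M3} (hX : EBdd K X) (hXY : EBdd L (X * Y)) (hd : 1 / 2 ≤ |X.det|) :
    EBdd (12 * K ^ 2 * L) Y := by
  intro i j
  have h1 := (hX.adjugate.mul hXY) i j
  rw [← Matrix.mul_assoc, adjugate_mul, smul_mul, Matrix.one_mul, Matrix.smul_apply, smul_eq_mul, abs_mul] at h1
  have : 1 / 2 * |Y i j| ≤ |X.det| * |Y i j| := mul_le_mul_of_nonneg_right hd (abs_nonneg _)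
  linarith

/-- Recover a left factor. -/
lemma EBdd.of_mul_right {K L : ℝ} {X Y : M3} (hY : EBdd K Y) (hXY : EBdd L (X * Y))
    (hd : 1 / 2 ≤ |Y.det|) : EBdd (12 * K ^ 2 * L) X := by
  intro i j
  have h1 := (hXY.mul hY.adjugate) i j
  rw [Matrix.mul_assoc, mul_adjugate, Matrix.mul_smul, Matrix.mul_one, Matrix.smul_apply, smul_eq_mul,
    abs_mul] at h1
  have : 1 / 2 * |X i j| ≤ |Y.det| * |X i j| := mul_le_mul_of_nonneg_right hd (abs_nonneg _)
  linarith

/-- Uniformly finitely many `γ` translate a matrix into a given ball. -/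
lemma exists_return_set {L : ℝ} (hL : 1 ≤ L) : ∃ Z : Finset SL3Z, (Z.card : ℝ) ≤ (25 * L ^ 3) ^ 9 ∧
    ∀ (B : M3) (γ γ' : SL3Z), 1 / 2 ≤ |B.det| → EBdd L (B * toR γ.1) → EBdd L (B * toR γ'.1) →
      γ⁻¹ * γ' ∈ Z := by
  obtain ⟨Z, hZ, hmem⟩ := exists_finset_SL3Z_eBdd ⌊12 * L ^ 3⌋₊
  have hL3 : 1 ≤ L ^ 3 := one_le_pow₀ hL
  have hfl := Nat.floor_le (show 0 ≤ 12 * L ^ 3 by positivity)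
  refine ⟨Z, ?_, ?_⟩
  · calc (Z.card : ℝ) ≤ (((2 * ⌊12 * L ^ 3⌋₊ + 1) ^ 9 : ℕ) : ℝ) := by exact_mod_cast hZ
      _ = (2 * (⌊12 * L ^ 3⌋₊ : ℝ) + 1) ^ 9 := by push_cast; ring
      _ ≤ _ := by gcongr; linarith
  · intro B γ γ' hd h1 h2
    apply hmem
    have e : B * toR γ.1 * toR (γ⁻¹ * γ').1 = B * toR γ'.1 := by
      rw [Matrix.SpecialLinearGroup.coe_mul, toR_mul, Matrix.mul_assoc, ← Matrix.mul_assoc (toR γ.1),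
        toR_mul_inv, Matrix.one_mul]
    rw [← e] at h2
    have h3 := h1.of_mul h2 (by rw [det_mul, toR_det_SL, mul_one]; exact hd)
    intro i j
    have h4 := h3 i j
    rw [toR_apply] at h4 ⊢
    have h5 : |(γ⁻¹ * γ').1 i j| ≤ (⌊12 * L ^ 3⌋₊ : ℤ) := by
      rw [Int.abs_eq_natAbs]
      norm_cast
      rw [Nat.le_floor_iff (by positivity), Nat.cast_natAbs, Int.cast_abs]
      refine h4.trans (le_of_eq ?_); ring
    exact_mod_cast h5

/-- Signed permutations with prescribed last two columns. -/
lemma exists_signed_perm (i k : Fin 3) (hik : i ≠ k) : ∃ γ : SL3Z, (∀ r c, |γ.1 r c| ≤ 1) ∧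
    ∀ X : M3, (∀ r, (X * toR γ.1) r 2 = X r i) ∧ ∀ r, (X * toR γ.1) r 1 = X r k := by
  fin_cases i <;> fin_cases k <;> first | exact absurd rfl hik | skip
  · refine ⟨⟨!![0, 0, 1; 0, 1, 0; -1, 0, 0], by decide⟩, by decide, fun X => ⟨?_, ?_⟩⟩ <;>
      intro r <;> simp [mul_apply, Fin.sum_univ_three]
  · refine ⟨⟨!![0, 0, 1; 1, 0, 0; 0, 1, 0], by decide⟩, by decide, fun X => ⟨?_, ?_⟩⟩ <;>
      intro r <;> simp [mul_apply, Fin.sum_univ_three]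
  · refine ⟨⟨!![0, 1, 0; 0, 0, 1; 1, 0, 0], by decide⟩, by decide, fun X => ⟨?_, ?_⟩⟩ <;>
      intro r <;> simp [mul_apply, Fin.sum_univ_three]
  · refine ⟨⟨!![-1, 0, 0; 0, 0, 1; 0, 1, 0], by decide⟩, by decide, fun X => ⟨?_, ?_⟩⟩ <;>
      intro r <;> simp [mul_apply, Fin.sum_univ_three]
  · refine ⟨⟨!![0, 1, 0; -1, 0, 0; 0, 0, 1], by decide⟩, by decide, fun X => ⟨?_, ?_⟩⟩ <;>
      intro r <;> simp [mul_apply, Fin.sum_univ_three]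
  · refine ⟨⟨!![1, 0, 0; 0, 1, 0; 0, 0, 1], by decide⟩, by decide, fun X => ⟨?_, ?_⟩⟩ <;>
      intro r <;> simp [mul_apply, Fin.sum_univ_three]

/-- The row vector `(n₀, n₁, 1) * X`. -/
def rowN (n : Fin 2 → ℝ) (X : M3) (j : Fin 3) : ℝ := n 0 * X 0 j + n 1 * X 1 j + X 2 j

lemma jacD_second_difference (n : Fin 2 → ℝ) (X : M3) :
    jacD n (X * !![1, 0, 0; 0, 1, 0; 1, 0, 1]) + jacD n (X * !![1, 0, 0; 0, 1, 0; -1, 0, 1]) -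
      2 * jacD n X = -2 * (rowN n X 2 * (rowN n X 1 * X 0 2 - rowN n X 2 * X 0 1)) := by
  simp only [jacD, betaC, alphaC, rowN, adjugate_fin_three, mul_apply, Fin.sum_univ_three]
  simp
  ring

/-- There are two columns along which the quadratic coefficient of the Jacobian is not small. -/
lemma exists_columns_nondegenerate {n : Fin 2 → ℝ} {X : M3} {K : ℝ}
    (hX : EBdd K X) (hK : 1 ≤ K) (hd : 1 / 2 ≤ |X.det|) : ∃ i k : Fin 3, i ≠ k ∧
      1 / (144 * K ^ 3) ≤ |rowN n X i * (rowN n X k * X 0 i - rowN n X i * X 0 k)| := by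
  obtain ⟨i, hi⟩ := Finite.exists_max fun i => |rowN n X i|
  have hK0 : 0 < K := by linarith
  have tri : ∀ a b c : ℝ, |a + b + c| ≤ |a| + |b| + |c| := fun a b c =>
    (abs_add_le _ _).trans (by gcongr; exact abs_add_le _ _)
  have hbig : 1 / (12 * K ^ 2) ≤ |rowN n X i| := by
    have e : X.det = rowN n X 0 * X.adjugate 0 2 + rowN n X 1 * X.adjugate 1 2 +
        rowN n X 2 * X.adjugate 2 2 := by
      rw [det_fin_three]; simp only [rowN, adjugate_fin_three]; simp; ring
    have h1 : |X.det| ≤ 3 * (|rowN n X i| * (2 * K ^ 2)) := by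
      rw [e]
      refine (tri _ _ _).trans ?_
      simp only [abs_mul]
      have b : ∀ j, |rowN n X j| * |X.adjugate j 2| ≤ |rowN n X i| * (2 * K ^ 2) := fun j =>
        mul_le_mul (hi j) (hX.adjugate j 2) (abs_nonneg _) (abs_nonneg _)
      linarith [b 0, b 1, b 2]
    rw [div_le_iff₀ (by positivity)]
    nlinarith
  set y := rowN n X with hy
  have hyi : 0 < |y i| := lt_of_lt_of_le (by positivity) hbig
  -- the cross product of `y` and the first row of `X`
  set r : Fin 3 → ℝ := fun c => y (c + 1) * X 0 (c + 2) - y (c + 2) * X 0 (c + 1) with hr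
  have er : y 0 * r 0 + y 1 * r 1 + y 2 * r 2 = 0 := by simp [hr]; ring
  have hcy : y i * r i + y (i + 1) * r (i + 1) + y (i + 2) * r (i + 2) = 0 := by
    rw [← er]; fin_cases i <;> simp <;> ring
  have hri : |r i| ≤ |r (i + 1)| + |r (i + 2)| := by
    have : |y i| * |r i| ≤ |y i| * (|r (i + 1)| + |r (i + 2)|) := by
      rw [← abs_mul, show y i * r i = -(y (i + 1) * r (i + 1) + y (i + 2) * r (i + 2)) by linarith,
        abs_neg]
      refine (abs_add_le _ _).trans ?_
      rw [abs_mul, abs_mul, mul_add]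
      exact add_le_add (mul_le_mul_of_nonneg_right (hi _) (abs_nonneg _))
        (mul_le_mul_of_nonneg_right (hi _) (abs_nonneg _))
    exact le_of_mul_le_mul_left this hyi
  have hrdet : X.det = r 0 * X 1 0 + r 1 * X 1 1 + r 2 * X 1 2 := by
    rw [det_fin_three]; simp [hr, hy, rowN]; ring
  have hrsum : |X.det| ≤ (|r 0| + |r 1| + |r 2|) * K := by
    rw [hrdet]
    refine (tri _ _ _).trans ?_
    simp only [abs_mul, add_mul]
    gcongr <;> exact hX _ _
  have hrsum' : |r 0| + |r 1| + |r 2| = |r i| + |r (i + 1)| + |r (i + 2)| := by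
    fin_cases i <;> simp <;> ring
  have hone : 1 / (12 * K) ≤ |r (i + 1)| ∨ 1 / (12 * K) ≤ |r (i + 2)| := by
    by_contra! hcon
    have : (1 / (12 * K)) * K = 1 / 12 := by field_simp
    have : (|r i| + |r (i + 1)| + |r (i + 2)|) * K < (4 * (1 / (12 * K))) * K :=
      mul_lt_mul_of_pos_right (by linarith) hK0
    rw [hrsum'] at hrsum
    linarith
  have hprod : ∀ x : ℝ, 1 / (12 * K) ≤ |x| → 1 / (144 * K ^ 3) ≤ |y i * x| := by
    intro x hx
    rw [abs_mul]
    calc 1 / (144 * K ^ 3) = (1 / (12 * K ^ 2)) * (1 / (12 * K)) := by field_simp; norm_num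
      _ ≤ _ := mul_le_mul hbig hx (by positivity) (abs_nonneg _)
  rcases hone with h | h
  · refine ⟨i, i + 2, by fin_cases i <;> decide, ?_⟩
    convert hprod _ h using 3
    simp only [hr]
    rw [show i + 1 + 1 = i + 2 by fin_cases i <;> rfl, show i + 1 + 2 = i by fin_cases i <;> rfl]
  · refine ⟨i, i + 1, by fin_cases i <;> decide, ?_⟩
    have := hprod (-(r (i + 2))) (by rwa [abs_neg])
    convert this using 3
    simp only [hr]
    rw [show i + 2 + 1 = i by fin_cases i <;> rfl, show i + 2 + 2 = i + 1 by fin_cases i <;> rfl]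
    ring

lemma exists_nondegenerate_translate {n : Fin 2 → ℝ} {X : M3} {K : ℝ}
    (hX : EBdd K X) (hK : 1 ≤ K) (hd : 1 / 2 ≤ |X.det|) : ∃ γ : SL3Z, EBdd 3 (toR γ.1) ∧
      1 / (288 * K ^ 3) ≤ |jacD n (X * toR γ.1)| := by
  obtain ⟨i, k, hik, hc⟩ := exists_columns_nondegenerate (n := n) hX hK hd
  obtain ⟨σ, hσ, hσX⟩ := exists_signed_perm i k hik
  obtain ⟨e2, e1⟩ := hσX X
  have hs := jacD_second_difference n (X * toR σ.1)
  have q : ∀ j j', (∀ r, (X * toR σ.1) r j = X r j') → rowN n (X * toR σ.1) j = rowN n X j' := by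
    intro j j' h; simp only [rowN, h]
  rw [q 2 i e2, q 1 k e1, e1, e2] at hs
  have hσb : EBdd 1 (toR σ.1) := fun r c => by
    rw [toR_apply]; exact_mod_cast hσ r c
  have hU : ∀ s : ℤ, |s| ≤ 1 → ∃ τ : SL3Z, EBdd 3 (toR (σ * τ).1) ∧
      X * toR (σ * τ).1 = X * toR σ.1 * !![1, 0, 0; 0, 1, 0; (s : ℝ), 0, 1] := by
    intro s hs
    have eU : toR !![1, 0, 0; 0, 1, 0; s, 0, 1] = !![1, 0, 0; 0, 1, 0; (s : ℝ), 0, 1] := by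
      ext a b; fin_cases a <;> fin_cases b <;> simp
    obtain ⟨τ, hτ⟩ : ∃ τ : SL3Z, τ.1 = !![1, 0, 0; 0, 1, 0; s, 0, 1] :=
      ⟨⟨!![1, 0, 0; 0, 1, 0; s, 0, 1], by simp [det_fin_three]⟩, rfl⟩
    refine ⟨τ, ?_, ?_⟩
    · rw [Matrix.SpecialLinearGroup.coe_mul, toR_mul, hτ]
      have : EBdd 1 (toR !![1, 0, 0; 0, 1, 0; s, 0, 1]) := by
        have hs' : |(s : ℝ)| ≤ 1 := by exact_mod_cast hs
        rw [eU]
        intro a b; fin_cases a <;> fin_cases b <;> simp [hs']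
      exact (hσb.mul this).mono (by norm_num)
    · rw [Matrix.SpecialLinearGroup.coe_mul, toR_mul, ← Matrix.mul_assoc, hτ, eU]
  obtain ⟨τ₁, b₁, x₁⟩ := hU 1 (by norm_num)
  obtain ⟨τ₂, b₂, x₂⟩ := hU (-1) (by norm_num)
  push_cast at x₁ x₂
  rw [← x₁, ← x₂] at hs
  by_contra! hall
  have l0 := hall σ (hσb.mono (by norm_num))
  have l1 := hall (σ * τ₁) b₁
  have l2 := hall (σ * τ₂) b₂
  have hK0 : 0 < K := by linarith
  have ee : 1 / (144 * K ^ 3) = 2 * (1 / (288 * K ^ 3)) := by field_simp; norm_num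
  rw [ee] at hc
  set w := rowN n X i * (rowN n X k * X 0 i - rowN n X i * X 0 k)
  rw [abs_lt] at l0 l1 l2
  rcases abs_cases w with h | h <;> linarith

/-- The finite set of integral matrices used to fix the determinant. -/
def detSet (ℓ : ℤ) : Set Z3 := {x | x.det = ℓ ∧ ∀ i j, |x i j| ≤ 9 * |ℓ|}

lemma exists_detSet_nondegenerate {ℓ : ℤ} (hℓ : ℓ ≠ 0) {n : Fin 2 → ℝ} {X : M3} {K : ℝ}
    (hX : EBdd K X) (hK : 1 ≤ K) (hd : 1 / 2 ≤ |X.det|) : ∃ x ∈ detSet ℓ,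
      1 / (288 * (3 * K * |(ℓ : ℝ)|) ^ 3) ≤ |jacD n (X * toR x)| := by
  have hℓ1 : (1 : ℝ) ≤ |(ℓ : ℝ)| := by exact_mod_cast Int.one_le_abs hℓ
  set E : Z3 := !![ℓ, 0, 0; 0, 1, 0; 0, 0, 1] with hE
  have hEd : E.det = ℓ := by simp [hE, det_fin_three]
  have hEb : EBdd |(ℓ : ℝ)| (toR E) := by
    intro i j; fin_cases i <;> fin_cases j <;> simp [hE, hℓ1]
  obtain ⟨γ, hγ, hD⟩ := exists_nondegenerate_translate (n := n) (hX.mul hEb)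
    (by nlinarith) (by
      rw [det_mul, toR_det, hEd, abs_mul]; nlinarith [abs_nonneg X.det])
  refine ⟨E * γ.1, ⟨by rw [det_mul, hEd, γ.2, mul_one], ?_⟩, ?_⟩
  · intro i j
    have := (hEb.mul hγ) i j
    rw [← toR_mul, toR_apply] at this
    have h2 : |((E * γ.1) i j : ℝ)| ≤ 9 * |(ℓ : ℝ)| := this.trans (le_of_eq (by ring))
    exact_mod_cast h2
  · rw [toR_mul, ← Matrix.mul_assoc]; exact hD

/-- Bounded, nondegenerate matrices whose traces are within `ε` of prescribed functions of the
determinant. -/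
def hit (T : Fin 2 → ℝ → ℝ) (n : Fin 2 → ℝ) (K ε : ℝ) : Set M3 :=
  {X | EBdd K X ∧ 1 / K ≤ |jacD n X| ∧ |X.trace - T 0 X.det| < ε ∧ |X.adjugate.trace - T 1 X.det| < ε}

/-- Matrices some translate of which, under `γ` on the left and integral matrices of determinant `ℓ`
on the right, is a hit. -/
def hitFor (T : Fin 2 → ℝ → ℝ) (ℓ : ℤ) (K ε : ℝ) (γ : SL3Z) : Set M3 :=
  {A | ∃ γ₂ : SL3Z, ∃ x ∈ detSet ℓ, toR γ.1 * A * toR γ₂.1 * toR x ∈ hit T (nOf (toR γ.1)) K ε}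

lemma continuous_alphaC (n : Fin 2 → ℝ) (i : Fin 2) : Continuous fun X : M3 => alphaC n X i := by
  unfold alphaC; fun_prop

lemma continuous_adjugate : Continuous fun X : M3 => X.adjugate := continuous_id.matrix_adjugate

lemma continuous_jacD (n : Fin 2 → ℝ) : Continuous fun X : M3 => jacD n X := by
  unfold jacD betaC
  have h := fun i => (continuous_alphaC n i).comp continuous_adjugate
  exact ((continuous_alphaC n 0).mul (h 1)).sub ((continuous_alphaC n 1).mul (h 0))

lemma measurable_det : Measurable fun X : M3 => X.det := (continuous_id.matrix_det).measurable

lemma measurableSet_hit {T : Fin 2 → ℝ → ℝ} (hT : ∀ i, Measurable (T i)) (n : Fin 2 → ℝ) (K ε : ℝ) :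
    MeasurableSet (hit T n K ε) := by
  have htr : Measurable fun X : M3 => X.trace := (continuous_id.matrix_trace).measurable
  have htra : Measurable fun X : M3 => X.adjugate.trace := continuous_adjugate.matrix_trace.measurable
  refine (measurableSet_EBdd K).inter ((measurableSet_le measurable_const
    (continuous_jacD n).abs.measurable).inter (MeasurableSet.inter ?_ ?_))
  · exact measurableSet_lt (htr.sub ((hT 0).comp measurable_det)).abs measurable_const
  · exact measurableSet_lt (htra.sub ((hT 1).comp measurable_det)).abs measurable_const

lemma measurableSet_hitFor {T : Fin 2 → ℝ → ℝ} (hT : ∀ i, Measurable (T i)) (ℓ : ℤ) (K ε : ℝ)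
    (γ : SL3Z) : MeasurableSet (hitFor T ℓ K ε γ) := by
  have : hitFor T ℓ K ε γ = ⋃ γ₂ : SL3Z, ⋃ x : Z3, ⋃ _ : x ∈ detSet ℓ,
      (fun A => toR γ.1 * A * toR γ₂.1 * toR x) ⁻¹' hit T (nOf (toR γ.1)) K ε := by
    ext A; simp [hitFor]
  rw [this]
  refine MeasurableSet.iUnion fun γ₂ => MeasurableSet.iUnion fun x => MeasurableSet.iUnion fun _ =>
    (measurable_mul_right _).comp ((measurable_mul_right _).comp (measurable_mul_left _))
      (measurableSet_hit hT _ _ _)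

lemma hitFor_mul_right {T : Fin 2 → ℝ → ℝ} {ℓ : ℤ} {K ε : ℝ} {γ : SL3Z} {A : M3} (γ₃ : SL3Z) :
    A * toR γ₃.1 ∈ hitFor T ℓ K ε γ ↔ A ∈ hitFor T ℓ K ε γ := by
  constructor
  · rintro ⟨γ₂, x, hx, h⟩
    refine ⟨γ₃ * γ₂, x, hx, ?_⟩
    rw [Matrix.SpecialLinearGroup.coe_mul, toR_mul]
    simpa only [Matrix.mul_assoc] using h
  · rintro ⟨γ₂, x, hx, h⟩
    refine ⟨γ₃⁻¹ * γ₂, x, hx, ?_⟩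
    rw [Matrix.SpecialLinearGroup.coe_mul, toR_mul]
    have : toR γ.1 * (A * toR γ₃.1) * (toR (γ₃⁻¹).1 * toR γ₂.1) * toR x =
        toR γ.1 * A * (toR γ₃.1 * toR (γ₃⁻¹).1) * toR γ₂.1 * toR x := by
      simp only [Matrix.mul_assoc]
    rw [this, toR_mul_inv, Matrix.mul_one]
    exact h

lemma EBdd.abs_alphaC_le {K : ℝ} {X : M3} (hX : EBdd K X) {n : Fin 2 → ℝ} (hn : ∀ i, |n i| ≤ 1)
    (i : Fin 2) : |alphaC n X i| ≤ 6 * K := by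
  have hp : ∀ (a x : ℝ), |a| ≤ 1 → |x| ≤ K → |a * x| ≤ K := by
    intro a x ha hx
    rw [abs_mul]
    calc |a| * |x| ≤ 1 * K := mul_le_mul ha hx (abs_nonneg _) zero_le_one
      _ = K := one_mul K
  have hs : ∀ j, |n 0 * X 0 j + n 1 * X 1 j + X 2 j| ≤ 3 * K := by
    intro j
    have h1 := abs_add_le (n 0 * X 0 j + n 1 * X 1 j) (X 2 j)
    have h2 := abs_add_le (n 0 * X 0 j) (n 1 * X 1 j)
    linarith [hp _ _ (hn 0) (hX 0 j), hp _ _ (hn 1) (hX 1 j), hX 2 j]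
  unfold alphaC
  have h3 := abs_sub (n 0 * X 0 i.castSucc + n 1 * X 1 i.castSucc + X 2 i.castSucc)
    (n i * (n 0 * X 0 2 + n 1 * X 1 2 + X 2 2))
  have h4 : |n i * (n 0 * X 0 2 + n 1 * X 1 2 + X 2 2)| ≤ 1 * (3 * K) := by
    rw [abs_mul]; exact mul_le_mul (hn i) (hs 2) (abs_nonneg _) zero_le_one
  linarith [hs i.castSucc]

lemma EBdd.abs_betaC_le {K : ℝ} {X : M3} (hX : EBdd K X) {n : Fin 2 → ℝ} (hn : ∀ i, |n i| ≤ 1)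
    (i : Fin 2) : |betaC n X i| ≤ 12 * K ^ 2 := by
  have := hX.adjugate.abs_alphaC_le hn i
  rw [betaC]; linarith

lemma EBdd.abs_jacD_le {K : ℝ} {X : M3} (hX : EBdd K X) {n : Fin 2 → ℝ} (hn : ∀ i, |n i| ≤ 1) :
    |jacD n X| ≤ 144 * K ^ 3 := by
  have hK := hX.nonneg
  have h : ∀ i j, |alphaC n X i * betaC n X j| ≤ 6 * K * (12 * K ^ 2) := fun i j => by
    rw [abs_mul]
    exact mul_le_mul (hX.abs_alphaC_le hn i) (hX.abs_betaC_le hn j) (abs_nonneg _) (by positivity)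
  have := abs_sub (alphaC n X 0 * betaC n X 1) (alphaC n X 1 * betaC n X 0)
  rw [jacD]
  linarith [h 0 1, h 1 0]

lemma EBdd.abs_trace_le {K : ℝ} {X : M3} (hX : EBdd K X) : |X.trace| ≤ 3 * K := by
  rw [trace_fin_three]
  have h1 := abs_add_le (X 0 0 + X 1 1) (X 2 2)
  have h2 := abs_add_le (X 0 0) (X 1 1)
  linarith [hX 0 0, hX 1 1, hX 2 2]

lemma eBdd_uni {n c : Fin 2 → ℝ} {r : ℝ} (hn : ∀ i, |n i| ≤ 1) (hc : ∀ i, |c i| ≤ r) :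
    EBdd (1 + 2 * r) (uni n c) := by
  have hr : 0 ≤ r := (abs_nonneg _).trans (hc 0)
  have hp : ∀ i k, |c i * n k| ≤ r := fun i k => by
    rw [abs_mul]
    calc |c i| * |n k| ≤ r * 1 := mul_le_mul (hc i) (hn k) (abs_nonneg _) hr
      _ = r := mul_one r
  have hs : |n 0 * c 0 + n 1 * c 1| ≤ 2 * r := by
    refine (abs_add_le _ _).trans ?_
    rw [mul_comm (n 0), mul_comm (n 1)]
    linarith [hp 0 0, hp 1 1]
  have hs' : ∀ k, |-(n 0 * c 0 + n 1 * c 1) * n k| ≤ 2 * r := fun k => by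
    rw [abs_mul, abs_neg]
    calc _ ≤ 2 * r * 1 := mul_le_mul hs (hn k) (abs_nonneg _) (by positivity)
      _ = _ := mul_one _
  have h1 : ∀ x : ℝ, |x| ≤ 2 * r → |1 + x| ≤ 1 + 2 * r := fun x hx =>
    (abs_add_le _ _).trans (by rw [abs_one]; linarith)
  intro i j
  fin_cases i <;> fin_cases j
  · exact h1 _ ((hp 0 0).trans (by linarith))
  · exact (hp 0 1).trans (by linarith)
  · exact (hc 0).trans (by linarith)
  · exact (hp 1 0).trans (by linarith)
  · exact h1 _ ((hp 1 1).trans (by linarith))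
  · exact (hc 1).trans (by linarith)
  · exact (hs' 0).trans (by linarith)
  · exact (hs' 1).trans (by linarith)
  · have := h1 (-(n 0 * c 0 + n 1 * c 1)) (by rwa [abs_neg])
    rwa [← sub_eq_add_neg] at this

/-- Solutions of the trace equations are bounded. -/
lemma trace_set_bounded {T : Fin 2 → ℝ → ℝ} {n c : Fin 2 → ℝ} {X : M3} {K ε : ℝ} (hK : 1 ≤ K)
    (hT : ∀ i t, |T i t| + 1 ≤ K) (hε : ε ≤ 1) (hn : ∀ i, |n i| ≤ 1) (hX : EBdd K X)
    (hD : 1 / K ≤ |jacD n X|) (h0 : |(uni n c * X).trace - T 0 X.det| < ε)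
    (h1 : |(uni n c * X).adjugate.trace - T 1 X.det| < ε) (i : Fin 2) : |c i| ≤ 90 * K ^ 4 := by
  rw [trace_uni_mul] at h0
  rw [trace_adjugate_uni_mul] at h1
  obtain ⟨u, hu⟩ : ∃ u, u = alphaC n X 0 * c 0 + alphaC n X 1 * c 1 := ⟨_, rfl⟩
  obtain ⟨v, hv⟩ : ∃ v, v = betaC n X 0 * c 0 + betaC n X 1 * c 1 := ⟨_, rfl⟩
  rw [← hu] at h0
  rw [← hv] at h1
  have hub : |u| ≤ 4 * K := by
    have e : u = (X.trace + u - T 0 X.det) + T 0 X.det - X.trace := by ring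
    have t1 := abs_sub ((X.trace + u - T 0 X.det) + T 0 X.det) X.trace
    have t2 := abs_add_le (X.trace + u - T 0 X.det) (T 0 X.det)
    rw [← e] at t1
    linarith [hX.abs_trace_le, hT 0 X.det]
  have hK2 : K ≤ K ^ 2 := by nlinarith
  have hvb : |v| ≤ 7 * K ^ 2 := by
    have e : v = X.adjugate.trace - ((X.adjugate.trace - v - T 1 X.det) + T 1 X.det) := by ring
    have t1 := abs_sub X.adjugate.trace ((X.adjugate.trace - v - T 1 X.det) + T 1 X.det)
    have t2 := abs_add_le (X.adjugate.trace - v - T 1 X.det) (T 1 X.det)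
    rw [← e] at t1
    linarith [hX.adjugate.abs_trace_le, hT 1 X.det]
  have hK0 : 0 < K := by linarith
  have key : |jacD n X * c i| ≤ 90 * K ^ 3 := by
    have b1 : ∀ k, |u * betaC n X k| ≤ 4 * K * (12 * K ^ 2) := fun k => by
      rw [abs_mul]; exact mul_le_mul hub (hX.abs_betaC_le hn k) (abs_nonneg _) (by positivity)
    have b2 : ∀ k, |v * alphaC n X k| ≤ 7 * K ^ 2 * (6 * K) := fun k => by
      rw [abs_mul]; exact mul_le_mul hvb (hX.abs_alphaC_le hn k) (abs_nonneg _) (by positivity)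
    fin_cases i
    · have : jacD n X * c 0 = u * betaC n X 1 - v * alphaC n X 1 := by rw [hu, hv, jacD]; ring
      change |jacD n X * c 0| ≤ _
      rw [this]
      linarith [abs_sub (u * betaC n X 1) (v * alphaC n X 1), b1 1, b2 1]
    · have : jacD n X * c 1 = v * alphaC n X 0 - u * betaC n X 0 := by rw [hu, hv, jacD]; ring
      change |jacD n X * c 1| ≤ _
      rw [this]
      linarith [abs_sub (v * alphaC n X 0) (u * betaC n X 0), b1 0, b2 0]
  rw [abs_mul] at key
  have h5 : 1 / K * |c i| ≤ 90 * K ^ 3 :=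
    (mul_le_mul_of_nonneg_right hD (abs_nonneg _)).trans key
  rw [one_div, inv_mul_le_iff₀ hK0] at h5
  linarith

lemma lintegral_measure_fiber {X C : Type*} [MeasurableSpace X] [MeasurableSpace C] {m : Measure X}
    {ν : Measure C} [SFinite m] [SFinite ν] {a : X → C → X} (ha : Measurable fun p : X × C => a p.1 p.2)
    (hc : ∀ c, MeasurePreserving (fun x => a x c) m m) {G : Set X} (hG : MeasurableSet G) :
    ∫⁻ x, ν {c | a x c ∈ G} ∂m = ν Set.univ * m G := by
  have hs : MeasurableSet {p : X × C | a p.1 p.2 ∈ G} := ha hG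
  have h1 := Measure.prod_apply (μ := m) (ν := ν) hs
  have h2 := Measure.prod_apply_symm (μ := m) (ν := ν) hs
  have h3 : ∫⁻ x, ν {c | a x c ∈ G} ∂m = m.prod ν {p : X × C | a p.1 p.2 ∈ G} := h1.symm
  rw [h3, h2]
  have : ∀ c, m ((fun x => (x, c)) ⁻¹' {p : X × C | a p.1 p.2 ∈ G}) = m G := fun c =>
    (hc c).measure_preimage hG.nullMeasurableSet
  simp only [this, lintegral_const, mul_comm]

/-- The inverse of the linear map `cOf g`. -/
noncomputable def cInv (g : M3) (c : Fin 2 → ℝ) : Fin 2 → ℝ :=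
  ![(g 1 1 * c 0 - g 0 1 * c 1) / g.adjugate 2 2 ^ 2, (g 0 0 * c 1 - g 1 0 * c 0) / g.adjugate 2 2 ^ 2]

lemma adjugate_two_two (g : M3) : g.adjugate 2 2 = g 0 0 * g 1 1 - g 0 1 * g 1 0 := by
  simp [Matrix.adjugate_fin_three]

lemma cOf_cInv {g : M3} (hp : g.adjugate 2 2 ≠ 0) (c : Fin 2 → ℝ) : cOf g (cInv g c) = c := by
  have h := adjugate_two_two g
  ext i
  fin_cases i <;> simp [cOf, cInv] <;> field_simp <;> rw [h] <;> ring

lemma measurable_cInv (g : M3) : Measurable (cInv g) := by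
  refine measurable_pi_iff.mpr fun i => ?_
  fin_cases i <;> simp [cInv] <;> fun_prop

lemma ntr_add_mul {g : M3} (hg : g.det = 1) (hp : g.adjugate 2 2 ≠ 0) (θ c : Fin 2 → ℝ) (B : M3) :
    g * (ntr (θ + cInv g c) * B) = uni (nOf g) c * (g * (ntr θ * B)) := by
  have h := mul_ntr_eq_uni_mul hg hp (cInv g c)
  rw [cOf_cInv hp] at h
  rw [add_comm, ← ntr_mul_ntr, ← Matrix.mul_assoc, ← Matrix.mul_assoc, h]
  simp only [Matrix.mul_assoc]

lemma continuous_ntr : Continuous ntr := by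
  refine continuous_matrix fun i j => ?_
  fin_cases i <;> fin_cases j <;> simp [ntr] <;> fun_prop

lemma measurable_ntr_mul (B : M3) : Measurable fun θ => ntr θ * B :=
  (continuous_ntr.matrix_mul continuous_const).measurable

/-- The half-open unit square. -/
def sq01 : Set (Fin 2 → ℝ) := {θ | ∀ i, θ i ∈ Set.Ioc 0 1}

/-- The middle half of the unit square. -/
def sqMid : Set (Fin 2 → ℝ) := {θ | ∀ i, θ i ∈ Set.Icc (1 / 4) (3 / 4)}

lemma sq01_eq : sq01 = Set.univ.pi fun _ => Set.Ioc 0 1 := by ext; simp [sq01]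

lemma sqMid_eq : sqMid = Set.univ.pi fun _ => Set.Icc (1 / 4) (3 / 4) := by
  ext; simp only [sqMid, Set.mem_univ_pi, Set.mem_ofPred_eq]

lemma measurableSet_sq01 : MeasurableSet sq01 := by
  rw [sq01_eq]; exact MeasurableSet.univ_pi fun _ => measurableSet_Ioc

lemma volume_sq01 : volume sq01 = 1 := by
  rw [sq01_eq, volume_pi_pi]; simp

lemma volume_sqMid : volume sqMid = ENNReal.ofReal (1 / 4) := by
  rw [sqMid_eq, volume_pi_pi]
  simp only [Real.volume_Icc, Finset.prod_const, Finset.card_univ, Fintype.card_fin]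
  rw [← ENNReal.ofReal_pow (by norm_num)]; norm_num

lemma ColBox.abs_cInv_lt {h : ℕ} {g : Z3} (H : ColBox h g) (hh : 1 ≤ h) {r : ℝ}
    (hr : r ≤ (h : ℝ) ^ 3) {c : Fin 2 → ℝ} (hc : ∀ i, |c i| ≤ r) (i : Fin 2) :
    |cInv (toR g) c i| < 1 / 4 := by
  have hp : 0 < (h : ℝ) := by exact_mod_cast hh
  have h1 := H.real_adj22_ge
  have hr0 : 0 ≤ r := (abs_nonneg _).trans (hc 0)
  have h2 : (144 : ℝ) * h ^ 4 ≤ (toR g).adjugate 2 2 ^ 2 := by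
    have := pow_le_pow_left₀ (by positivity) h1 2
    nlinarith
  have big : ∀ a : ℝ, 0 ≤ a → a ≤ 5 * (h : ℝ) → ∀ i, |a * c i| ≤ 5 * h * r := fun a ha ha' i => by
    rw [abs_mul, abs_of_nonneg ha]; exact mul_le_mul ha' (hc i) (abs_nonneg _) (by positivity)
  have small : ∀ a : ℝ, 0 ≤ a → a ≤ 2 * (h : ℝ) → ∀ i, |a * c i| ≤ 2 * h * r := fun a ha ha' i => by
    rw [abs_mul, abs_of_nonneg ha]; exact mul_le_mul ha' (hc i) (abs_nonneg _) (by positivity)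
  have l00 : (4 : ℝ) * h ≤ g 0 0 := by exact_mod_cast H.l00
  have u00 : (g 0 0 : ℝ) ≤ 5 * h := by exact_mod_cast H.u00
  have l10 : (h : ℝ) ≤ g 1 0 := by exact_mod_cast H.l10
  have u10 : (g 1 0 : ℝ) ≤ 2 * h := by exact_mod_cast H.u10
  have l01 : (h : ℝ) ≤ g 0 1 := by exact_mod_cast H.l01
  have u01 : (g 0 1 : ℝ) ≤ 2 * h := by exact_mod_cast H.u01
  have l11 : (4 : ℝ) * h ≤ g 1 1 := by exact_mod_cast H.l11
  have u11 : (g 1 1 : ℝ) ≤ 5 * h := by exact_mod_cast H.u11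
  have key : ∀ x : ℝ, |x| ≤ 7 * h * r → |x / (toR g).adjugate 2 2 ^ 2| < 1 / 4 := fun x hx => by
    have hpos : 0 < (toR g).adjugate 2 2 ^ 2 := lt_of_lt_of_le (by positivity) h2
    rw [abs_div, abs_of_pos hpos, div_lt_iff₀ hpos]
    have : 7 * (h : ℝ) * r ≤ 7 * h * h ^ 3 := mul_le_mul_of_nonneg_left hr (by positivity)
    have h4 : 0 < (h : ℝ) ^ 4 := by positivity
    have e : 7 * (h : ℝ) * h ^ 3 = 7 * (h : ℝ) ^ 4 := by ring
    linarith
  fin_cases i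
  · refine key _ ?_
    have := abs_sub (toR g 1 1 * c 0) (toR g 0 1 * c 1)
    have := big (toR g 1 1) (by rw [toR_apply]; linarith) (by rw [toR_apply]; linarith) 0
    have := small (toR g 0 1) (by rw [toR_apply]; linarith) (by rw [toR_apply]; linarith) 1
    linarith
  · refine key _ ?_
    have := abs_sub (toR g 0 0 * c 1) (toR g 1 0 * c 0)
    have := big (toR g 0 0) (by rw [toR_apply]; linarith) (by rw [toR_apply]; linarith) 1
    have := small (toR g 1 0) (by rw [toR_apply]; linarith) (by rw [toR_apply]; linarith) 0
    linarith

/-- Lower bound for the measure of parameters `θ` at which `ntr θ * B` is a hit for `γ`. -/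
lemma first_moment {h : ℕ} {γ : SL3Z} (H : ColBox h γ.1) (hh : 1 ≤ h) {ℓ : ℤ} (hℓ : ℓ ≠ 0)
    {T : Fin 2 → ℝ → ℝ} (hTm : ∀ i, Measurable (T i)) {κ K₂ K ε : ℝ} (hκ : 0 < κ) (hκ1 : κ ≤ 1)
    (hK₂ : K₂ = 288 * (9 * |(ℓ : ℝ)| / κ ^ 2) ^ 3) (hT : ∀ i t, |T i t| + 1 ≤ K₂)
    (hK : 543 * K₂ ^ 5 ≤ K) (hh3 : 90 * K₂ ^ 4 ≤ (h : ℝ) ^ 3) (hε : 0 < ε) (hε1 : ε ≤ 1)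
    {B : M3} (hB : 1 / 2 ≤ B.det) (hB1 : B.det ≤ 1) :
    ENNReal.ofReal (4 * ε ^ 2 / (144 * K₂ ^ 3)) *
        volume {θ | θ ∈ sqMid ∧ ¬Cusp κ (toR γ.1 * (ntr θ * B))} ≤
      ENNReal.ofReal ((180 * K₂ ^ 4) ^ 2) *
        volume {θ | θ ∈ sq01 ∧ ntr θ * B ∈ hitFor T ℓ K ε γ} := by
  have hL : (1 : ℝ) ≤ |(ℓ : ℝ)| := by exact_mod_cast Int.one_le_abs hℓ
  have hκ2 : 0 < κ ^ 2 := by positivity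
  have hκ21 : κ ^ 2 ≤ 1 := pow_le_one₀ hκ.le hκ1
  have hM : 9 * |(ℓ : ℝ)| ≤ 9 * |(ℓ : ℝ)| / κ ^ 2 := by
    rw [le_div_iff₀ hκ2]; exact mul_le_of_le_one_right (by positivity) hκ21
  obtain ⟨M, hMd⟩ : ∃ M, M = 9 * |(ℓ : ℝ)| / κ ^ 2 := ⟨_, rfl⟩
  rw [← hMd] at hK₂ hM
  have hM9 : 9 ≤ M := by linarith
  have hMK : 9 * |(ℓ : ℝ)| * M ≤ K₂ := by
    have h1 : 9 * |(ℓ : ℝ)| * M ≤ M * M := mul_le_mul_of_nonneg_right hM (by linarith)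
    have h2 : M * M ≤ M ^ 3 := by nlinarith [sq_nonneg M]
    have h3 : 0 < M ^ 3 := by positivity
    rw [hK₂]; linarith
  have hK₂1 : 1 ≤ K₂ := by nlinarith
  have hK₂0 : 0 < K₂ := by linarith
  obtain ⟨g, hgd⟩ : ∃ g, g = toR γ.1 := ⟨_, rfl⟩
  have hg : g.det = 1 := hgd ▸ toR_det_SL γ
  have hp0 : 0 < (h : ℝ) := by exact_mod_cast hh
  have hp : g.adjugate 2 2 ≠ 0 := by
    have := H.real_adj22_ge
    rw [← hgd] at this
    have h3 : 0 < g.adjugate 2 2 := lt_of_lt_of_le (by positivity) this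
    exact h3.ne'
  have hn : ∀ i, |nOf g i| ≤ 1 := by rw [hgd]; exact H.abs_nOf_le hh
  let Box : Set (Fin 2 → ℝ) := Set.univ.pi fun _ => Set.Icc (-(90 * K₂ ^ 4)) (90 * K₂ ^ 4)
  have hBoxv : volume Box = ENNReal.ofReal ((180 * K₂ ^ 4) ^ 2) := by
    rw [volume_pi_pi]
    simp only [Real.volume_Icc, Finset.prod_const, Finset.card_univ, Fintype.card_fin]
    rw [← ENNReal.ofReal_pow (by nlinarith [pow_pos hK₂0 4])]; congr 1; ring
  have hBoxm : MeasurableSet Box := MeasurableSet.univ_pi fun _ => measurableSet_Icc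
  obtain ⟨G, hG⟩ : ∃ G, G = {θ | θ ∈ sq01 ∧ ntr θ * B ∈ hitFor T ℓ K ε γ} := ⟨_, rfl⟩
  have hGm : MeasurableSet G := by
    rw [hG]
    exact measurableSet_sq01.inter (measurable_ntr_mul B (measurableSet_hitFor hTm ℓ K ε γ))
  have hfib := lintegral_measure_fiber (m := (volume : Measure (Fin 2 → ℝ)))
    (ν := volume.restrict Box) (a := fun θ c => θ + cInv g c)
    (measurable_fst.add ((measurable_cInv g).comp measurable_snd))
    (fun c => measurePreserving_add_right volume (cInv g c)) hGm
  rw [Measure.restrict_apply_univ, hBoxv] at hfib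
  rw [← hG, ← hfib]
  refine le_trans ?_ (mul_meas_ge_le_lintegral₀ (measurable_measure_prodMk_left ((measurable_fst.add
    ((measurable_cInv g).comp measurable_snd)) hGm)).aemeasurable
    (ENNReal.ofReal (4 * ε ^ 2 / (144 * K₂ ^ 3))))
  refine mul_le_mul_right (measure_mono ?_) _
  rintro θ ⟨hθ, hcusp⟩
  rw [← hgd] at hcusp
  obtain ⟨γ₂, hγ₂⟩ := exists_reduced (B := g * (ntr θ * B)) (by
    rw [Matrix.det_mul, Matrix.det_mul, hg, det_ntr]; nlinarith) hκ hκ1 hcusp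
  obtain ⟨x, hx, hxD⟩ := exists_detSet_nondegenerate (n := nOf g) hℓ hγ₂
    (by rw [le_div_iff₀ hκ2]; linarith) (by
      rw [Matrix.det_mul, Matrix.det_mul, Matrix.det_mul, hg, det_ntr, toR_det_SL, abs_of_nonneg]
        <;> linarith)
  obtain ⟨X, hXd⟩ : ∃ X, X = g * (ntr θ * B) * toR γ₂.1 * toR x := ⟨_, rfl⟩
  rw [← hXd] at hxD
  have hXK : EBdd K₂ X := by
    have hxb : EBdd (9 * |(ℓ : ℝ)|) (toR x) := fun i j => by
      rw [toR_apply]; exact_mod_cast hx.2 i j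
    have := hγ₂.mul hxb
    rw [← hXd] at this
    refine this.mono ?_
    have e : 3 * (3 / κ ^ 2) * (9 * |(ℓ : ℝ)|) = 9 * M := by
      rw [hMd]; ring
    have h1 : 9 * 1 * M ≤ 9 * |(ℓ : ℝ)| * M :=
      mul_le_mul_of_nonneg_right (by linarith) (by linarith)
    linarith
  have hD : 1 / K₂ ≤ |jacD (nOf g) X| := by
    convert hxD using 2
    rw [hK₂, hMd]; congr 2; ring
  have hDpos : 0 < |jacD (nOf g) X| := lt_of_lt_of_le (by positivity) hD
  have hv := volume_trace_set (n := nOf g) (X := X) (abs_pos.mp hDpos) (T 0 X.det) (T 1 X.det) hε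
  have hmX : MeasurableSet {c | θ + cInv g c ∈ G} := (measurable_const.add (measurable_cInv g)) hGm
  change _ ≤ (volume.restrict Box) {c | θ + cInv g c ∈ G}
  rw [Measure.restrict_apply hmX]
  refine le_trans ?_ (measure_mono (μ := volume) (s := {c | |(uni (nOf g) c * X).trace - T 0 X.det| < ε ∧
    |(uni (nOf g) c * X).adjugate.trace - T 1 X.det| < ε}) ?_)
  · rw [hv]
    refine ENNReal.ofReal_le_ofReal ?_
    exact div_le_div_of_nonneg_left (by positivity) hDpos (hXK.abs_jacD_le hn)
  · rintro c ⟨h0, h1⟩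
    have hcb := trace_set_bounded hK₂1 hT hε1 hn hXK hD h0 h1
    refine ⟨?_, fun i _ => abs_le.mp (hcb i)⟩
    rw [Set.mem_ofPred_eq, hG]
    refine ⟨fun i => ?_, γ₂, x, hx, ?_⟩
    · have h3 := abs_lt.mp (H.abs_cInv_lt hh hh3 hcb i)
      rw [← hgd] at h3
      have h4 := hθ i
      exact ⟨by simp only [Pi.add_apply]; linarith [h4.1, h3.1],
        by simp only [Pi.add_apply]; linarith [h4.2, h3.2]⟩
    · have e : toR γ.1 * (ntr (θ + cInv g c) * B) * toR γ₂.1 * toR x = uni (nOf g) c * X := by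
        rw [← hgd, ntr_add_mul hg hp, hXd]; simp only [Matrix.mul_assoc]
      have hdet : (uni (nOf g) c * X).det = X.det := by rw [Matrix.det_mul, det_uni, one_mul]
      rw [e, ← hgd]
      have h45 : 1 ≤ K₂ ^ 4 := one_le_pow₀ hK₂1
      have hKK : K₂ ≤ K := by
        have : K₂ * 1 ≤ K₂ * K₂ ^ 4 := mul_le_mul_of_nonneg_left h45 hK₂0.le
        have e : K₂ * K₂ ^ 4 = K₂ ^ 5 := by ring
        linarith
      refine ⟨((eBdd_uni hn hcb).mul hXK).mono ?_, ?_, ?_, ?_⟩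
      · have e : 3 * (1 + 2 * (90 * K₂ ^ 4)) * K₂ = 3 * (K₂ * 1) + 540 * K₂ ^ 5 := by ring
        have : K₂ * 1 ≤ K₂ * K₂ ^ 4 := mul_le_mul_of_nonneg_left h45 hK₂0.le
        have e' : K₂ * K₂ ^ 4 = K₂ ^ 5 := by ring
        linarith
      · rw [jacD_uni_mul]
        exact (one_div_le_one_div_of_le hK₂0 hKK).trans hD
      · rw [hdet]; exact h0
      · rw [hdet]; exact h1

/-- Unfolding: an invariant function integrated over a set of bounded multiplicity whose
translates meet `E` is controlled by its integral over `E`. -/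
lemma lintegral_fold_le {R E : Set M3} (hR : MeasurableSet R) (hE : MeasurableSet E) {Φ : M3 → ENNReal}
    (hΦ : Measurable Φ) (hinv : ∀ A (γ : SL3Z), Φ (A * toR γ.1) = Φ A)
    (hcov : ∀ A ∈ R, ∃ γ : SL3Z, A * toR γ.1 ∈ E) {m : ℕ}
    (hmult : ∀ A (F : Finset SL3Z), (∀ γ ∈ F, A * toR γ.1 ∈ R) → F.card ≤ m) :
    ∫⁻ A in R, Φ A ≤ m * ∫⁻ A in E, Φ A := by
  rw [← lintegral_indicator hR, ← lintegral_indicator hE]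
  have hterm : ∀ γ : SL3Z, Measurable fun A : M3 =>
      R.indicator 1 (A * toR (γ⁻¹).1) * E.indicator Φ A := fun γ =>
    ((measurable_one.indicator hR).comp (measurable_mul_right _)).mul (hΦ.indicator hE)
  calc ∫⁻ A, R.indicator Φ A
      ≤ ∫⁻ A, ∑' γ : SL3Z, R.indicator 1 A * E.indicator Φ (A * toR γ.1) := by
        refine lintegral_mono fun A => ?_
        by_cases hA : A ∈ R
        · obtain ⟨γ, hγ⟩ := hcov A hA
          refine le_trans (le_of_eq ?_) (ENNReal.le_tsum γ)
          simp [hA, hγ, hinv]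
        · simp [hA]
    _ = ∑' γ : SL3Z, ∫⁻ A, R.indicator 1 A * E.indicator Φ (A * toR γ.1) :=
        lintegral_tsum fun γ => ((measurable_one.indicator hR).mul
          ((hΦ.indicator hE).comp (measurable_mul_right _))).aemeasurable
    _ = ∑' γ : SL3Z, ∫⁻ A, R.indicator 1 (A * toR (γ⁻¹).1) * E.indicator Φ A := by
        refine tsum_congr fun γ => ?_
        rw [← (measurePreserving_mul_right (toR_det_SL γ)).lintegral_comp (hterm γ)]
        refine lintegral_congr fun A => ?_
        rw [Matrix.mul_assoc, toR_mul_inv, Matrix.mul_one]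
    _ = ∫⁻ A, ∑' γ : SL3Z, R.indicator 1 (A * toR (γ⁻¹).1) * E.indicator Φ A :=
        (lintegral_tsum fun γ => (hterm γ).aemeasurable).symm
    _ ≤ ∫⁻ A, m * E.indicator Φ A := by
        refine lintegral_mono fun A => ?_
        rw [ENNReal.tsum_mul_right]
        refine mul_le_mul_left ?_ _
        rw [ENNReal.tsum_eq_iSup_sum]
        refine iSup_le fun F => ?_
        classical
        have h1 : ∑ γ ∈ F, R.indicator (1 : M3 → ENNReal) (A * toR (γ⁻¹).1) =
            ((F.filter fun γ => A * toR (γ⁻¹).1 ∈ R).card : ENNReal) := by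
          rw [Finset.card_filter, Nat.cast_sum]
          refine Finset.sum_congr rfl fun γ _ => ?_
          rw [Set.indicator_apply]; split_ifs <;> simp
        rw [h1, ← Finset.card_image_of_injective _ (inv_injective (G := SL3Z))]
        have := hmult A ((F.filter fun γ => A * toR (γ⁻¹).1 ∈ R).image (·⁻¹)) fun γ hγ => by
          obtain ⟨γ', h', rfl⟩ := Finset.mem_image.mp hγ
          exact (Finset.mem_filter.mp h').2
        exact_mod_cast this
    _ = m * ∫⁻ A, E.indicator Φ A := lintegral_const_mul _ (hΦ.indicator hE)

/-- The determinant window. -/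
def detWin : Set M3 := {A | 1 / 2 ≤ A.det ∧ A.det ≤ 1}

lemma measurableSet_detWin : MeasurableSet detWin :=
  (measurableSet_le measurable_const measurable_det).inter
    (measurableSet_le measurable_det measurable_const)

lemma mul_left_mem_detWin {g A : M3} (hg : g.det = 1) : g * A ∈ detWin ↔ A ∈ detWin := by
  simp [detWin, Matrix.det_mul, hg]

lemma mul_right_mem_detWin {g A : M3} (hg : g.det = 1) : A * g ∈ detWin ↔ A ∈ detWin := by
  simp [detWin, Matrix.det_mul, hg]

lemma abs_det_of_mem_detWin {A : M3} (hA : A ∈ detWin) : 1 / 2 ≤ |A.det| :=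
  hA.1.trans (le_abs_self _)

/-- The bounded part of the determinant window. -/
def bddWin (L : ℝ) : Set M3 := {A | EBdd L A} ∩ detWin

lemma measurableSet_bddWin (L : ℝ) : MeasurableSet (bddWin L) :=
  (measurableSet_EBdd L).inter measurableSet_detWin

lemma exists_multiplicity {L : ℝ} (hL : 1 ≤ L) : ∃ m : ℕ, (m : ℝ) ≤ (25 * L ^ 3) ^ 9 ∧
    ∀ (B : M3) (F : Finset SL3Z), (∀ γ ∈ F, B * toR γ.1 ∈ bddWin L) → F.card ≤ m := by
  classical
  obtain ⟨Z, hZ, h⟩ := exists_return_set hL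
  refine ⟨Z.card, hZ, fun B F hF => ?_⟩
  rcases F.eq_empty_or_nonempty with rfl | ⟨γ₀, h₀⟩
  · simp
  · have hd : 1 / 2 ≤ |B.det| :=
      abs_det_of_mem_detWin ((mul_right_mem_detWin (toR_det_SL γ₀)).mp (hF γ₀ h₀).2)
    refine Finset.card_le_card_of_injOn (fun γ => γ₀⁻¹ * γ) (fun γ hγ => ?_)
      (fun _ _ _ _ h => mul_left_cancel h)
    exact h B γ₀ γ hd (hF γ₀ h₀).1 (hF γ hγ).1

lemma alphaC_sub (n : Fin 2 → ℝ) (X Y : M3) (i : Fin 2) :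
    alphaC n (X - Y) i = alphaC n X i - alphaC n Y i := by
  simp only [alphaC, Matrix.sub_apply]; ring

lemma abs_mul_sub_mul_le {a b a' b' A B α β : ℝ} (ha : |a| ≤ A) (hb' : |b'| ≤ B) (h1 : |a - a'| ≤ α)
    (h2 : |b - b'| ≤ β) : |a * b - a' * b'| ≤ A * β + α * B := by
  have e : a * b - a' * b' = a * (b - b') + (a - a') * b' := by ring
  rw [e]
  refine (abs_add_le _ _).trans ?_
  rw [abs_mul, abs_mul]
  exact add_le_add (mul_le_mul ha h2 (abs_nonneg _) ((abs_nonneg _).trans ha))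
    (mul_le_mul h1 hb' (abs_nonneg _) ((abs_nonneg _).trans h1))

lemma eBdd_adjugate_sub {X Y : M3} {K δ : ℝ} (hX : EBdd K X) (hY : EBdd K Y) (h : EBdd δ (X - Y)) :
    EBdd (4 * K * δ) (X.adjugate - Y.adjugate) := by
  have key : ∀ i j k l, |X i j * X k l - Y i j * Y k l| ≤ 2 * K * δ := fun i j k l => by
    refine (abs_mul_sub_mul_le (hX i j) (hY k l) (h i j) (h k l)).trans (by linarith)
  have key2 : ∀ i j k l i' j' k' l', |(X i j * X k l - X i' j' * X k' l') -
      (Y i j * Y k l - Y i' j' * Y k' l')| ≤ 4 * K * δ := fun i j k l i' j' k' l' => by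
    have e : (X i j * X k l - X i' j' * X k' l') - (Y i j * Y k l - Y i' j' * Y k' l') =
      (X i j * X k l - Y i j * Y k l) - (X i' j' * X k' l' - Y i' j' * Y k' l') := by ring
    rw [e]
    linarith [abs_sub (X i j * X k l - Y i j * Y k l) (X i' j' * X k' l' - Y i' j' * Y k' l'),
      key i j k l, key i' j' k' l']
  intro i j
  rw [Matrix.sub_apply, Matrix.adjugate_fin_three, Matrix.adjugate_fin_three]
  fin_cases i <;> fin_cases j <;> simp only [Fin.reduceFinMk, Fin.zero_eta, Fin.mk_one, of_apply,
    cons_val', cons_val, cons_val_fin_one, cons_val_zero, cons_val_one]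
  · exact key2 _ _ _ _ _ _ _ _
  · convert key2 0 2 2 1 0 1 2 2 using 2; ring
  · exact key2 _ _ _ _ _ _ _ _
  · convert key2 1 2 2 0 1 0 2 2 using 2; ring
  · exact key2 _ _ _ _ _ _ _ _
  · convert key2 0 2 1 0 0 0 1 2 using 2; ring
  · exact key2 _ _ _ _ _ _ _ _
  · convert key2 0 1 2 0 0 0 2 1 using 2; ring
  · exact key2 _ _ _ _ _ _ _ _

lemma abs_jacD_sub_le {X Y : M3} {K δ : ℝ} (hX : EBdd K X) (hY : EBdd K Y) (h : EBdd δ (X - Y))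
    {n : Fin 2 → ℝ} (hn : ∀ i, |n i| ≤ 1) : |jacD n X - jacD n Y| ≤ 432 * K ^ 2 * δ := by
  have hα : ∀ i, |alphaC n X i - alphaC n Y i| ≤ 6 * δ := fun i => by
    rw [← alphaC_sub]; exact h.abs_alphaC_le hn i
  have hβ : ∀ i, |betaC n X i - betaC n Y i| ≤ 6 * (4 * K * δ) := fun i => by
    rw [betaC, betaC, ← alphaC_sub]; exact (eBdd_adjugate_sub hX hY h).abs_alphaC_le hn i
  have key := fun i j => abs_mul_sub_mul_le (hX.abs_alphaC_le hn i) (hY.abs_betaC_le hn j) (hα i) (hβ j)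
  have e : jacD n X - jacD n Y = (alphaC n X 0 * betaC n X 1 - alphaC n Y 0 * betaC n Y 1) -
    (alphaC n X 1 * betaC n X 0 - alphaC n Y 1 * betaC n Y 0) := by simp only [jacD]; ring
  rw [e]
  refine (abs_sub _ _).trans ?_
  linarith [key 0 1, key 1 0]

lemma abs_alphaC_sub_le {X : M3} {K δ : ℝ} (hX : EBdd K X) {n n' : Fin 2 → ℝ} (hn : ∀ i, |n i| ≤ 1)
    (hδ : δ ≤ 1) (hnn : ∀ i, |n' i - n i| ≤ δ) (i : Fin 2) :
    |alphaC n' X i - alphaC n X i| ≤ 9 * K * δ := by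
  have hK := hX.nonneg
  have hδ0 : 0 ≤ δ := (abs_nonneg _).trans (hnn 0)
  have hp : ∀ k l j, |(n' k - n k) * X l j| ≤ δ * K := fun k l j => by
    rw [abs_mul]; exact mul_le_mul (hnn k) (hX _ _) (abs_nonneg _) hδ0
  have hr : ∀ j, |(n' 0 * X 0 j + n' 1 * X 1 j + X 2 j) - (n 0 * X 0 j + n 1 * X 1 j + X 2 j)| ≤
      2 * K * δ := fun j => by
    have e : (n' 0 * X 0 j + n' 1 * X 1 j + X 2 j) - (n 0 * X 0 j + n 1 * X 1 j + X 2 j) =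
      (n' 0 - n 0) * X 0 j + (n' 1 - n 1) * X 1 j := by ring
    rw [e]
    linarith [abs_add_le ((n' 0 - n 0) * X 0 j) ((n' 1 - n 1) * X 1 j), hp 0 0 j, hp 1 1 j]
  have hrb : ∀ j, |n 0 * X 0 j + n 1 * X 1 j + X 2 j| ≤ 3 * K := fun j => by
    have h0 : ∀ k l, |n k * X l j| ≤ 1 * K := fun k l => by
      rw [abs_mul]; exact mul_le_mul (hn k) (hX _ _) (abs_nonneg _) zero_le_one
    linarith [abs_add_le (n 0 * X 0 j + n 1 * X 1 j) (X 2 j), abs_add_le (n 0 * X 0 j) (n 1 * X 1 j),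
      h0 0 0, h0 1 1, hX 2 j]
  have hn' : |n' i| ≤ 2 := by
    have e : n' i = (n' i - n i) + n i := by ring
    rw [e]
    linarith [abs_add_le (n' i - n i) (n i), hnn i, hn i]
  have h3 := abs_mul_sub_mul_le hn' (hrb 2) (hnn i) (hr 2)
  have h4 := hr i.castSucc
  unfold alphaC
  rw [sub_sub_sub_comm]
  refine (abs_sub _ _).trans ?_
  linarith

lemma abs_jacD_sub_le_of_param {X : M3} {K δ : ℝ} (hX : EBdd K X) {n n' : Fin 2 → ℝ}
    (hn : ∀ i, |n i| ≤ 1) (hδ : δ ≤ 1) (hnn : ∀ i, |n' i - n i| ≤ δ) :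
    |jacD n' X - jacD n X| ≤ 756 * K ^ 3 * δ := by
  have hK := hX.nonneg
  have hα := abs_alphaC_sub_le hX hn hδ hnn
  have hβ := abs_alphaC_sub_le hX.adjugate hn hδ hnn
  have hα' : ∀ i, |alphaC n' X i| ≤ 15 * K := fun i => by
    have e : alphaC n' X i = (alphaC n' X i - alphaC n X i) + alphaC n X i := by ring
    rw [e]
    have : 9 * K * δ ≤ 9 * K * 1 := mul_le_mul_of_nonneg_left hδ (by positivity)
    linarith [abs_add_le (alphaC n' X i - alphaC n X i) (alphaC n X i), hα i, hX.abs_alphaC_le hn i]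
  have key := fun i j => abs_mul_sub_mul_le (hα' i) (hX.abs_betaC_le hn j) (hα i) (hβ j)
  have e : jacD n' X - jacD n X = (alphaC n' X 0 * betaC n' X 1 - alphaC n X 0 * betaC n X 1) -
    (alphaC n' X 1 * betaC n' X 0 - alphaC n X 1 * betaC n X 0) := by simp only [jacD]; ring
  rw [e]
  refine (abs_sub _ _).trans ?_
  have k1 := key 0 1
  have k2 := key 1 0
  unfold betaC at *
  linarith

lemma finite_detSet (ℓ : ℤ) : (detSet ℓ).Finite := by
  have h : (Set.univ.pi fun _ : Fin 3 => Set.univ.pi fun _ : Fin 3 =>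
      Set.Icc (-(9 * |ℓ|)) (9 * |ℓ|)).Finite :=
    Set.Finite.pi fun _ => Set.Finite.pi fun _ => Set.finite_Icc _ _
  exact h.subset fun x hx i _ j _ => abs_le.mp (hx.2 i j)

lemma eBdd_of_mem_detSet {ℓ : ℤ} {x : Z3} (hx : x ∈ detSet ℓ) : EBdd (9 * |(ℓ : ℝ)|) (toR x) :=
  fun i j => by rw [toR_apply]; exact_mod_cast hx.2 i j

/-- Largeness conditions on a size parameter. -/
structure BigFor (ℓ : ℤ) (K : ℝ) : Prop where
  large : 1000 ≤ K
  abs_le : 9 * |(ℓ : ℝ)| ≤ K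
  ncard_le : ((detSet ℓ).ncard : ℝ) ≤ K

lemma BigFor.mono {ℓ : ℤ} {K K' : ℝ} (h : BigFor ℓ K) (hK : K ≤ K') : BigFor ℓ K' :=
  ⟨h.large.trans hK, h.abs_le.trans hK, h.ncard_le.trans hK⟩

lemma EBdd.of_mul_detSet {ℓ : ℤ} (hℓ : ℓ ≠ 0) {K L : ℝ} (hK : BigFor ℓ K) {x : Z3} (hx : x ∈ detSet ℓ)
    {C : M3} (h : EBdd L (C * toR x)) : EBdd (12 * K ^ 2 * L) C := by
  refine ((eBdd_of_mem_detSet hx).mono hK.abs_le).of_mul_right h ?_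
  rw [toR_det, hx.1]
  have : (1 : ℝ) ≤ |(ℓ : ℝ)| := by exact_mod_cast Int.one_le_abs hℓ
  linarith

lemma volume_uni_hit_le {T : Fin 2 → ℝ → ℝ} {n n' : Fin 2 → ℝ} {K ε : ℝ} (hK : 0 < K) (hε : 0 < ε)
    (hjac : ∀ Y, EBdd K Y → 1 / K ≤ |jacD n' Y| → 1 / (2 * K) ≤ |jacD n Y|) (X : M3) :
    volume {c | uni n c * X ∈ hit T n' K ε} ≤ ENNReal.ofReal (8 * K * ε ^ 2) := by
  rcases Set.eq_empty_or_nonempty {c | uni n c * X ∈ hit T n' K ε} with h | ⟨c₀, hc₀⟩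
  · rw [h]; simp
  · have hD : 1 / (2 * K) ≤ |jacD n X| := by
      have := hjac _ hc₀.1 hc₀.2.1
      rwa [jacD_uni_mul] at this
    have hDpos : 0 < |jacD n X| := lt_of_lt_of_le (by positivity) hD
    calc volume {c | uni n c * X ∈ hit T n' K ε}
        ≤ volume {c | |(uni n c * X).trace - T 0 X.det| < ε ∧
            |(uni n c * X).adjugate.trace - T 1 X.det| < ε} := by
          refine measure_mono fun c hc => ?_
          have hdet : (uni n c * X).det = X.det := by rw [Matrix.det_mul, det_uni, one_mul]
          have h := hc.2.2
          rw [hdet] at h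
          exact h
      _ = ENNReal.ofReal (4 * ε ^ 2 / |jacD n X|) := volume_trace_set (abs_pos.mp hDpos) _ _ hε
      _ ≤ _ := by
          refine ENNReal.ofReal_le_ofReal ?_
          rw [div_le_iff₀ hDpos]
          have := mul_le_mul_of_nonneg_left hD (show 0 ≤ 8 * K * ε ^ 2 by positivity)
          have e : 8 * K * ε ^ 2 * (1 / (2 * K)) = 4 * ε ^ 2 := by field_simp; ring
          linarith

lemma measurable_uni (n : Fin 2 → ℝ) : Measurable (uni n) := by
  have : Continuous (uni n) := by
    refine continuous_matrix fun i j => ?_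
    fin_cases i <;> fin_cases j <;> simp [uni] <;> fun_prop
  exact this.measurable

lemma measurable_matrix_mul : Measurable fun p : M3 × M3 => p.1 * p.2 :=
  (continuous_fst.matrix_mul continuous_snd).measurable

/-- Matrices which become hits after multiplication by an integral matrix of bounded size. -/
def hitBase (T : Fin 2 → ℝ → ℝ) (ℓ : ℤ) (n : Fin 2 → ℝ) (K ε : ℝ) : Set M3 :=
  {C | C ∈ detWin ∧ ∃ x ∈ detSet ℓ, C * toR x ∈ hit T n K ε}

lemma measurableSet_hitBase {T : Fin 2 → ℝ → ℝ} (hT : ∀ i, Measurable (T i)) (ℓ : ℤ) (n : Fin 2 → ℝ)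
    (K ε : ℝ) : MeasurableSet (hitBase T ℓ n K ε) := by
  have : hitBase T ℓ n K ε = detWin ∩ ⋃ x : Z3, ⋃ _ : x ∈ detSet ℓ,
      (fun A => A * toR x) ⁻¹' hit T n K ε := by
    ext A; simp [hitBase]
  rw [this]
  exact measurableSet_detWin.inter (MeasurableSet.iUnion fun x => MeasurableSet.iUnion fun _ =>
    (measurable_mul_right _) (measurableSet_hit hT _ _ _))

lemma measure_biUnion_finite_le {α ι : Type*} [MeasurableSpace α] (μ : Measure α) {s : Set ι}
    (hs : s.Finite) (f : ι → Set α) {u : ENNReal} (h : ∀ i ∈ s, μ (f i) ≤ u) :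
    μ (⋃ i ∈ s, f i) ≤ s.ncard * u := by
  have h1 := measure_biUnion_finset_le (μ := μ) hs.toFinset f
  have h2 : ∑ i ∈ hs.toFinset, μ (f i) ≤ ∑ _i ∈ hs.toFinset, u :=
    Finset.sum_le_sum fun i hi => h i (hs.mem_toFinset.mp hi)
  rw [Finset.sum_const, nsmul_eq_mul, ← Set.ncard_eq_toFinset_card s hs] at h2
  refine le_trans ?_ (h1.trans h2)
  simp

lemma volume_hitBase_le {T : Fin 2 → ℝ → ℝ} (hT : ∀ i, Measurable (T i)) {ℓ : ℤ} (hℓ : ℓ ≠ 0)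
    {n : Fin 2 → ℝ} (hn : ∀ i, |n i| ≤ 1) {K ε : ℝ} (hK : BigFor ℓ K) (hε : 0 < ε) :
    volume (hitBase T ℓ n K ε) ≤ ENNReal.ofReal (K ^ 48 * ε ^ 2) := by
  have hK1 := hK.large
  have hK0 : 0 < K := by linarith
  have hm := measurableSet_hitBase hT ℓ n K ε
  have hfib := lintegral_measure_fiber (m := (volume : Measure M3))
    (ν := volume.restrict sq01) (a := fun C c => uni n c * C)
    (measurable_matrix_mul.comp (((measurable_uni n).comp measurable_snd).prodMk measurable_fst))
    (fun c => measurePreserving_mul_left (det_uni n c)) hm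
  rw [Measure.restrict_apply_univ, volume_sq01, one_mul] at hfib
  rw [← hfib]
  have hpt : ∀ C : M3, (volume.restrict sq01) {c | uni n c * C ∈ hitBase T ℓ n K ε} ≤
      {A | EBdd (K ^ 4) A}.indicator (fun _ => ENNReal.ofReal (8 * K ^ 2 * ε ^ 2)) C := by
    intro C
    have hmc : MeasurableSet {c | uni n c * C ∈ hitBase T ℓ n K ε} :=
      ((measurable_mul_right C).comp (measurable_uni n)) hm
    rw [Measure.restrict_apply hmc]
    rcases Set.eq_empty_or_nonempty ({c | uni n c * C ∈ hitBase T ℓ n K ε} ∩ sq01) with h | ⟨c, hc, hc1⟩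
    · rw [h]; simp
    · have hC : EBdd (K ^ 4) C := by
        obtain ⟨_, x, hx, hhit⟩ := hc
        have h1 := EBdd.of_mul_detSet hℓ hK hx hhit.1
        have h2 : EBdd (1 + 2 * 1) (uni n (-c)) := eBdd_uni hn fun i => by
          have := hc1 i
          rw [Pi.neg_apply, abs_neg, abs_of_pos this.1]; exact this.2
        have h3 := h2.mul h1
        rw [← Matrix.mul_assoc, uni_mul_uni, neg_add_cancel, uni_zero, Matrix.one_mul] at h3
        refine h3.mono ?_
        have : K ^ 3 * 1000 ≤ K ^ 3 * K := mul_le_mul_of_nonneg_left hK1 (by positivity)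
        have : 0 < K ^ 3 := by positivity
        nlinarith
      rw [Set.indicator_of_mem (by exact hC)]
      have hsub : {c | uni n c * C ∈ hitBase T ℓ n K ε} ∩ sq01 ⊆
          ⋃ x ∈ detSet ℓ, {c | uni n c * (C * toR x) ∈ hit T n K ε} := by
        rintro c ⟨⟨_, x, hx, hhit⟩, _⟩
        rw [Matrix.mul_assoc] at hhit
        exact Set.mem_biUnion hx hhit
      refine (measure_mono hsub).trans ((measure_biUnion_finite_le volume (finite_detSet ℓ) _
        fun x _ => volume_uni_hit_le (n := n) hK0 hε (fun Y _ h => le_trans ?_ h) _).trans ?_)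
      · exact one_div_le_one_div_of_le hK0 (by linarith)
      · rw [← ENNReal.ofReal_natCast, ← ENNReal.ofReal_mul (by positivity)]
        refine ENNReal.ofReal_le_ofReal ?_
        have := mul_le_mul_of_nonneg_right hK.ncard_le (show 0 ≤ 8 * K * ε ^ 2 by positivity)
        linarith
  refine (lintegral_mono hpt).trans ?_
  rw [lintegral_indicator (measurableSet_EBdd _), setLIntegral_const,
    volume_EBdd (by positivity), ← ENNReal.ofReal_mul (by positivity)]
  refine ENNReal.ofReal_le_ofReal ?_
  have e : 8 * K ^ 2 * ε ^ 2 * (2 * K ^ 4) ^ 9 = K ^ 38 * (8 * 2 ^ 9) * ε ^ 2 := by ring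
  rw [e]
  have h10 : (8 * 2 ^ 9 : ℝ) ≤ K ^ 10 := by
    calc (8 * 2 ^ 9 : ℝ) ≤ 1000 ^ 10 := by norm_num
      _ ≤ K ^ 10 := pow_le_pow_left₀ (by norm_num) hK1 10
  have e2 : K ^ 48 = K ^ 38 * K ^ 10 := by ring
  rw [e2]
  exact mul_le_mul_of_nonneg_right (mul_le_mul_of_nonneg_left h10 (by positivity)) (by positivity)

/-- The normalized `k`-th row of `ζ`. -/
noncomputable def rowNu (ζ : SL3Z) (k : Fin 3) (i : Fin 2) : ℝ := toR ζ.1 k i.castSucc / toR ζ.1 k 2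

/-- The conjugate of `uni (rowNu ζ k) c` by `ζ`. -/
noncomputable def uniConj (ζ : SL3Z) (k : Fin 3) (c : Fin 2 → ℝ) : M3 :=
  toR ζ.1 * uni (rowNu ζ k) c * toR (ζ⁻¹).1

lemma det_uniConj (ζ : SL3Z) (k : Fin 3) (c : Fin 2 → ℝ) : (uniConj ζ k c).det = 1 := by
  rw [uniConj, Matrix.det_mul, Matrix.det_mul, det_uni, toR_det_SL, toR_det_SL]; norm_num

lemma uniConj_neg_mul (ζ : SL3Z) (k : Fin 3) (c : Fin 2 → ℝ) :
    uniConj ζ k (-c) * uniConj ζ k c = 1 := by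
  have : uniConj ζ k (-c) * uniConj ζ k c = toR ζ.1 * (uni (rowNu ζ k) (-c) *
      (toR (ζ⁻¹).1 * toR ζ.1) * uni (rowNu ζ k) c) * toR (ζ⁻¹).1 := by
    simp only [uniConj, Matrix.mul_assoc]
  rw [this, toR_inv_mul, Matrix.mul_one, uni_mul_uni, neg_add_cancel, uni_zero, Matrix.mul_one,
    toR_mul_inv]

lemma inv_mul_uniConj_mul (ζ : SL3Z) (k : Fin 3) (c : Fin 2 → ℝ) (C : M3) :
    toR (ζ⁻¹).1 * (uniConj ζ k c * C) = uni (rowNu ζ k) c * (toR (ζ⁻¹).1 * C) := by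
  have : toR (ζ⁻¹).1 * (uniConj ζ k c * C) =
      (toR (ζ⁻¹).1 * toR ζ.1) * (uni (rowNu ζ k) c * (toR (ζ⁻¹).1 * C)) := by
    simp only [uniConj, Matrix.mul_assoc]
  rw [this, toR_inv_mul, Matrix.one_mul]

lemma measurable_uniConj (ζ : SL3Z) (k : Fin 3) : Measurable (uniConj ζ k) :=
  (measurable_mul_right _).comp ((measurable_mul_left _).comp (measurable_uni _))

lemma uniConj_sub_one (ζ : SL3Z) {k : Fin 3} (hk : toR ζ.1 k 2 ≠ 0) (c : Fin 2 → ℝ) (r t : Fin 3) :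
    (uniConj ζ k c - 1) r t =
      (c 0 * (toR ζ.1 r 0 - toR ζ.1 r 2 * rowNu ζ k 0) + c 1 * (toR ζ.1 r 1 - toR ζ.1 r 2 * rowNu ζ k 1))
        / toR ζ.1 k 2 * (1 : M3) k t := by
  have h1 : uniConj ζ k c - 1 = toR ζ.1 * (uni (rowNu ζ k) c - 1) * toR (ζ⁻¹).1 := by
    rw [Matrix.mul_sub, Matrix.sub_mul, Matrix.mul_one, toR_mul_inv, uniConj]
  have h2 : ∀ s, (toR ζ.1 * (uni (rowNu ζ k) c - 1)) r s =
      (c 0 * (toR ζ.1 r 0 - toR ζ.1 r 2 * rowNu ζ k 0) + c 1 * (toR ζ.1 r 1 - toR ζ.1 r 2 * rowNu ζ k 1))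
        / toR ζ.1 k 2 * toR ζ.1 k s := by
    intro s
    have e0 : toR ζ.1 k 0 / toR ζ.1 k 2 = rowNu ζ k 0 := rfl
    have e1 : toR ζ.1 k 1 / toR ζ.1 k 2 = rowNu ζ k 1 := rfl
    have e2 : toR ζ.1 k 2 / toR ζ.1 k 2 = 1 := div_self hk
    rw [div_mul_eq_mul_div, mul_div_assoc, Matrix.mul_apply, Fin.sum_univ_three]
    fin_cases s
    · change _ = _ * (toR ζ.1 k 0 / toR ζ.1 k 2)
      rw [e0]; simp [uni, Matrix.sub_apply]; ring
    · change _ = _ * (toR ζ.1 k 1 / toR ζ.1 k 2)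
      rw [e1]; simp [uni, Matrix.sub_apply]; ring
    · change _ = _ * (toR ζ.1 k 2 / toR ζ.1 k 2)
      rw [e2]; simp [uni, Matrix.sub_apply]; ring
  rw [h1, Matrix.mul_apply]
  simp only [h2, mul_assoc]
  rw [← Finset.mul_sum, ← Matrix.mul_apply, toR_mul_inv]

/-- `ζ` maps the plane orthogonal to `(n₀, n₁, 1)` to bounded vectors. -/
def PlaneClose (ζ : SL3Z) (n : Fin 2 → ℝ) : Prop :=
  ∀ k (i : Fin 2), |toR ζ.1 k i.castSucc - toR ζ.1 k 2 * n i| ≤ 5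

lemma PlaneClose.abs_rowNu_sub_le {ζ : SL3Z} {n : Fin 2 → ℝ} (h : PlaneClose ζ n) {k : Fin 3}
    (hk : toR ζ.1 k 2 ≠ 0) (i : Fin 2) : |rowNu ζ k i - n i| ≤ 5 / |toR ζ.1 k 2| := by
  have hp : 0 < |toR ζ.1 k 2| := abs_pos.mpr hk
  rw [le_div_iff₀ hp, ← abs_mul]
  have e : (rowNu ζ k i - n i) * toR ζ.1 k 2 = toR ζ.1 k i.castSucc - toR ζ.1 k 2 * n i := by
    rw [sub_mul, rowNu, div_mul_cancel₀ _ hk, mul_comm (n i)]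
  rw [e]
  exact h k i

lemma PlaneClose.eBdd_uniConj_sub_one {ζ : SL3Z} {n : Fin 2 → ℝ} (h : PlaneClose ζ n) {k : Fin 3}
    (hk : toR ζ.1 k 2 ≠ 0) (hmax : ∀ r, |toR ζ.1 r 2| ≤ |toR ζ.1 k 2|) {c : Fin 2 → ℝ} {t : ℝ}
    (hc : ∀ i, |c i| ≤ t) : EBdd (20 * t / |toR ζ.1 k 2|) (uniConj ζ k c - 1) := by
  have hp : 0 < |toR ζ.1 k 2| := abs_pos.mpr hk
  have ht : 0 ≤ t := (abs_nonneg _).trans (hc 0)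
  have h10 : ∀ r (i : Fin 2), |toR ζ.1 r i.castSucc - toR ζ.1 r 2 * rowNu ζ k i| ≤ 10 := fun r i => by
    have e : toR ζ.1 r i.castSucc - toR ζ.1 r 2 * rowNu ζ k i =
      (toR ζ.1 r i.castSucc - toR ζ.1 r 2 * n i) - toR ζ.1 r 2 * (rowNu ζ k i - n i) := by ring
    have h1 : |toR ζ.1 r 2 * (rowNu ζ k i - n i)| ≤ 5 := by
      rw [abs_mul]
      calc _ ≤ |toR ζ.1 k 2| * (5 / |toR ζ.1 k 2|) :=
            mul_le_mul (hmax r) (h.abs_rowNu_sub_le hk i) (abs_nonneg _) hp.le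
        _ = 5 := by field_simp
    rw [e]
    linarith [abs_sub (toR ζ.1 r i.castSucc - toR ζ.1 r 2 * n i) (toR ζ.1 r 2 * (rowNu ζ k i - n i)), h r i]
  intro r s
  rw [uniConj_sub_one ζ hk, abs_mul, abs_div]
  have hone : |(1 : M3) k s| ≤ 1 := by
    rw [Matrix.one_apply]; split_ifs <;> simp
  have hb : ∀ i : Fin 2, |c i * (toR ζ.1 r i.castSucc - toR ζ.1 r 2 * rowNu ζ k i)| ≤ t * 10 := fun i => by
    rw [abs_mul]; exact mul_le_mul (hc i) (h10 r i) (abs_nonneg _) ht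
  have h0 := hb 0
  have h1 := hb 1
  simp only [Fin.castSucc_zero, Fin.castSucc_one] at h0 h1
  have hsum := (abs_add_le (c 0 * (toR ζ.1 r 0 - toR ζ.1 r 2 * rowNu ζ k 0))
    (c 1 * (toR ζ.1 r 1 - toR ζ.1 r 2 * rowNu ζ k 1)))
  refine (mul_le_mul_of_nonneg_left hone (by positivity)).trans ?_
  rw [mul_one]
  exact div_le_div_of_nonneg_right (by linarith) hp.le

/-- Hits for `n` which, after translation by `ζ⁻¹`, are also hits for `n'`. -/
def hitPair (T : Fin 2 → ℝ → ℝ) (ℓ : ℤ) (n n' : Fin 2 → ℝ) (ζ : SL3Z) (K ε : ℝ) : Set M3 :=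
  {C | C ∈ hitBase T ℓ n K ε ∧
    ∃ γ₂ : SL3Z, ∃ x ∈ detSet ℓ, toR (ζ⁻¹).1 * C * toR γ₂.1 * toR x ∈ hit T n' K ε}

lemma measurableSet_hitPair {T : Fin 2 → ℝ → ℝ} (hT : ∀ i, Measurable (T i)) (ℓ : ℤ) (n n' : Fin 2 → ℝ)
    (ζ : SL3Z) (K ε : ℝ) : MeasurableSet (hitPair T ℓ n n' ζ K ε) := by
  have : hitPair T ℓ n n' ζ K ε = hitBase T ℓ n K ε ∩ ⋃ γ₂ : SL3Z, ⋃ x : Z3, ⋃ _ : x ∈ detSet ℓ,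
      (fun A => toR (ζ⁻¹).1 * A * toR γ₂.1 * toR x) ⁻¹' hit T n' K ε := by
    ext A; simp [hitPair]
  rw [this]
  refine (measurableSet_hitBase hT ℓ n K ε).inter
    (MeasurableSet.iUnion fun γ₂ => MeasurableSet.iUnion fun x => MeasurableSet.iUnion fun _ =>
    (measurable_mul_right _).comp ((measurable_mul_right _).comp (measurable_mul_left _))
      (measurableSet_hit hT _ _ _))

/-- Hits are stable under small perturbations. -/
lemma mem_hit_of_close {T : Fin 2 → ℝ → ℝ} {n : Fin 2 → ℝ} (hn : ∀ i, |n i| ≤ 1) {K ε δ : ℝ}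
    (hK : 1000 ≤ K) (hε1 : ε ≤ 1) (hδ : δ * K ^ 5 ≤ 60 * ε) {X Y : M3} (hY : Y ∈ hit T n K ε)
    (hdet : X.det = Y.det) (hXY : EBdd δ (X - Y)) : X ∈ hit T n (2 * K) (2 * ε) := by
  have hK0 : 0 < K := by linarith
  have hδ0 : 0 ≤ δ := hXY.nonneg
  have hδ4 : 24 * K * δ ≤ ε := by
    have h4 : (1440 : ℝ) ≤ K ^ 4 := le_trans (by norm_num) (pow_le_pow_left₀ (by norm_num) hK 4)
    have hε : 0 ≤ ε := by nlinarith [mul_nonneg hδ0 (pow_pos hK0 5).le]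
    have : 24 * K * δ * K ^ 4 ≤ ε * K ^ 4 := by nlinarith
    exact le_of_mul_le_mul_right this (by positivity)
  have hδK : 3 * δ ≤ 24 * K * δ := by nlinarith
  have hX : EBdd (2 * K) X := fun i j => by
    have e : X i j = Y i j + (X - Y) i j := by rw [Matrix.sub_apply]; ring
    rw [e]
    linarith [abs_add_le (Y i j) ((X - Y) i j), hY.1 i j, hXY i j]
  have hY2 : EBdd (2 * K) Y := hY.1.mono (by linarith)
  refine ⟨hX, ?_, ?_, ?_⟩
  · have h1 := abs_jacD_sub_le hX hY2 hXY hn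
    have h2 : 432 * (2 * K) ^ 2 * δ ≤ 1 / (2 * K) := by
      rw [le_div_iff₀ (by positivity)]
      have h6 : (1000 : ℝ) ^ 2 ≤ K ^ 2 := pow_le_pow_left₀ (by norm_num) hK 2
      have : 432 * (2 * K) ^ 2 * δ * (2 * K) * K ^ 2 ≤ 1 * K ^ 2 := by nlinarith
      exact le_of_mul_le_mul_right this (by positivity)
    have h3 := hY.2.1
    have h4 : 1 / K = 1 / (2 * K) + 1 / (2 * K) := by field_simp; norm_num
    have h5 : |jacD n Y| ≤ |jacD n X| + |jacD n X - jacD n Y| := by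
      have e : jacD n Y = jacD n X - (jacD n X - jacD n Y) := by ring
      calc |jacD n Y| = |jacD n X - (jacD n X - jacD n Y)| := by rw [← e]
        _ ≤ _ := abs_sub _ _
    linarith
  · have e : X.trace - T 0 X.det = (X - Y).trace + (Y.trace - T 0 Y.det) := by
      rw [hdet, Matrix.trace_sub]; ring
    rw [e]
    linarith [abs_add_le (X - Y).trace (Y.trace - T 0 Y.det), hXY.abs_trace_le, hY.2.2.1]
  · have e : X.adjugate.trace - T 1 X.det =
        (X.adjugate - Y.adjugate).trace + (Y.adjugate.trace - T 1 Y.det) := by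
      rw [hdet, Matrix.trace_sub]; ring
    rw [e]
    linarith [abs_add_le (X.adjugate - Y.adjugate).trace (Y.adjugate.trace - T 1 Y.det),
      (eBdd_adjugate_sub hX hY2 hXY).abs_trace_le, hY.2.2.2]

lemma Set.finite_and_ncard_le {α : Type*} {s : Set α} {m : ℕ}
    (h : ∀ F : Finset α, (∀ a ∈ F, a ∈ s) → F.card ≤ m) : s.Finite ∧ s.ncard ≤ m := by
  have hf : s.Finite := by
    by_contra hi
    obtain ⟨t, ht, hc⟩ := Set.Infinite.exists_subset_card_eq hi (m + 1)
    have := h t fun a ha => ht ha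
    omega
  refine ⟨hf, ?_⟩
  rw [Set.ncard_eq_toFinset_card s hf]
  exact h _ fun a ha => hf.mem_toFinset.mp ha

lemma eBdd_uni_of_le_two {n c : Fin 2 → ℝ} (hn : ∀ i, |n i| ≤ 2) (hc : ∀ i, |c i| ≤ 1) :
    EBdd 9 (uni n c) := by
  have hp : ∀ i k, |c i * n k| ≤ 2 := fun i k => by
    rw [abs_mul]
    calc |c i| * |n k| ≤ 1 * 2 := mul_le_mul (hc i) (hn k) (abs_nonneg _) zero_le_one
      _ = 2 := by norm_num
  have hs : |n 0 * c 0 + n 1 * c 1| ≤ 4 := by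
    refine (abs_add_le _ _).trans ?_
    rw [mul_comm (n 0), mul_comm (n 1)]
    linarith [hp 0 0, hp 1 1]
  have hs' : ∀ k, |-(n 0 * c 0 + n 1 * c 1) * n k| ≤ 8 := fun k => by
    rw [abs_mul, abs_neg]
    calc _ ≤ 4 * 2 := mul_le_mul hs (hn k) (abs_nonneg _) (by positivity)
      _ = _ := by norm_num
  have h1 : ∀ x : ℝ, |x| ≤ 8 → |1 + x| ≤ 9 := fun x hx =>
    (abs_add_le _ _).trans (by rw [abs_one]; linarith)
  intro i j
  fin_cases i <;> fin_cases j
  · exact h1 _ ((hp 0 0).trans (by norm_num))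
  · exact (hp 0 1).trans (by norm_num)
  · exact (hc 0).trans (by norm_num)
  · exact (hp 1 0).trans (by norm_num)
  · exact h1 _ ((hp 1 1).trans (by norm_num))
  · exact (hc 1).trans (by norm_num)
  · exact (hs' 0).trans (by norm_num)
  · exact (hs' 1).trans (by norm_num)
  · have := h1 (-(n 0 * c 0 + n 1 * c 1)) (by rw [abs_neg]; linarith)
    rwa [← sub_eq_add_neg] at this

/-- Fibrewise bound for pairs of hits along the conjugated unipotent family. -/
lemma volume_uniConj_hitPair_le {T : Fin 2 → ℝ → ℝ} {ℓ : ℤ} (hℓ : ℓ ≠ 0)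
    {n n' : Fin 2 → ℝ} (hn' : ∀ i, |n' i| ≤ 1) {ζ : SL3Z} (hζ : PlaneClose ζ n') {K ε τ : ℝ}
    (hK : BigFor ℓ K) (hε : 0 < ε) (hτ1 : τ ≤ 1) {k : Fin 3}
    (hQ : K ^ 6 ≤ |toR ζ.1 k 2|) (C : M3) :
    volume ({c | uniConj ζ k c * C ∈ hitPair T ℓ n n' ζ K ε} ∩ {c | ∀ i, |c i| ≤ τ}) ≤
      ENNReal.ofReal (K ^ 120 * ε ^ 2) := by
  have hK1 := hK.large
  have hK0 : 0 < K := by linarith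
  have hK6 : (1000 : ℝ) ^ 6 ≤ K ^ 6 := pow_le_pow_left₀ (by norm_num) hK1 6
  have hk : toR ζ.1 k 2 ≠ 0 := abs_pos.mp (lt_of_lt_of_le (by positivity) hQ)
  have hδ1 : 5 / |toR ζ.1 k 2| ≤ 1 := by
    rw [div_le_one (abs_pos.mpr hk)]; linarith
  have hclose := hζ.abs_rowNu_sub_le hk
  have hν2 : ∀ i, |rowNu ζ k i| ≤ 2 := fun i => by
    have e : rowNu ζ k i = (rowNu ζ k i - n' i) + n' i := by ring
    rw [e]
    linarith [abs_add_le (rowNu ζ k i - n' i) (n' i), hclose i, hn' i]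
  have hjac : ∀ Y, EBdd K Y → 1 / K ≤ |jacD n' Y| → 1 / (2 * K) ≤ |jacD (rowNu ζ k) Y| := by
    intro Y hY hD
    have h1 := abs_jacD_sub_le_of_param hY hn' hδ1 hclose
    have h2 : 756 * K ^ 3 * (5 / |toR ζ.1 k 2|) ≤ 1 / (2 * K) := by
      rw [← mul_div_assoc, div_le_div_iff₀ (abs_pos.mpr hk) (by positivity)]
      have : 756 * K ^ 3 * 5 * (2 * K) ≤ K ^ 6 := by
        have : (1000 : ℝ) ^ 2 ≤ K ^ 2 := pow_le_pow_left₀ (by norm_num) hK1 2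
        have h4 : 0 < K ^ 4 := by positivity
        nlinarith
      linarith
    have h4 : 1 / K = 1 / (2 * K) + 1 / (2 * K) := by field_simp; norm_num
    have h5 : |jacD n' Y| ≤ |jacD (rowNu ζ k) Y| + |jacD (rowNu ζ k) Y - jacD n' Y| := by
      have e : jacD n' Y = jacD (rowNu ζ k) Y - (jacD (rowNu ζ k) Y - jacD n' Y) := by ring
      calc |jacD n' Y| = |jacD (rowNu ζ k) Y - (jacD (rowNu ζ k) Y - jacD n' Y)| := by rw [← e]
        _ ≤ _ := abs_sub _ _
    linarith
  obtain ⟨m, hm, hmult⟩ := exists_multiplicity (L := K ^ 4) (one_le_pow₀ (by linarith))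
  obtain ⟨F, hF⟩ : ∃ F : Set SL3Z, F = {γ | toR (ζ⁻¹).1 * C * toR γ.1 ∈ bddWin (K ^ 4)} := ⟨_, rfl⟩
  obtain ⟨hFf, hFc⟩ := Set.finite_and_ncard_le (s := F) (m := m) fun G hG =>
    hmult (toR (ζ⁻¹).1 * C) G fun γ hγ => by have := hG γ hγ; rw [hF] at this; exact this
  have hsub : {c | uniConj ζ k c * C ∈ hitPair T ℓ n n' ζ K ε} ∩ {c | ∀ i, |c i| ≤ τ} ⊆
      ⋃ γ ∈ F, ⋃ x ∈ detSet ℓ,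
        {c | uni (rowNu ζ k) c * (toR (ζ⁻¹).1 * C * toR γ.1 * toR x) ∈ hit T n' K ε} := by
    rintro c ⟨⟨hbase, γ, x, hx, hhit⟩, hc⟩
    rw [inv_mul_uniConj_mul] at hhit
    have e : uni (rowNu ζ k) c * (toR (ζ⁻¹).1 * C) * toR γ.1 * toR x =
      uni (rowNu ζ k) c * (toR (ζ⁻¹).1 * C * toR γ.1 * toR x) := by simp only [Matrix.mul_assoc]
    rw [e] at hhit
    refine Set.mem_biUnion (x := γ) ?_ (Set.mem_biUnion (x := x) hx hhit)
    rw [hF]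
    refine ⟨?_, ?_⟩
    · have h2 : EBdd 9 (uni (rowNu ζ k) (-c)) := eBdd_uni_of_le_two hν2 fun i => by
        rw [Pi.neg_apply, abs_neg]; exact (hc i).trans hτ1
      have h3 := h2.mul hhit.1
      rw [← Matrix.mul_assoc, uni_mul_uni, neg_add_cancel, uni_zero, Matrix.one_mul] at h3
      refine (EBdd.of_mul_detSet hℓ hK hx h3).mono ?_
      have : 0 < K ^ 3 := by positivity
      nlinarith
    · rw [mul_right_mem_detWin (toR_det_SL γ), mul_left_mem_detWin (toR_det_SL _)]
      exact (mul_left_mem_detWin (det_uniConj ζ k c)).mp hbase.1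
  refine (measure_mono hsub).trans ((measure_biUnion_finite_le volume hFf _ fun γ _ =>
    measure_biUnion_finite_le volume (finite_detSet ℓ) _
        fun x _ => volume_uni_hit_le hK0 hε hjac _).trans ?_)
  rw [← ENNReal.ofReal_natCast, ← ENNReal.ofReal_natCast, ← ENNReal.ofReal_mul (by positivity),
    ← ENNReal.ofReal_mul (by positivity)]
  refine ENNReal.ofReal_le_ofReal ?_
  have hF2 : (F.ncard : ℝ) ≤ K ^ 117 := by
    have h1 : (F.ncard : ℝ) ≤ m := by exact_mod_cast hFc
    refine (h1.trans hm).trans ?_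
    calc (25 * (K ^ 4) ^ 3) ^ 9 ≤ (K * (K ^ 4) ^ 3) ^ 9 :=
          pow_le_pow_left₀ (by positivity) (mul_le_mul_of_nonneg_right (by linarith) (by positivity)) 9
      _ = K ^ 117 := by ring
  calc (F.ncard : ℝ) * (((detSet ℓ).ncard : ℝ) * (8 * K * ε ^ 2))
      ≤ K ^ 117 * (K * (K * K * ε ^ 2)) := by
        refine mul_le_mul hF2 (mul_le_mul hK.ncard_le ?_ (by positivity) hK0.le) (by positivity)
          (by positivity)
        exact mul_le_mul_of_nonneg_right (mul_le_mul_of_nonneg_right (by linarith) hK0.le) (by positivity)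
    _ = K ^ 120 * ε ^ 2 := by ring

lemma volume_hitPair_le {T : Fin 2 → ℝ → ℝ} (hT : ∀ i, Measurable (T i)) {ℓ : ℤ} (hℓ : ℓ ≠ 0)
    {n n' : Fin 2 → ℝ} (hn : ∀ i, |n i| ≤ 1) (hn' : ∀ i, |n' i| ≤ 1) {ζ : SL3Z}
    (hζ : PlaneClose ζ n') {K ε : ℝ} (hK : BigFor ℓ K) (hε : 0 < ε) (hε1 : ε ≤ 1)
    (hεQ : ε * colQ ζ.1 ≤ K ^ 6) :
    volume (hitPair T ℓ n n' ζ K ε) ≤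
      ENNReal.ofReal (K ^ 186 * ε ^ 2 * (1 / (colQ ζ.1 : ℝ) ^ 2)) := by
  have hK1 := hK.large
  have hK0 : 0 < K := by linarith
  have hQ1 : (1 : ℝ) ≤ colQ ζ.1 := by exact_mod_cast one_le_colQ ζ
  obtain ⟨Q, hQd⟩ : ∃ Q : ℝ, Q = colQ ζ.1 := ⟨_, rfl⟩
  rw [← hQd] at hεQ hQ1 ⊢
  have hQ0 : 0 < Q := by linarith
  have hm := measurableSet_hitPair hT ℓ n n' ζ K ε
  rcases lt_or_ge Q (K ^ 6) with hQ | hQ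
  · refine (measure_mono fun C hC => hC.1).trans ((volume_hitBase_le hT hℓ hn hK hε).trans
      (ENNReal.ofReal_le_ofReal ?_))
    rw [mul_one_div, le_div_iff₀ (by positivity)]
    have h1 : Q ^ 2 ≤ (K ^ 6) ^ 2 := pow_le_pow_left₀ hQ0.le hQ.le 2
    calc K ^ 48 * ε ^ 2 * Q ^ 2 ≤ K ^ 48 * ε ^ 2 * (K ^ 6) ^ 2 :=
          mul_le_mul_of_nonneg_left h1 (by positivity)
      _ = K ^ 60 * ε ^ 2 := by ring
      _ ≤ K ^ 186 * ε ^ 2 := mul_le_mul_of_nonneg_right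
          (pow_le_pow_right₀ (by linarith) (by norm_num)) (by positivity)
  · obtain ⟨k, hk⟩ := exists_natAbs_eq_colQ ζ.1
    have hcast : ∀ r, |toR ζ.1 r 2| = ((ζ.1 r 2).natAbs : ℝ) := fun r => by
      rw [toR_apply, Nat.cast_natAbs, Int.cast_abs]
    have hkQ : |toR ζ.1 k 2| = Q := by rw [hcast, hk, hQd]
    have hmax : ∀ r, |toR ζ.1 r 2| ≤ |toR ζ.1 k 2| := fun r => by
      rw [hcast, hcast, hk]; exact_mod_cast natAbs_le_colQ ζ.1 r
    have hk0 : toR ζ.1 k 2 ≠ 0 := abs_pos.mp (hkQ ▸ hQ0)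
    obtain ⟨τ, hτ⟩ : ∃ τ, τ = ε * Q / K ^ 6 := ⟨_, rfl⟩
    have hτ0 : 0 < τ := by rw [hτ]; positivity
    have hτ1 : τ ≤ 1 := by rw [hτ, div_le_one (by positivity)]; exact hεQ
    obtain ⟨Box, hBox⟩ : ∃ Box : Set (Fin 2 → ℝ), Box = {c | ∀ i, |c i| ≤ τ} := ⟨_, rfl⟩
    have hBoxe : Box = Set.univ.pi fun _ => Set.Icc (-τ) τ := by
      rw [hBox]; ext c; simp only [Set.mem_univ_pi, Set.mem_Icc, abs_le, Set.mem_ofPred_eq]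
    have hBoxv : volume Box = ENNReal.ofReal ((2 * τ) ^ 2) := by
      rw [hBoxe, volume_pi_pi]
      simp only [Real.volume_Icc, Finset.prod_const, Finset.card_univ, Fintype.card_fin]
      rw [← ENNReal.ofReal_pow (by linarith)]; congr 1; ring
    have hfib := lintegral_measure_fiber (m := (volume : Measure M3))
      (ν := volume.restrict Box) (a := fun C c => uniConj ζ k c * C)
      (measurable_matrix_mul.comp (((measurable_uniConj ζ k).comp measurable_snd).prodMk measurable_fst))
      (fun c => measurePreserving_mul_left (det_uniConj ζ k c)) hm
    rw [Measure.restrict_apply_univ, hBoxv] at hfib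
    have hpt : ∀ C : M3, (volume.restrict Box) {c | uniConj ζ k c * C ∈ hitPair T ℓ n n' ζ K ε} ≤
        (hitBase T ℓ n (2 * K) (2 * ε)).indicator (fun _ => ENNReal.ofReal (K ^ 120 * ε ^ 2)) C := by
      intro C
      have hmc : MeasurableSet {c | uniConj ζ k c * C ∈ hitPair T ℓ n n' ζ K ε} :=
        ((measurable_mul_right C).comp (measurable_uniConj ζ k)) hm
      rw [Measure.restrict_apply hmc]
      rcases Set.eq_empty_or_nonempty ({c | uniConj ζ k c * C ∈ hitPair T ℓ n n' ζ K ε} ∩ Box) with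
        h | ⟨c, hc, hc1⟩
      · rw [h]; simp
      · have hC : C ∈ hitBase T ℓ n (2 * K) (2 * ε) := by
          obtain ⟨⟨hwin, x, hx, hhit⟩, _⟩ := hc
          refine ⟨(mul_left_mem_detWin (det_uniConj ζ k c)).mp hwin, x, hx, ?_⟩
          rw [hBox] at hc1
          have h2 := (hζ.eBdd_uniConj_sub_one hk0 hmax (c := -c) (t := τ) fun i => by
            rw [Pi.neg_apply, abs_neg]; exact hc1 i).mul hhit.1
          have e : (uniConj ζ k (-c) - 1) * (uniConj ζ k c * C * toR x) =
              C * toR x - uniConj ζ k c * C * toR x := by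
            rw [Matrix.sub_mul, Matrix.one_mul, ← Matrix.mul_assoc, ← Matrix.mul_assoc,
              uniConj_neg_mul, Matrix.one_mul]
          rw [e, hkQ] at h2
          refine mem_hit_of_close hn hK1 hε1 (le_of_eq ?_) hhit ?_ h2
          · rw [hτ]; field_simp; ring
          · rw [Matrix.mul_assoc, Matrix.det_mul (uniConj ζ k c), det_uniConj, one_mul]
        rw [Set.indicator_of_mem hC, hBox]
        exact volume_uniConj_hitPair_le hℓ hn' hζ hK hε hτ1 (by rw [hkQ]; exact hQ) C
    have h1 := lintegral_mono (μ := volume) hpt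
    rw [lintegral_indicator (measurableSet_hitBase hT _ _ _ _), setLIntegral_const, hfib] at h1
    have h2 := volume_hitBase_le hT hℓ hn (hK.mono (show K ≤ 2 * K by linarith))
      (show 0 < 2 * ε by linarith)
    have h3 : ENNReal.ofReal ((2 * τ) ^ 2) * volume (hitPair T ℓ n n' ζ K ε) ≤
        ENNReal.ofReal (K ^ 120 * ε ^ 2 * ((2 * K) ^ 48 * (2 * ε) ^ 2)) := by
      refine h1.trans ?_
      rw [ENNReal.ofReal_mul (p := K ^ 120 * ε ^ 2) (by positivity)]
      exact mul_le_mul_right h2 _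
    have hpos : 0 < (2 * τ) ^ 2 := by positivity
    rw [mul_comm, ← ENNReal.le_div_iff_mul_le (Or.inl (by simpa using hτ0.ne'))
      (Or.inl ENNReal.ofReal_ne_top), ← ENNReal.ofReal_div_of_pos hpos] at h3
    refine h3.trans (ENNReal.ofReal_le_ofReal ?_)
    have h48 : (2 : ℝ) ^ 48 ≤ K ^ 6 :=
      le_trans (by norm_num) (pow_le_pow_left₀ (by norm_num) hK1 6)
    rw [div_le_iff₀ hpos, hτ]
    have e1 : K ^ 120 * ε ^ 2 * ((2 * K) ^ 48 * (2 * ε) ^ 2) = 2 ^ 48 * (4 * K ^ 168 * ε ^ 4) := by ring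
    have e2 : K ^ 186 * ε ^ 2 * (1 / Q ^ 2) * (2 * (ε * Q / K ^ 6)) ^ 2 = K ^ 6 * (4 * K ^ 168 * ε ^ 4) := by
      field_simp
      norm_num
    rw [e1, e2]
    exact mul_le_mul_of_nonneg_right h48 (by positivity)

/-- Left translates of `bddWin L`. -/
def bddWinL (w : M3) (L : ℝ) : Set M3 := {A | w * A ∈ bddWin L}

lemma measurableSet_bddWinL (w : M3) (L : ℝ) : MeasurableSet (bddWinL w L) :=
  measurable_mul_left w (measurableSet_bddWin L)

lemma volume_hitFor_inter_le {T : Fin 2 → ℝ → ℝ} (hT : ∀ i, Measurable (T i)) {ℓ : ℤ} (hℓ : ℓ ≠ 0)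
    {h : ℕ} (hh : 1 ≤ h) {γ γ' : SL3Z} (H : ColBox h γ.1) (H' : ColBox h γ'.1) {K ε : ℝ}
    (hK : BigFor ℓ K) (hε : 0 < ε) (hε1 : ε ≤ 1) (hεh : ε * (h : ℝ) ^ 3 ≤ 1) {w : M3} (hw : w.det = 1)
    {L : ℝ} (hL : 1 ≤ L) :
    volume (bddWinL w L ∩ (hitFor T ℓ K ε γ ∩ hitFor T ℓ K ε γ')) ≤
      ENNReal.ofReal ((25 * L ^ 3) ^ 9 * (K ^ 186 * ε ^ 2) * (1 / (colQ (γ * γ'⁻¹).1 : ℝ) ^ 2)) := by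
  obtain ⟨m, hm, hmult⟩ := exists_multiplicity hL
  have hm1 := measurableSet_hitFor hT ℓ K ε γ
  have hm2 := measurableSet_hitFor hT ℓ K ε γ'
  have hmE := measurable_mul_left (toR γ.1)
    (measurableSet_hitBase hT ℓ (nOf (toR γ.1)) K ε)
  have hfold := lintegral_fold_le (R := bddWinL w L ∩ hitFor T ℓ K ε γ)
    (E := {A | toR γ.1 * A ∈ hitBase T ℓ (nOf (toR γ.1)) K ε})
    (Φ := (hitFor T ℓ K ε γ').indicator 1) ((measurableSet_bddWinL w L).inter hm1) hmE
    (measurable_one.indicator hm2)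
    (fun A γ₃ => by
      by_cases hA : A ∈ hitFor T ℓ K ε γ'
      · rw [Set.indicator_of_mem hA, Set.indicator_of_mem ((hitFor_mul_right γ₃).mpr hA)]; rfl
      · rw [Set.indicator_of_notMem hA,
          Set.indicator_of_notMem (fun h => hA ((hitFor_mul_right γ₃).mp h))])
    (fun A hA => by
      obtain ⟨⟨_, hdet⟩, γ₂, x, hx, hhit⟩ := hA
      refine ⟨γ₂, ?_, x, hx, ?_⟩
      · rw [mul_left_mem_detWin (toR_det_SL γ), mul_right_mem_detWin (toR_det_SL γ₂)]
        exact (mul_left_mem_detWin hw).mp hdet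
      · simpa only [Matrix.mul_assoc] using hhit) (m := m)
    (fun A F hF => hmult (w * A) F fun γ₃ hγ₃ => by
      have := (hF γ₃ hγ₃).1
      rw [Matrix.mul_assoc]; exact this)
  rw [lintegral_indicator_one₀ hm2.nullMeasurableSet, lintegral_indicator_one₀ hm2.nullMeasurableSet,
    Measure.restrict_apply hm2, Measure.restrict_apply hm2] at hfold
  have e1 : bddWinL w L ∩ (hitFor T ℓ K ε γ ∩ hitFor T ℓ K ε γ') =
      hitFor T ℓ K ε γ' ∩ (bddWinL w L ∩ hitFor T ℓ K ε γ) := by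
    rw [← Set.inter_assoc, Set.inter_comm]
  rw [e1]
  refine hfold.trans ?_
  have hpair : volume (hitFor T ℓ K ε γ' ∩ {A | toR γ.1 * A ∈ hitBase T ℓ (nOf (toR γ.1)) K ε}) ≤
      ENNReal.ofReal (K ^ 186 * ε ^ 2 * (1 / (colQ (γ * γ'⁻¹).1 : ℝ) ^ 2)) := by
    refine le_trans ?_ (volume_hitPair_le hT hℓ (H.abs_nOf_le hh) (H'.abs_nOf_le hh)
      (quot_row_close hh H H') hK hε hε1 ?_)
    · rw [← (measurePreserving_mul_left (toR_det_SL γ)).measure_preimage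
        (measurableSet_hitPair hT _ _ _ _ _ _).nullMeasurableSet]
      refine measure_mono ?_
      rintro A ⟨⟨γ₂, x, hx, hhit⟩, hA⟩
      refine ⟨hA, γ₂, x, hx, ?_⟩
      have e : toR ((γ * γ'⁻¹)⁻¹).1 * (toR γ.1 * A) = toR γ'.1 * A := by
        rw [← Matrix.mul_assoc, ← toR_mul, ← Matrix.SpecialLinearGroup.coe_mul,
          show (γ * γ'⁻¹)⁻¹ * γ = γ' by group]
      rw [e]; exact hhit
    · have h1 := colQ_quot_le H H'
      have h2 := mul_le_mul_of_nonneg_left h1 hε.le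
      have h3 : (20250 : ℝ) ≤ K ^ 6 :=
        le_trans (by norm_num) (pow_le_pow_left₀ (by norm_num) hK.large 6)
      nlinarith
  refine (mul_le_mul_right hpair _).trans ?_
  rw [← ENNReal.ofReal_natCast, ← ENNReal.ofReal_mul (by positivity)]
  refine ENNReal.ofReal_le_ofReal ?_
  rw [mul_assoc ((25 * L ^ 3) ^ 9)]
  exact mul_le_mul_of_nonneg_right hm (mul_nonneg (by have := hK.large; positivity) (by positivity))

/-- The number of `γ ∈ S` for which `A` is a hit. -/
noncomputable def hitCount (T : Fin 2 → ℝ → ℝ) (ℓ : ℤ) (K ε : ℝ) (S : Finset SL3Z) (A : M3) : ENNReal :=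
  ∑ γ ∈ S, (hitFor T ℓ K ε γ).indicator 1 A

lemma measurable_hitCount {T : Fin 2 → ℝ → ℝ} (hT : ∀ i, Measurable (T i)) (ℓ : ℤ) (K ε : ℝ)
    (S : Finset SL3Z) : Measurable (hitCount T ℓ K ε S) :=
  Finset.measurable_fun_sum _ fun γ _ => measurable_one.indicator (measurableSet_hitFor hT ℓ K ε γ)

lemma second_moment {T : Fin 2 → ℝ → ℝ} (hT : ∀ i, Measurable (T i)) {ℓ : ℤ} (hℓ : ℓ ≠ 0)
    {j : ℕ} {S : Finset SL3Z} (hS : ∀ γ ∈ S, ColBox (2 ^ j) γ.1) {K ε : ℝ}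
    (hK : BigFor ℓ K) (hε : 0 < ε) (hε1 : ε ≤ 1) (hεh : ε * (2 ^ j) ^ 3 ≤ 1) {w : M3} (hw : w.det = 1)
    {L : ℝ} (hL : 1 ≤ L) :
    ∫⁻ A in bddWinL w L, hitCount T ℓ K ε S A ^ 2 ≤
      ENNReal.ofReal ((25 * L ^ 3) ^ 9 * (K ^ 186 * ε ^ 2) *
        (S.card * (4 * (270 * 432 ^ 2) * (3 * j + 15)))) := by
  have hKp : 0 ≤ K := by have := hK.large; linarith
  have e : ∀ A, hitCount T ℓ K ε S A ^ 2 = ∑ γ' ∈ S, ∑ γ ∈ S,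
      (hitFor T ℓ K ε γ ∩ hitFor T ℓ K ε γ').indicator 1 A := by
    intro A
    rw [sq, hitCount, Finset.sum_mul_sum, Finset.sum_comm]
    refine Finset.sum_congr rfl fun γ' _ => Finset.sum_congr rfl fun γ _ => ?_
    rw [Set.inter_indicator_one]; rfl
  have hmm : ∀ γ γ', MeasurableSet (hitFor T ℓ K ε γ ∩ hitFor T ℓ K ε γ') := fun γ γ' =>
    (measurableSet_hitFor hT ℓ K ε γ).inter (measurableSet_hitFor hT ℓ K ε γ')
  simp only [e]
  rw [lintegral_finsetSum _ fun γ' _ => Finset.measurable_fun_sum _ fun γ _ =>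
    measurable_one.indicator (hmm γ γ')]
  have hin : ∀ γ' ∈ S, ∫⁻ A in bddWinL w L, ∑ γ ∈ S,
      (hitFor T ℓ K ε γ ∩ hitFor T ℓ K ε γ').indicator 1 A ≤ ENNReal.ofReal
      ((25 * L ^ 3) ^ 9 * (K ^ 186 * ε ^ 2) * (4 * (270 * 432 ^ 2) * (3 * j + 15))) := by
    intro γ' hγ'
    rw [lintegral_finsetSum _ fun γ _ => measurable_one.indicator (hmm γ γ')]
    refine (Finset.sum_le_sum fun γ hγ => ?_).trans ((ENNReal.ofReal_sum_of_nonneg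
      (f := fun γ => (25 * L ^ 3) ^ 9 * (K ^ 186 * ε ^ 2) * (1 / (colQ (γ * γ'⁻¹).1 : ℝ) ^ 2))
      fun γ hγ => by positivity).symm.le.trans (ENNReal.ofReal_le_ofReal ?_))
    · rw [lintegral_indicator_one₀ (hmm γ γ').nullMeasurableSet, Measure.restrict_apply (hmm γ γ'),
        Set.inter_comm]
      exact volume_hitFor_inter_le hT hℓ Nat.one_le_two_pow (hS γ hγ) (hS γ' hγ') hK hε hε1
        (by exact_mod_cast hεh) hw hL
    · rw [← Finset.mul_sum]
      exact mul_le_mul_of_nonneg_left (sum_inv_colQ_le S hS (hS γ' hγ')) (by positivity)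
  refine (Finset.sum_le_sum hin).trans ?_
  rw [Finset.sum_const, nsmul_eq_mul, ← ENNReal.ofReal_natCast, ← ENNReal.ofReal_mul (by positivity)]
  refine ENNReal.ofReal_le_ofReal (le_of_eq ?_)
  ring

lemma volume_mulVec_cube {w : M3} (hw : w.det = 1) {c : ℝ} :
    volume {v : Fin 3 → ℝ | ∀ i, |(w *ᵥ v) i| < c} = ENNReal.ofReal (2 * c) ^ 3 := by
  have hmap := Real.map_matrix_volume_pi_eq_smul_volume_pi (M := w) (by rw [hw]; norm_num)
  rw [hw] at hmap
  simp only [inv_one, abs_one, ENNReal.ofReal_one, one_smul] at hmap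
  have hcube : {v : Fin 3 → ℝ | ∀ i, |v i| < c} = Set.univ.pi fun _ => Set.Ioo (-c) c := by
    ext v; simp [abs_lt]
  have hm : MeasurableSet {v : Fin 3 → ℝ | ∀ i, |v i| < c} := by
    rw [hcube]; exact MeasurableSet.univ_pi fun _ => measurableSet_Ioo
  have hmeas : Measurable (toLin' w) := (LinearMap.continuous_of_finiteDimensional _).measurable
  have h1 := Measure.map_apply (μ := volume) hmeas hm
  rw [hmap] at h1
  have h2 : {v : Fin 3 → ℝ | ∀ i, |(w *ᵥ v) i| < c} = toLin' w ⁻¹' {v | ∀ i, |v i| < c} := by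
    ext v; simp [toLin'_apply]
  rw [h2, ← h1, hcube, volume_pi_pi]
  simp [Real.volume_Ioo, two_mul]

lemma volume_cols {j : Fin 3} {G : Set (Fin 3 → ℝ)} (hG : MeasurableSet G) {L : ℝ} :
    volume {B : M3 | (∀ i k, k ≠ j → |B i k| ≤ L) ∧ (fun i => B i j) ∈ G} =
      ENNReal.ofReal (2 * L) ^ 6 * volume G := by
  obtain ⟨s, hs⟩ : ∃ s : Fin 3 → Set (Fin 3 → ℝ), s = fun k =>
      if k = j then G else Set.univ.pi fun _ => Set.Icc (-L) L := ⟨_, rfl⟩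
  have hsm : ∀ k, MeasurableSet (s k) := fun k => by
    rw [hs]; dsimp only; split_ifs
    · exact hG
    · exact MeasurableSet.univ_pi fun _ => measurableSet_Icc
  have hset : {B : M3 | (∀ i k, k ≠ j → |B i k| ≤ L) ∧ (fun i => B i j) ∈ G} =
      (fun B : M3 => Bᵀ) ⁻¹' (Set.univ.pi s : Set (Fin 3 → Fin 3 → ℝ)) := by
    ext B
    rw [hs]
    constructor
    · rintro ⟨h1, h2⟩ k _
      change (fun i => B i k) ∈ if k = j then G else Set.univ.pi fun _ => Set.Icc (-L) L
      split_ifs with hk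
      · rw [hk]; exact h2
      · rw [Set.mem_univ_pi]; exact fun i => abs_le.mp (h1 i k hk)
    · intro h
      refine ⟨fun i k hk => ?_, ?_⟩
      · have : (fun i => B i k) ∈ if k = j then G else Set.univ.pi fun _ => Set.Icc (-L) L :=
          h k (Set.mem_univ k)
        rw [if_neg hk, Set.mem_univ_pi] at this
        exact abs_le.mpr (this i)
      · have : (fun i => B i j) ∈ if j = j then G else Set.univ.pi fun _ => Set.Icc (-L) L :=
          h j (Set.mem_univ j)
        rw [if_pos rfl] at this
        exact this
  rw [hset, measurePreserving_transpose.measure_preimage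
    (MeasurableSet.univ_pi hsm).nullMeasurableSet]
  refine (volume_pi_pi s).trans ?_
  have hcube : volume (Set.univ.pi fun _ : Fin 3 => Set.Icc (-L) L) = ENNReal.ofReal (2 * L) ^ 3 := by
    rw [volume_pi_pi]; simp [Real.volume_Icc, two_mul]
  have : ∀ k, volume (s k) = if k = j then volume G else ENNReal.ofReal (2 * L) ^ 3 := by
    intro k; rw [hs]; dsimp only; split_ifs
    · rfl
    · exact hcube
  simp only [this]
  rw [Fin.prod_univ_three]
  fin_cases j <;> simp <;> ring

lemma volume_cusp_vector_le {w : M3} (hw : w.det = 1) {κ L : ℝ} (hκ : 0 < κ) (hL : 0 ≤ L)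
    {q : Fin 3 → ℝ} {j : Fin 3} {k : ℝ} (hk : 0 < k) (hq : |q j| = k) :
    volume {A : M3 | EBdd L A ∧ ∀ i, |((w * A) *ᵥ q) i| < κ} ≤
      ENNReal.ofReal ((2 * L) ^ 6 * (2 * κ / k) ^ 3) := by
  have hq0 : q j ≠ 0 := by rw [← abs_pos, hq]; exact hk
  obtain ⟨P, hP⟩ : ∃ P : M3, P = (1 : M3).updateCol j fun i => q i / q j := ⟨_, rfl⟩
  have hPd : P.det = 1 := by
    rw [hP, det_fin_three]
    fin_cases j <;> simp <;> exact hq0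
  have hcol : ∀ (A : M3) i, (A * P) i j = (A *ᵥ q) i / q j := by
    intro A i
    rw [hP, mul_apply, mulVec, dotProduct, Finset.sum_div]
    exact Finset.sum_congr rfl fun l _ => by rw [updateCol_self, mul_div_assoc]
  have hoth : ∀ (A : M3) i l, l ≠ j → (A * P) i l = A i l := by
    intro A i l hl
    rw [hP, mul_apply]
    simp only [updateCol_ne hl]
    rw [← mul_apply, mul_one]
  have hGm : MeasurableSet {v : Fin 3 → ℝ | ∀ i, |(w *ᵥ v) i| < κ / k} := by
    have : IsOpen {v : Fin 3 → ℝ | ∀ i, |(w *ᵥ v) i| < κ / k} := by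
      simp only [Set.ofPred_forall]
      exact isOpen_iInter_of_finite fun i => isOpen_lt (by fun_prop) continuous_const
    exact this.measurableSet
  have hmeas : MeasurableSet {B : M3 | (∀ i l, l ≠ j → |B i l| ≤ L) ∧
      (fun i => B i j) ∈ {v : Fin 3 → ℝ | ∀ i, |(w *ᵥ v) i| < κ / k}} := by
    refine MeasurableSet.inter (s₁ := {B : M3 | ∀ i l, l ≠ j → |B i l| ≤ L}) ?_ ?_
    · simp only [Set.ofPred_forall]
      exact MeasurableSet.iInter fun i => MeasurableSet.iInter fun l => MeasurableSet.iInter fun _ =>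
        (isClosed_le (by fun_prop) continuous_const).measurableSet
    · exact (show Continuous fun B : M3 => fun i => B i j by fun_prop).measurable hGm
  have hc := volume_cols (j := j) hGm (L := L)
  rw [volume_mulVec_cube hw] at hc
  rw [← (measurePreserving_mul_right hPd).measure_preimage hmeas.nullMeasurableSet] at hc
  refine (measure_mono ?_).trans (hc.le.trans (le_of_eq ?_))
  · rintro A ⟨hA, hAq⟩
    refine ⟨fun i l hl => by change |(A * P) i l| ≤ L; rw [hoth A i l hl]; exact hA i l, fun i => ?_⟩
    have e : (fun i => (A * P) i j) = (q j)⁻¹ • (A *ᵥ q) := by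
      ext i; rw [hcol, Pi.smul_apply, smul_eq_mul, div_eq_inv_mul]
    change |(w *ᵥ fun i => (A * P) i j) i| < κ / k
    rw [e, mulVec_smul, mulVec_mulVec, Pi.smul_apply, smul_eq_mul, abs_mul, abs_inv, hq,
      ← div_eq_inv_mul]
    exact (div_lt_div_iff_of_pos_right hk).mpr (hAq i)
  · rw [← ENNReal.ofReal_pow (by positivity), ← ENNReal.ofReal_pow (by positivity),
      ← ENNReal.ofReal_mul (by positivity), mul_div_assoc]

/-- Integral vectors of sup norm `k` attained at the coordinate `j`. -/
noncomputable def sphereAt (j : Fin 3) (k : ℕ) : Finset (Fin 3 → ℤ) :=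
  Fintype.piFinset fun i => if i = j then {(k : ℤ), -(k : ℤ)} else Finset.Icc (-(k : ℤ)) k

lemma card_sphereAt_le (j : Fin 3) {k : ℕ} (hk : 1 ≤ k) : (sphereAt j k).card ≤ 18 * k ^ 2 := by
  have h1 : ∀ i, (if i = j then ({(k : ℤ), -(k : ℤ)} : Finset ℤ) else Finset.Icc (-(k : ℤ)) k).card ≤
      if i = j then 2 else 3 * k := by
    intro i; split_ifs
    · exact Finset.card_le_two
    · rw [Int.card_Icc]; omega
  rw [sphereAt, Fintype.card_piFinset]
  refine (Finset.prod_le_prod' fun i _ => h1 i).trans ?_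
  rw [Fin.prod_univ_three]
  fin_cases j <;> simp <;> nlinarith

lemma exists_mem_sphereAt {q : Fin 3 → ℤ} (hq : q ≠ 0) : ∃ j, ∃ k : ℕ, 1 ≤ k ∧ (q j).natAbs = k ∧
    q ∈ sphereAt j k := by
  obtain ⟨j, hj⟩ := Finite.exists_max fun i => (q i).natAbs
  refine ⟨j, (q j).natAbs, ?_, rfl, ?_⟩
  · obtain ⟨i, hi⟩ := Function.ne_iff.mp hq
    have := hj i
    simp only [Pi.zero_apply] at hi
    omega
  · rw [sphereAt, Fintype.mem_piFinset]
    intro i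
    split_ifs with h
    · rw [h, Finset.mem_insert, Finset.mem_singleton]; omega
    · rw [Finset.mem_Icc]; have := hj i; omega

lemma cusp_vector_bound {w A : M3} (hw : w.det = 1) {Λ κ L : ℝ} (hΛ : EBdd Λ w.adjugate)
    (hκ1 : κ ≤ 1) (hA : A ∈ bddWin L) {q : Fin 3 → ℝ}
    (hq : ∀ i, |((w * A) *ᵥ q) i| < κ) (j : Fin 3) : |q j| ≤ 36 * L ^ 2 * Λ := by
  have hd : 1 / 2 ≤ |A.det| := abs_det_of_mem_detWin hA.2
  have hL : 0 ≤ L := hA.1.nonneg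
  have hΛ0 : 0 ≤ Λ := hΛ.nonneg
  have hadj := hA.1.adjugate.mul hΛ
  have e : A.det • q = (A.adjugate * w.adjugate) *ᵥ ((w * A) *ᵥ q) := by
    rw [mulVec_mulVec, ← adjugate_mul_distrib, adjugate_mul, det_mul, hw, one_mul, smul_mulVec,
      one_mulVec]
  have e2 : A.det * q j = ∑ l, (A.adjugate * w.adjugate) j l * ((w * A) *ᵥ q) l :=
    congrFun e j
  have hb : |A.det * q j| ≤ 18 * L ^ 2 * Λ := by
    rw [e2]
    refine (Finset.abs_sum_le_sum_abs _ _).trans ?_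
    have : ∀ l ∈ Finset.univ, |(A.adjugate * w.adjugate) j l * ((w * A) *ᵥ q) l| ≤
        3 * (2 * L ^ 2) * Λ * 1 := fun l _ => by
      rw [abs_mul]
      exact mul_le_mul (hadj j l) ((hq l).le.trans hκ1) (abs_nonneg _) (by positivity)
    refine (Finset.sum_le_card_nsmul _ _ _ this).trans (le_of_eq ?_)
    simp; ring
  rw [abs_mul] at hb
  nlinarith [abs_nonneg (q j)]

lemma volume_cusp_le {w : M3} (hw : w.det = 1) {Λ κ L : ℝ} (hΛ : EBdd Λ w.adjugate) (hκ : 0 < κ)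
    (hκ1 : κ ≤ 1) (hL : 0 ≤ L) {M : ℕ} (hM : 36 * L ^ 2 * Λ ≤ 2 ^ M) :
    volume {A | A ∈ bddWin L ∧ Cusp κ (w * A)} ≤ ENNReal.ofReal (27648 * L ^ 6 * κ ^ 3 * (M + 1)) := by
  obtain ⟨f, hf⟩ : ∃ f : (Fin 3 → ℤ) → Set M3, f = fun q =>
    {A : M3 | EBdd L A ∧ ∀ i, |((w * A) *ᵥ fun l => (q l : ℝ)) i| < κ} := ⟨_, rfl⟩
  have hsub : {A | A ∈ bddWin L ∧ Cusp κ (w * A)} ⊆ ⋃ k ∈ Finset.Icc 1 (2 ^ M), ⋃ j ∈ (Finset.univ : Finset (Fin 3)),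
      ⋃ q ∈ (sphereAt j k).filter (fun q => (q j).natAbs = k), f q := by
    rintro A ⟨hA, q, hq, hqA⟩
    obtain ⟨j, k, hk, hkq, hs⟩ := exists_mem_sphereAt hq
    have hb := (cusp_vector_bound hw hΛ hκ1 hA hqA j).trans hM
    have hk2 : k ≤ 2 ^ M := by
      rw [← hkq]
      have : ((q j).natAbs : ℝ) ≤ 2 ^ M := by rw [Nat.cast_natAbs, Int.cast_abs]; exact hb
      exact_mod_cast this
    simp only [Set.mem_iUnion]
    refine ⟨k, Finset.mem_Icc.mpr ⟨hk, hk2⟩, j, Finset.mem_univ _, q,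
      Finset.mem_filter.mpr ⟨hs, hkq⟩, ?_⟩
    rw [hf]; exact ⟨hA.1, hqA⟩
  have hq : ∀ k ∈ Finset.Icc 1 (2 ^ M), ∀ j ∈ (Finset.univ : Finset (Fin 3)),
      volume (⋃ q ∈ (sphereAt j k).filter (fun q => (q j).natAbs = k), f q) ≤
        ENNReal.ofReal (18 * k ^ 2 * ((2 * L) ^ 6 * (2 * κ / k) ^ 3)) := by
    intro k hk j _
    have hk1 := (Finset.mem_Icc.mp hk).1
    have hkr : (0 : ℝ) < k := by exact_mod_cast hk1
    refine (measure_biUnion_finset_le _ _).trans ((Finset.sum_le_card_nsmul _ _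
      (ENNReal.ofReal ((2 * L) ^ 6 * (2 * κ / k) ^ 3)) fun q hq => ?_).trans ?_)
    · have := (Finset.mem_filter.mp hq).2
      rw [hf]
      exact volume_cusp_vector_le hw hκ hL hkr (j := j) (by
        rw [← this, Nat.cast_natAbs, Int.cast_abs])
    · rw [nsmul_eq_mul, ← ENNReal.ofReal_natCast, ← ENNReal.ofReal_mul (by positivity)]
      refine ENNReal.ofReal_le_ofReal (mul_le_mul_of_nonneg_right ?_ (by positivity))
      exact_mod_cast (Finset.card_filter_le _ _).trans (card_sphereAt_le j hk1)
  have hk : ∀ k ∈ Finset.Icc 1 (2 ^ M), volume (⋃ j ∈ (Finset.univ : Finset (Fin 3)),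
      ⋃ q ∈ (sphereAt j k).filter (fun q => (q j).natAbs = k), f q) ≤
        ENNReal.ofReal (27648 * L ^ 6 * κ ^ 3 * (k : ℝ)⁻¹) := by
    intro k hk
    have hk1 := (Finset.mem_Icc.mp hk).1
    have hkr : (0 : ℝ) < k := by exact_mod_cast hk1
    refine (measure_biUnion_finset_le _ _).trans ((Finset.sum_le_card_nsmul _ _ _ (hq k hk)).trans ?_)
    rw [nsmul_eq_mul, ← ENNReal.ofReal_natCast, ← ENNReal.ofReal_mul (by positivity)]
    refine ENNReal.ofReal_le_ofReal (le_of_eq ?_)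
    simp; field_simp; ring
  refine (measure_mono hsub).trans ((measure_biUnion_finset_le _ _).trans
    ((Finset.sum_le_sum hk).trans ?_))
  rw [← ENNReal.ofReal_sum_of_nonneg fun k _ => by positivity, ← Finset.mul_sum]
  refine ENNReal.ofReal_le_ofReal (mul_le_mul_of_nonneg_left ?_ (by positivity))
  have h1 := harmonic_le_one_add_log (2 ^ M)
  rw [harmonic_eq_sum_Icc] at h1
  push_cast at h1
  refine h1.trans ?_
  rw [Real.log_pow]
  have := Real.log_two_lt_d9
  nlinarith [(Nat.cast_nonneg M : (0 : ℝ) ≤ M)]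

section Torus

open UnitAddTorus

noncomputable local instance : MeasureSpace UnitAddCircle := ⟨AddCircle.haarAddCircle⟩

local instance : Measure.IsAddHaarMeasure (volume : Measure UnitAddCircle) :=
  inferInstanceAs (Measure.IsAddHaarMeasure AddCircle.haarAddCircle)

local instance : IsProbabilityMeasure (volume : Measure UnitAddCircle) :=
  inferInstanceAs (IsProbabilityMeasure AddCircle.haarAddCircle)

lemma tsum_sq_mFourierCoeff {f : UnitAddTorus (Fin 2) → ℂ} (hf : MemLp f 2 volume) :
    ∑' k, ‖mFourierCoeff f k‖ₑ ^ 2 = ∫⁻ t, ‖f t‖ₑ ^ 2 := by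
  have h := hasSum_sq_mFourierCoeff hf.toLp
  have hc : ∀ k, mFourierCoeff (hf.toLp : UnitAddTorus (Fin 2) → ℂ) k = mFourierCoeff f k := fun k =>
    integral_congr_ae (hf.coeFn_toLp.mono fun t ht => by simp only [ht])
  have hi : ∫ t, ‖(hf.toLp : UnitAddTorus (Fin 2) → ℂ) t‖ ^ 2 = ∫ t, ‖f t‖ ^ 2 :=
    integral_congr_ae (hf.coeFn_toLp.mono fun t ht => by simp only [ht])
  rw [hi] at h
  simp only [hc] at h
  have h_int : Integrable (fun t => ‖f t‖ ^ 2) volume := hf.integrable_norm_pow (by norm_num)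
  have h1 : ∫⁻ t, ‖f t‖ₑ ^ 2 = ENNReal.ofReal (∫ t, ‖f t‖ ^ 2) := by
    rw [ofReal_integral_eq_lintegral_ofReal h_int (Filter.Eventually.of_forall fun t => by positivity)]
    refine lintegral_congr fun t => ?_
    rw [ENNReal.ofReal_pow (norm_nonneg _), ofReal_norm]
  rw [h1, ← h.tsum_eq, ENNReal.ofReal_tsum_of_nonneg (fun k => by positivity) h.summable]
  refine tsum_congr fun k => ?_
  rw [ENNReal.ofReal_pow (norm_nonneg _), ofReal_norm]

/-- The endomorphism of the torus given by the matrix `(a, 1; -(a² + 1), -a)`. -/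
def torusHom (a : ℤ) : UnitAddTorus (Fin 2) →+ UnitAddTorus (Fin 2) where
  toFun t := ![a • t 0 + t 1, -(a ^ 2 + 1) • t 0 - a • t 1]
  map_zero' := by ext i; fin_cases i <;> simp
  map_add' s t := by
    ext i
    fin_cases i
    · simp only [Pi.add_apply, smul_add, Fin.zero_eta, cons_val_zero]; abel
    · simp only [Pi.add_apply, smul_add, Fin.mk_one, cons_val_one, cons_val_zero]; abel

lemma torusHom_apply (a : ℤ) (t : UnitAddTorus (Fin 2)) :
    torusHom a t = ![a • t 0 + t 1, -(a ^ 2 + 1) • t 0 - a • t 1] := rfl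

lemma continuous_torusHom (a : ℤ) : Continuous (torusHom a) := by
  refine continuous_pi fun i => ?_
  fin_cases i
  · change Continuous fun t : UnitAddTorus (Fin 2) => a • t 0 + t 1
    fun_prop
  · change Continuous fun t : UnitAddTorus (Fin 2) => -(a ^ 2 + 1) • t 0 - a • t 1
    fun_prop

lemma torusHom_torusHom (a : ℤ) (t : UnitAddTorus (Fin 2)) : torusHom a (torusHom a t) = -t := by
  ext i
  fin_cases i
  · simp only [torusHom_apply, Fin.zero_eta, cons_val_zero, cons_val_one, Pi.neg_apply]
    module
  · simp only [torusHom_apply, Fin.mk_one, cons_val_zero, cons_val_one, Pi.neg_apply]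
    module

lemma measurePreserving_torusHom (a : ℤ) : MeasurePreserving (torusHom a) volume volume :=
  (torusHom a).measurePreserving (continuous_torusHom a)
    (fun t => ⟨-torusHom a t, by rw [map_neg, torusHom_torusHom, neg_neg]⟩) rfl

lemma mFourier_eq_toCircle (k : Fin 2 → ℤ) (t : UnitAddTorus (Fin 2)) :
    mFourier k t = (AddCircle.toCircle (k 0 • t 0 + k 1 • t 1) : ℂ) := by
  rw [AddCircle.toCircle_add, Circle.coe_mul]
  simp only [mFourier, ContinuousMap.coe_mk, Fin.prod_univ_two, fourier_apply]

/-- The automorphism of `ℤ²` dual to `torusHom a`. -/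
def dualMap (a : ℤ) : (Fin 2 → ℤ) ≃ (Fin 2 → ℤ) where
  toFun k := ![-(a * k 0 - (a ^ 2 + 1) * k 1), -(k 0 - a * k 1)]
  invFun k := ![a * k 0 - (a ^ 2 + 1) * k 1, k 0 - a * k 1]
  left_inv k := by ext i; fin_cases i <;> simp <;> ring
  right_inv k := by ext i; fin_cases i <;> simp <;> ring

lemma mFourierCoeff_comp_torusHom (a : ℤ) (f : UnitAddTorus (Fin 2) → ℂ) (hf : Measurable f)
    (k : Fin 2 → ℤ) : mFourierCoeff (fun t => f (torusHom a t)) k = mFourierCoeff f (dualMap a k) := by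
  have hmp := measurePreserving_torusHom a
  have key := integral_map (μ := volume) (f := fun t => mFourier (-dualMap a k) t • f t)
    hmp.measurable.aemeasurable
    (((mFourier (-dualMap a k)).continuous.measurable.smul hf).aestronglyMeasurable)
  rw [hmp.map_eq] at key
  rw [mFourierCoeff, mFourierCoeff, key]
  refine integral_congr_ae (Filter.Eventually.of_forall fun t => ?_)
  have : mFourier (-k) t = mFourier (-dualMap a k) (torusHom a t) := by
    rw [mFourier_eq_toCircle, mFourier_eq_toCircle]
    congr 2
    simp only [dualMap, Equiv.coe_fn_mk, torusHom_apply, Pi.neg_apply, cons_val_zero, cons_val_one]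
    module
  simp only [this]

/-- The vectors expanded by `dualMap a`. -/
def Cone (a : ℤ) (k : Fin 2 → ℤ) : Prop := |k 0 - a * k 1| < |k 1|

lemma eq_zero_of_mem_two_cones {i i' : ℕ} (hi : i ≠ i') {k : Fin 2 → ℤ}
    (h : |k 0 - 3 * i * k 1| ≤ |k 1|) (h' : |k 0 - 3 * i' * k 1| ≤ |k 1|) : k = 0 := by
  have h1 : 3 * |k 1| ≤ |(3 * i - 3 * i' : ℤ) * k 1| := by
    rw [abs_mul]
    refine mul_le_mul_of_nonneg_right ?_ (abs_nonneg _)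
    rcases lt_or_gt_of_ne hi with h | h
    · rw [abs_of_nonpos] <;> omega
    · rw [abs_of_nonneg] <;> omega
  have h2 : |(3 * i - 3 * i' : ℤ) * k 1| ≤ |k 0 - 3 * i' * k 1| + |k 0 - 3 * i * k 1| := by
    have := abs_sub (k 0 - 3 * i' * k 1) (k 0 - 3 * i * k 1)
    refine le_trans (le_of_eq ?_) this
    congr 1; ring
  have h3 : |k 1| = 0 := le_antisymm (by linarith) (abs_nonneg _)
  have h4 : k 1 = 0 := abs_eq_zero.mp h3
  rw [h4] at h
  simp at h
  ext i
  fin_cases i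
  · exact h
  · exact h4

lemma eq_of_cone_cone {i i' : ℕ} {k : Fin 2 → ℤ} (h : Cone (3 * i) k) (h' : Cone (3 * i') k) : i = i' := by
  by_contra hi
  have := eq_zero_of_mem_two_cones hi h.le h'.le
  rw [this] at h
  simp [Cone] at h

lemma eq_of_not_cone_dualMap {i i' : ℕ} {k : Fin 2 → ℤ} (hk : k ≠ 0) (h : ¬Cone (3 * i) (dualMap (3 * i) k))
    (h' : ¬Cone (3 * i') (dualMap (3 * i') k)) : i = i' := by
  by_contra hi
  have key : ∀ a : ℤ, ¬Cone a (dualMap a k) → |k 0 - a * k 1| ≤ |k 1| := by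
    intro a ha
    simp only [Cone, not_lt, dualMap, Equiv.coe_fn_mk, cons_val_zero, cons_val_one] at ha
    rw [abs_neg] at ha
    refine ha.trans (le_of_eq ?_)
    rw [show -(a * k 0 - (a ^ 2 + 1) * k 1) - a * -(k 0 - a * k 1) = k 1 by ring]
  exact hk (eq_zero_of_mem_two_cones hi (key _ h) (key _ h'))

lemma enorm_sum_sq_le {n : ℕ} (z : ℕ → ℂ) (P : ℕ → Prop) [DecidablePred P]
    (h : ∀ i < n, ∀ i' < n, ¬P i → ¬P i' → i = i') :
    ‖∑ i ∈ Finset.range n, z i‖ₑ ^ 2 ≤ 2 * ∑ i ∈ Finset.range n, ‖z i‖ₑ ^ 2 +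
      2 * n * ∑ i ∈ Finset.range n, if P i then ‖z i‖ₑ ^ 2 else 0 := by
  have hcs : ∀ s : Finset ℕ, ‖∑ i ∈ s, z i‖ ^ 2 ≤ s.card * ∑ i ∈ s, ‖z i‖ ^ 2 := fun s =>
    (pow_le_pow_left₀ (norm_nonneg _) (norm_sum_le _ _) 2).trans sq_sum_le_card_mul_sum_sq
  have hreal : ‖∑ i ∈ Finset.range n, z i‖ ^ 2 ≤ 2 * ∑ i ∈ Finset.range n, ‖z i‖ ^ 2 +
      2 * n * ∑ i ∈ Finset.range n, if P i then ‖z i‖ ^ 2 else 0 := by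
    rw [← Finset.sum_filter_add_sum_filter_not (Finset.range n) P z, ← Finset.sum_filter]
    have h1 := hcs ((Finset.range n).filter P)
    have h2 := hcs ((Finset.range n).filter fun i => ¬P i)
    have c1 : (((Finset.range n).filter P).card : ℝ) ≤ n := by
      exact_mod_cast (Finset.card_filter_le _ _).trans (Finset.card_range n).le
    have c2 : (((Finset.range n).filter fun i => ¬P i).card : ℝ) ≤ 1 := by
      have : ((Finset.range n).filter fun i => ¬P i).card ≤ 1 := by
        rw [Finset.card_le_one]
        intro i hi i' hi'
        rw [Finset.mem_filter, Finset.mem_range] at hi hi'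
        exact h i hi.1 i' hi'.1 hi.2 hi'.2
      exact_mod_cast this
    have s1 : (0 : ℝ) ≤ ∑ i ∈ (Finset.range n).filter P, ‖z i‖ ^ 2 :=
      Finset.sum_nonneg fun i _ => by positivity
    have s2 : (0 : ℝ) ≤ ∑ i ∈ (Finset.range n).filter (fun i => ¬P i), ‖z i‖ ^ 2 :=
      Finset.sum_nonneg fun i _ => by positivity
    have s3 : ∑ i ∈ (Finset.range n).filter (fun i => ¬P i), ‖z i‖ ^ 2 ≤
        ∑ i ∈ Finset.range n, ‖z i‖ ^ 2 :=
      Finset.sum_le_sum_of_subset_of_nonneg (Finset.filter_subset _ _) fun i _ _ => by positivity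
    have t := pow_le_pow_left₀ (norm_nonneg _) (norm_add_le (∑ i ∈ (Finset.range n).filter P, z i)
      (∑ i ∈ (Finset.range n).filter (fun i => ¬P i), z i)) 2
    have t2 := mul_le_mul_of_nonneg_right c1 s1
    have t3 := mul_le_mul_of_nonneg_right c2 s2
    nlinarith [sq_nonneg (‖∑ i ∈ (Finset.range n).filter P, z i‖ -
      ‖∑ i ∈ (Finset.range n).filter (fun i => ¬P i), z i‖)]
  have := ENNReal.ofReal_le_ofReal hreal
  have e : ∀ w : ℂ, ENNReal.ofReal (‖w‖ ^ 2) = ‖w‖ₑ ^ 2 := fun w => by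
    rw [ENNReal.ofReal_pow (norm_nonneg _), ofReal_norm]
  have hn1 : ∀ i ∈ Finset.range n, 0 ≤ ‖z i‖ ^ 2 := fun i _ => by positivity
  have hn2 : ∀ i ∈ Finset.range n, 0 ≤ if P i then ‖z i‖ ^ 2 else 0 := fun i _ => by
    split_ifs <;> positivity
  rw [e, ENNReal.ofReal_add (mul_nonneg (by norm_num) (Finset.sum_nonneg hn1))
    (mul_nonneg (by positivity) (Finset.sum_nonneg hn2)), ENNReal.ofReal_mul (by norm_num),
    ENNReal.ofReal_mul (by positivity), ENNReal.ofReal_mul (by norm_num),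
    ENNReal.ofReal_sum_of_nonneg hn1, ENNReal.ofReal_sum_of_nonneg hn2] at this
  simp only [ENNReal.ofReal_ofNat, ENNReal.ofReal_natCast, apply_ite ENNReal.ofReal, e,
    ENNReal.ofReal_zero] at this
  exact this

/-- The representative of a point of the torus in the unit square. -/
noncomputable def torusLift (t : UnitAddTorus (Fin 2)) : Fin 2 → ℝ := (measurableEquivPiIoc 0 t).1

/-- The projection of the plane to the torus. -/
def toTorus (θ : Fin 2 → ℝ) : UnitAddTorus (Fin 2) := fun i => (θ i : UnitAddCircle)

lemma measurable_torusLift : Measurable torusLift :=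
  measurable_subtype_coe.comp (measurableEquivPiIoc 0).measurable

lemma sq01_eq_torus : sq01 = {x : Fin 2 → ℝ | ∀ i, x i ∈ Set.Ioc ((0 : Fin 2 → ℝ) i) ((0 : Fin 2 → ℝ) i + 1)} := by
  simp [sq01]

lemma torusLift_mem (t : UnitAddTorus (Fin 2)) : torusLift t ∈ sq01 := by
  rw [sq01_eq_torus]; exact (measurableEquivPiIoc 0 t).2

lemma toTorus_torusLift (t : UnitAddTorus (Fin 2)) : toTorus (torusLift t) = t :=
  (measurableEquivPiIoc (0 : Fin 2 → ℝ)).symm_apply_apply t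

lemma torusLift_toTorus {θ : Fin 2 → ℝ} (hθ : θ ∈ sq01) : torusLift (toTorus θ) = θ := by
  rw [sq01_eq_torus] at hθ
  exact congrArg Subtype.val ((measurableEquivPiIoc (0 : Fin 2 → ℝ)).apply_symm_apply ⟨θ, hθ⟩)

lemma lintegral_torus (f : UnitAddTorus (Fin 2) → ENNReal) :
    ∫⁻ t, f t = ∫⁻ θ in sq01, f (toTorus θ) := by
  rw [sq01_eq_torus]; exact lintegral_preimage f 0

/-- The Fourier coefficients of the periodization of `E ∩ sq01`. -/
noncomputable def setCoeff (E : Set (Fin 2 → ℝ)) (k : Fin 2 → ℤ) : ℂ :=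
  ∫ θ in sq01, mFourier (-k) (toTorus θ) * E.indicator 1 θ

/-- The periodization of the indicator of `E ∩ sq01`. -/
noncomputable def torusInd (E : Set (Fin 2 → ℝ)) (t : UnitAddTorus (Fin 2)) : ℂ :=
  E.indicator 1 (torusLift t)

lemma measurable_torusInd {E : Set (Fin 2 → ℝ)} (hE : MeasurableSet E) : Measurable (torusInd E) :=
  (measurable_one.indicator hE).comp measurable_torusLift

lemma norm_torusInd_le (E : Set (Fin 2 → ℝ)) (t : UnitAddTorus (Fin 2)) : ‖torusInd E t‖ ≤ 1 := by
  classical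
  rw [torusInd, Set.indicator_apply]; split_ifs <;> simp

lemma memLp_torusInd {E : Set (Fin 2 → ℝ)} (hE : MeasurableSet E) : MemLp (torusInd E) 2 volume :=
  MemLp.of_bound (measurable_torusInd hE).aestronglyMeasurable 1
    (Filter.Eventually.of_forall (norm_torusInd_le E))

lemma mFourierCoeff_torusInd (E : Set (Fin 2 → ℝ)) (k : Fin 2 → ℤ) :
    mFourierCoeff (torusInd E) k = setCoeff E k := by
  rw [mFourierCoeff_eq_integral _ _ 0, ← sq01_eq_torus, setCoeff]
  refine setIntegral_congr_fun measurableSet_sq01 fun θ hθ => ?_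
  change mFourier (-k) (toTorus θ) • torusInd E (toTorus θ) = _
  rw [torusInd, torusLift_toTorus hθ, smul_eq_mul]

lemma setCoeff_zero {E : Set (Fin 2 → ℝ)} (hE : MeasurableSet E) :
    setCoeff E 0 = ((volume (sq01 ∩ E)).toReal : ℂ) := by
  have e : ∀ θ, mFourier (-0) (toTorus θ) * E.indicator (1 : (Fin 2 → ℝ) → ℂ) θ =
      E.indicator (1 : (Fin 2 → ℝ) → ℂ) θ := fun θ => by
    rw [neg_zero, mFourier_zero, ContinuousMap.one_apply, one_mul]
  simp only [setCoeff, e]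
  rw [integral_indicator hE, Measure.restrict_restrict hE, Set.inter_comm]
  simp [Measure.real]

open Classical in
/-- The energy of the Fourier coefficients in a cone. -/
noncomputable def coneEnergy (E : Set (Fin 2 → ℝ)) (a : ℤ) : ENNReal :=
  ∑' k, if Cone a k then ‖setCoeff E k‖ₑ ^ 2 else 0

lemma tsum_setCoeff_le {E : Set (Fin 2 → ℝ)} (hE : MeasurableSet E) :
    ∑' k, ‖setCoeff E k‖ₑ ^ 2 ≤ 1 := by
  simp only [← mFourierCoeff_torusInd]
  rw [tsum_sq_mFourierCoeff (memLp_torusInd hE)]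
  refine (lintegral_mono (g := fun _ => 1) fun t => ?_).trans (by simp)
  have : ‖torusInd E t‖ₑ ≤ 1 := by
    rw [← ofReal_norm, ENNReal.ofReal_le_one]; exact norm_torusInd_le E t
  exact pow_le_one₀ (by simp) this

lemma sum_coneEnergy_le {E : Set (Fin 2 → ℝ)} (hE : MeasurableSet E) (n : ℕ) :
    ∑ i ∈ Finset.range n, coneEnergy E (3 * i) ≤ 1 := by
  classical
  refine le_trans ?_ (tsum_setCoeff_le hE)
  simp only [coneEnergy]
  rw [← Summable.tsum_finsetSum fun _ _ => ENNReal.summable]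
  refine ENNReal.tsum_le_tsum fun k => ?_
  by_cases h : ∃ i ∈ Finset.range n, Cone (3 * i) k
  · obtain ⟨i, hi, hk⟩ := h
    rw [Finset.sum_eq_single_of_mem i hi fun b _ hb => if_neg fun h => hb (eq_of_cone_cone h hk)]
    rw [if_pos hk]
  · push Not at h
    rw [Finset.sum_eq_zero fun i hi => if_neg (h i hi)]
    simp

lemma coneEnergy_le {E : Set (Fin 2 → ℝ)} (hE : MeasurableSet E) (a : ℤ) : coneEnergy E a ≤ 1 := by
  refine le_trans (ENNReal.tsum_le_tsum fun k => ?_) (tsum_setCoeff_le hE)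
  split_ifs <;> simp

/-- The linear map of the plane covering `torusHom a`. -/
def planeMap (a : ℤ) (θ : Fin 2 → ℝ) : Fin 2 → ℝ := ![a * θ 0 + θ 1, -(a ^ 2 + 1) * θ 0 - a * θ 1]

lemma toTorus_planeMap (a : ℤ) (θ : Fin 2 → ℝ) : toTorus (planeMap a θ) = torusHom a (toTorus θ) := by
  ext i
  fin_cases i
  · simp only [toTorus, planeMap, torusHom_apply, Fin.zero_eta, cons_val_zero]
    rw [AddCircle.coe_add, ← zsmul_eq_mul, AddCircle.coe_zsmul]
  · simp only [toTorus, planeMap, torusHom_apply, Fin.mk_one, cons_val_one, cons_val_zero]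
    rw [AddCircle.coe_sub, ← zsmul_eq_mul, AddCircle.coe_zsmul,
      show (-((a : ℝ) ^ 2 + 1) * θ 0) = (-(a ^ 2 + 1) : ℤ) • θ 0 by rw [zsmul_eq_mul]; push_cast; ring,
      AddCircle.coe_zsmul]

lemma exists_lift_eq (x : Fin 2 → ℝ) : ∃ m : Fin 2 → ℤ, torusLift (toTorus x) = fun i => x i + m i := by
  have h := toTorus_torusLift (toTorus x)
  have : ∀ i, ∃ m : ℤ, torusLift (toTorus x) i = x i + m := by
    intro i
    have hi : ((torusLift (toTorus x) i : ℝ) : UnitAddCircle) = (x i : UnitAddCircle) := congrFun h i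
    rw [← sub_eq_zero, ← AddCircle.coe_sub, AddCircle.coe_eq_zero_iff] at hi
    obtain ⟨m, hm⟩ := hi
    exact ⟨m, by rw [zsmul_eq_mul, mul_one] at hm; linarith⟩
  choose m hm using this
  exact ⟨m, funext hm⟩

lemma mFourierCoeff_zero_index (f : UnitAddTorus (Fin 2) → ℂ) : mFourierCoeff f 0 = ∫ t, f t := by
  simp [mFourierCoeff, mFourier_zero]

lemma mFourierCoeff_const {k : Fin 2 → ℤ} (hk : k ≠ 0) (c : ℂ) :
    mFourierCoeff (fun _ : UnitAddTorus (Fin 2) => c) k = 0 := by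
  have hone : mFourierCoeff (fun _ : UnitAddTorus (Fin 2) => (1 : ℂ)) k = 0 := by
    have h := tsum_sq_mFourierCoeff (memLp_const (μ := volume) (1 : ℂ))
    have h0 : ‖mFourierCoeff (fun _ : UnitAddTorus (Fin 2) => (1 : ℂ)) 0‖ₑ ^ 2 = 1 := by
      rw [mFourierCoeff_zero_index]; simp
    have h2 := ENNReal.sum_le_tsum (f := fun k =>
      ‖mFourierCoeff (fun _ : UnitAddTorus (Fin 2) => (1 : ℂ)) k‖ₑ ^ 2) {0, k}
    rw [h, Finset.sum_pair hk.symm, h0] at h2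
    simp only [enorm_one, one_pow, lintegral_const, measure_univ, mul_one] at h2
    have h3 : ‖mFourierCoeff (fun _ : UnitAddTorus (Fin 2) => (1 : ℂ)) k‖ₑ ^ 2 ≤ 0 := by
      have : (1 : ENNReal) + ‖mFourierCoeff (fun _ : UnitAddTorus (Fin 2) => (1 : ℂ)) k‖ₑ ^ 2 ≤ 1 + 0 := by
        simpa using h2
      exact (ENNReal.add_le_add_iff_left ENNReal.one_ne_top).1 this
    simpa using h3
  rw [mFourierCoeff] at hone ⊢
  simp only [smul_eq_mul, mul_one] at hone ⊢
  rw [integral_mul_const, hone, zero_mul]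

lemma integrable_mFourier_mul {f : UnitAddTorus (Fin 2) → ℂ} (hf : MemLp f 2 volume) (k : Fin 2 → ℤ) :
    Integrable (fun t => mFourier k t • f t) volume := by
  have h1 : Integrable f volume := hf.integrable (by norm_num)
  refine h1.bdd_mul (c := 1) (mFourier k).continuous.aestronglyMeasurable ?_
  refine Filter.Eventually.of_forall fun t => ?_
  rw [mFourier_eq_toCircle]
  exact (Circle.norm_coe _).le

lemma dualMap_zero (a : ℤ) : dualMap a 0 = 0 := by
  ext i; fin_cases i <;> simp [dualMap]

/-- The number of visits of `t` to the sets `E i` under the maps `torusHom (3 * i)`. -/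
noncomputable def visitSum (E : ℕ → Set (Fin 2 → ℝ)) (n : ℕ) (t : UnitAddTorus (Fin 2)) : ℂ :=
  ∑ i ∈ Finset.range n, torusInd (E i) (torusHom (3 * i) t)

lemma memLp_torusInd_comp {E : Set (Fin 2 → ℝ)} (hE : MeasurableSet E) (a : ℤ) :
    MemLp (fun t => torusInd E (torusHom a t)) 2 volume :=
  (memLp_torusInd hE).comp_measurePreserving (measurePreserving_torusHom a)

lemma mFourierCoeff_visitSum {E : ℕ → Set (Fin 2 → ℝ)} (hE : ∀ i, MeasurableSet (E i)) (n : ℕ) (c : ℂ)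
    (k : Fin 2 → ℤ) : mFourierCoeff (fun t => visitSum E n t - c) k =
      ∑ i ∈ Finset.range n, setCoeff (E i) (dualMap (3 * i) k) -
        mFourierCoeff (fun _ : UnitAddTorus (Fin 2) => c) k := by
  have hi : ∀ i, Integrable (fun t => mFourier (-k) t • torusInd (E i) (torusHom (3 * i) t)) volume :=
    fun i => integrable_mFourier_mul (memLp_torusInd_comp (hE i) _) _
  have e : ∀ t, mFourier (-k) t • (visitSum E n t - c) =
      ∑ i ∈ Finset.range n, mFourier (-k) t • torusInd (E i) (torusHom (3 * i) t) -
        mFourier (-k) t • c := fun t => by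
    rw [visitSum, smul_sub, Finset.smul_sum]
  rw [mFourierCoeff]
  simp only [e]
  rw [integral_sub (integrable_finsetSum _ fun i _ => hi i)
    (integrable_mFourier_mul (memLp_const c) _), integral_finsetSum _ fun i _ => hi i, ← mFourierCoeff]
  congr 1
  refine Finset.sum_congr rfl fun i _ => ?_
  rw [← mFourierCoeff_torusInd, ← mFourierCoeff_comp_torusHom _ _ (measurable_torusInd (hE i)),
    mFourierCoeff]

lemma lintegral_visitSum_le {E : ℕ → Set (Fin 2 → ℝ)} (hE : ∀ i, MeasurableSet (E i)) (n : ℕ) :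
    ∫⁻ t, ‖visitSum E n t - ((∑ i ∈ Finset.range n, (volume (sq01 ∩ E i)).toReal : ℝ) : ℂ)‖ₑ ^ 2 ≤
      2 * n + 2 * n * ∑ i ∈ Finset.range n, coneEnergy (E i) (3 * i) := by
  classical
  have hL : MemLp (fun t => visitSum E n t -
      ((∑ i ∈ Finset.range n, (volume (sq01 ∩ E i)).toReal : ℝ) : ℂ)) 2 volume := by
    refine MemLp.sub ?_ (memLp_const _)
    exact memLp_finsetSum _ fun i _ => memLp_torusInd_comp (hE i) _
  rw [← tsum_sq_mFourierCoeff hL]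
  have hk : ∀ k, ‖mFourierCoeff (fun t => visitSum E n t -
      ((∑ i ∈ Finset.range n, (volume (sq01 ∩ E i)).toReal : ℝ) : ℂ)) k‖ₑ ^ 2 ≤
      2 * ∑ i ∈ Finset.range n, ‖setCoeff (E i) (dualMap (3 * i) k)‖ₑ ^ 2 +
      2 * n * ∑ i ∈ Finset.range n, if Cone (3 * i) (dualMap (3 * i) k) then
        ‖setCoeff (E i) (dualMap (3 * i) k)‖ₑ ^ 2 else 0 := by
    intro k
    rw [mFourierCoeff_visitSum hE]
    by_cases h0 : k = 0
    · have : ∑ i ∈ Finset.range n, setCoeff (E i) (dualMap (3 * i) k) -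
          mFourierCoeff (fun _ : UnitAddTorus (Fin 2) =>
            ((∑ i ∈ Finset.range n, (volume (sq01 ∩ E i)).toReal : ℝ) : ℂ)) k = 0 := by
        rw [h0, mFourierCoeff_zero_index]
        simp only [dualMap_zero, setCoeff_zero (hE _)]
        simp
      rw [this]; simp
    · rw [mFourierCoeff_const h0, sub_zero]
      exact enorm_sum_sq_le _ _ fun i _ i' _ h h' => eq_of_not_cone_dualMap h0 h h'
  refine (ENNReal.tsum_le_tsum hk).trans ?_
  rw [ENNReal.tsum_add, ENNReal.tsum_mul_left, ENNReal.tsum_mul_left,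
    Summable.tsum_finsetSum fun _ _ => ENNReal.summable, Summable.tsum_finsetSum fun _ _ => ENNReal.summable]
  refine add_le_add (mul_le_mul_right ?_ _) (mul_le_mul_right ?_ _)
  · refine (Finset.sum_le_sum (g := fun _ => 1) fun i _ => ?_).trans (by simp)
    rw [(dualMap (3 * i)).tsum_eq fun k => ‖setCoeff (E i) k‖ₑ ^ 2]
    exact tsum_setCoeff_le (hE i)
  · refine Finset.sum_le_sum fun i _ => ?_
    rw [(dualMap (3 * i)).tsum_eq fun k => if Cone (3 * i) k then ‖setCoeff (E i) k‖ₑ ^ 2 else 0]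
    rfl

/-- The points of the unit square whose images avoid the sets `E i`, `i < n`. -/
def avoid (E : ℕ → Set (Fin 2 → ℝ)) (n : ℕ) : Set (Fin 2 → ℝ) :=
  {τ | τ ∈ sq01 ∧ ∀ i < n, ∀ m : Fin 2 → ℤ, (fun l => planeMap (3 * i) τ l + m l) ∈ sq01 →
    (fun l => planeMap (3 * i) τ l + m l) ∉ E i}

lemma volume_avoid_le {E : ℕ → Set (Fin 2 → ℝ)} (hE : ∀ i, MeasurableSet (E i)) (n : ℕ) :
    (∑ i ∈ Finset.range n, volume (sq01 ∩ E i)) ^ 2 * volume (avoid E n) ≤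
      2 * n + 2 * n * ∑ i ∈ Finset.range n, coneEnergy (E i) (3 * i) := by
  refine le_trans ?_ (lintegral_visitSum_le hE n)
  rw [lintegral_torus]
  have hfin : ∀ i, volume (sq01 ∩ E i) ≠ ⊤ := fun i =>
    ne_top_of_le_ne_top (by rw [volume_sq01]; simp) (measure_mono Set.inter_subset_left)
  have hc : ‖((∑ i ∈ Finset.range n, (volume (sq01 ∩ E i)).toReal : ℝ) : ℂ)‖ₑ =
      ∑ i ∈ Finset.range n, volume (sq01 ∩ E i) := by
    rw [← ofReal_norm, Complex.norm_real, Real.norm_of_nonneg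
      (Finset.sum_nonneg fun _ _ => ENNReal.toReal_nonneg),
      ENNReal.ofReal_sum_of_nonneg fun _ _ => ENNReal.toReal_nonneg]
    exact Finset.sum_congr rfl fun i _ => ENNReal.ofReal_toReal (hfin i)
  have hvisit : ∀ τ ∈ avoid E n, visitSum E n (toTorus τ) = 0 := by
    intro τ hτ
    refine Finset.sum_eq_zero fun i hi => ?_
    rw [torusInd, ← toTorus_planeMap]
    obtain ⟨m, hm⟩ := exists_lift_eq (planeMap (3 * i) τ)
    have hmem := torusLift_mem (toTorus (planeMap (3 * i) τ))
    rw [hm] at hmem ⊢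
    exact Set.indicator_of_notMem (hτ.2 i (Finset.mem_range.1 hi) m hmem) _
  have hsub : avoid E n ⊆ sq01 ∩ {τ | (∑ i ∈ Finset.range n, volume (sq01 ∩ E i)) ^ 2 ≤
      ‖visitSum E n (toTorus τ) - ((∑ i ∈ Finset.range n, (volume (sq01 ∩ E i)).toReal : ℝ) : ℂ)‖ₑ ^ 2} := by
    intro τ hτ
    refine ⟨hτ.1, ?_⟩
    rw [Set.mem_ofPred_eq, hvisit τ hτ, zero_sub, enorm_neg, hc]
  refine (mul_le_mul_right (measure_mono hsub) _).trans ?_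
  rw [Set.inter_comm, ← Measure.restrict_apply' measurableSet_sq01]
  refine mul_meas_ge_le_lintegral₀ ?_ _
  have : Measurable (fun τ => visitSum E n (toTorus τ)) := by
    refine Finset.measurable_sum _ fun i _ => ?_
    refine (measurable_torusInd (hE i)).comp ((continuous_torusHom _).measurable.comp ?_)
    exact measurable_pi_lambda _ fun i => AddCircle.measurable_mk'.comp (measurable_pi_apply i)
  exact ((this.sub_const _).enorm.pow_const 2).aemeasurable

end Torus

lemma sq_lintegral_le {X : Type*} [MeasurableSpace X] {μ : Measure X} {f : X → ENNReal} (hf : Measurable f) :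
    (∫⁻ x, f x ∂μ) ^ 2 ≤ μ {x | f x ≠ 0} * ∫⁻ x, f x ^ 2 ∂μ := by
  have hs : MeasurableSet {x | f x ≠ 0} := hf (measurableSet_singleton 0).compl
  have h := ENNReal.lintegral_mul_le_Lp_mul_Lq μ Real.HolderConjugate.two_two
    ((measurable_one.indicator hs).aemeasurable (f := Set.indicator {x | f x ≠ 0} 1)) hf.aemeasurable
  have e : ∀ x, (Set.indicator {x | f x ≠ 0} (1 : X → ENNReal) * f) x = f x := by
    intro x
    by_cases hx : f x = 0 <;> simp [hx]
  have e2 : ∀ x, (Set.indicator {x | f x ≠ 0} (1 : X → ENNReal) x) ^ (2 : ℝ) =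
      Set.indicator {x | f x ≠ 0} 1 x := by
    intro x
    by_cases hx : f x = 0 <;> simp [hx]
  simp only [e, e2, ENNReal.rpow_two] at h
  rw [lintegral_indicator_one hs] at h
  refine (pow_le_pow_left' h 2).trans (le_of_eq ?_)
  rw [mul_pow, ← ENNReal.rpow_two, ← ENNReal.rpow_two, ← ENNReal.rpow_mul, ← ENNReal.rpow_mul]
  norm_num

lemma isOpen_cusp (κ : ℝ) : IsOpen {B : M3 | Cusp κ B} := by
  have : {B : M3 | Cusp κ B} = ⋃ q : Fin 3 → ℤ, ⋃ _ : q ≠ 0, ⋂ i,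
      {B : M3 | |(B *ᵥ fun j => (q j : ℝ)) i| < κ} := by
    ext B; simp [Cusp]
  rw [this]
  exact isOpen_iUnion fun q => isOpen_iUnion fun _ =>
    isOpen_iInter_of_finite fun i => isOpen_lt (by fun_prop) continuous_const

/-- The elliptic element of `SL(3, ℤ)` acting on the plane by `planeMap a`. -/
def wMat (a : ℤ) : SL3Z := ⟨!![a, 1, 0; -(a ^ 2 + 1), -a, 0; 0, 0, 1], by
  simp [Matrix.det_fin_three]; ring⟩

lemma wMat_mul_ntr (a : ℤ) (θ : Fin 2 → ℝ) :
    toR (wMat a).1 * ntr θ = ntr (planeMap a θ) * toR (wMat a).1 := by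
  ext i j
  fin_cases i <;> fin_cases j <;>
    simp [Matrix.mul_apply, Fin.sum_univ_three, wMat, ntr, planeMap] <;> ring

/-- The matrices hit by some element of `S`. -/
def hitSet (T : Fin 2 → ℝ → ℝ) (ℓ : ℤ) (K ε : ℝ) (S : Finset SL3Z) : Set M3 :=
  ⋃ γ ∈ S, hitFor T ℓ K ε γ

lemma measurableSet_hitSet {T : Fin 2 → ℝ → ℝ} (hT : ∀ i, Measurable (T i)) (ℓ : ℤ) (K ε : ℝ)
    (S : Finset SL3Z) : MeasurableSet (hitSet T ℓ K ε S) :=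
  Finset.measurableSet_biUnion _ fun γ _ => measurableSet_hitFor hT ℓ K ε γ

lemma hitCount_ne_zero {T : Fin 2 → ℝ → ℝ} {ℓ : ℤ} {K ε : ℝ} {S : Finset SL3Z} {A : M3} :
    hitCount T ℓ K ε S A ≠ 0 ↔ A ∈ hitSet T ℓ K ε S := by
  classical
  simp [hitCount, hitSet, Set.indicator_apply]

/-- The translations moving `B` into `H`. -/
def orbSet (H : Set M3) (B : M3) : Set (Fin 2 → ℝ) := {θ | ntr θ * B ∈ H}

lemma measurableSet_orbSet {H : Set M3} (hH : MeasurableSet H) (B : M3) : MeasurableSet (orbSet H B) :=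
  measurable_ntr_mul B hH

/-- The total length of the cuspidal parts of the orbits of `B`. -/
noncomputable def cuspCount (κ : ℝ) (S : Finset SL3Z) (B : M3) : ENNReal :=
  ∑ γ ∈ S, volume {θ | θ ∈ sq01 ∧ Cusp κ (toR γ.1 * (ntr θ * B))}

/-- The second moment along the orbit of `B`. -/
noncomputable def sqCount (T : Fin 2 → ℝ → ℝ) (ℓ : ℤ) (K ε : ℝ) (S : Finset SL3Z) (B : M3) : ENNReal :=
  ∫⁻ θ in sq01, hitCount T ℓ K ε S (ntr θ * B) ^ 2

lemma measurable_ntr_mul_mul (w : M3) : Measurable fun p : M3 × (Fin 2 → ℝ) => ntr p.2 * (w * p.1) :=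
  ((continuous_ntr.comp continuous_snd).matrix_mul (continuous_const.matrix_mul continuous_fst)).measurable

lemma measurable_sqCount {T : Fin 2 → ℝ → ℝ} (hT : ∀ i, Measurable (T i)) (ℓ : ℤ) (K ε : ℝ)
    (S : Finset SL3Z) (w : M3) : Measurable fun A => sqCount T ℓ K ε S (w * A) := by
  refine Measurable.lintegral_prod_right' (f := fun p : M3 × (Fin 2 → ℝ) =>
    hitCount T ℓ K ε S (ntr p.2 * (w * p.1)) ^ 2) ?_
  exact ((measurable_hitCount hT ℓ K ε S).comp (measurable_ntr_mul_mul w)).pow_const 2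

lemma measurableSet_cusp_prod (κ : ℝ) (g w : M3) :
    MeasurableSet {p : M3 × (Fin 2 → ℝ) | p.2 ∈ sq01 ∧ Cusp κ (g * (ntr p.2 * (w * p.1)))} :=
  (measurable_snd measurableSet_sq01).inter
    (((measurable_mul_left g).comp (measurable_ntr_mul_mul w)) (isOpen_cusp κ).measurableSet)

lemma measurable_cuspCount (κ : ℝ) (S : Finset SL3Z) (w : M3) :
    Measurable fun A => cuspCount κ S (w * A) :=
  Finset.measurable_fun_sum _ fun γ _ => measurable_measure_prodMk_left (measurableSet_cusp_prod κ (toR γ.1) w)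

lemma lintegral_sqCount_le {T : Fin 2 → ℝ → ℝ} (hT : ∀ i, Measurable (T i)) {ℓ : ℤ} (hℓ : ℓ ≠ 0)
    {j : ℕ} {S : Finset SL3Z} (hS : ∀ γ ∈ S, ColBox (2 ^ j) γ.1) {K ε : ℝ}
    (hK : BigFor ℓ K) (hε : 0 < ε) (hε1 : ε ≤ 1) (hεh : ε * (2 ^ j) ^ 3 ≤ 1) {w : M3} (hw : w.det = 1)
    {L : ℝ} (hL : 1 ≤ L) :
    ∫⁻ A in bddWin L, sqCount T ℓ K ε S (w * A) ≤
      ENNReal.ofReal ((25 * L ^ 3) ^ 9 * (K ^ 186 * ε ^ 2) *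
        (S.card * (4 * (270 * 432 ^ 2) * (3 * j + 15)))) := by
  simp only [sqCount]
  rw [lintegral_lintegral_swap]
  swap
  · exact (((measurable_hitCount hT ℓ K ε S).comp (measurable_ntr_mul_mul w)).pow_const 2).aemeasurable
  refine (lintegral_mono (g := fun _ => ENNReal.ofReal ((25 * L ^ 3) ^ 9 * (K ^ 186 * ε ^ 2) *
        (S.card * (4 * (270 * 432 ^ 2) * (3 * j + 15))))) fun θ => ?_).trans
    (by rw [lintegral_const, Measure.restrict_apply_univ, volume_sq01, mul_one])
  obtain ⟨u, hu⟩ : ∃ u, u = ntr θ * w := ⟨_, rfl⟩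
  have hud : u.det = 1 := by rw [hu, Matrix.det_mul, det_ntr, hw, mul_one]
  have hud' : u.adjugate.det = 1 := by rw [det_adjugate, hud, one_pow]
  have hinv : ∀ A : M3, u.adjugate * (u * A) = A := fun A => by
    rw [← Matrix.mul_assoc, adjugate_mul, hud, one_smul, Matrix.one_mul]
  refine le_trans (le_of_eq ?_) (second_moment hT hℓ hS hK hε hε1 hεh hud' hL)
  rw [← lintegral_indicator (measurableSet_bddWinL _ L), ← lintegral_indicator (measurableSet_bddWin L)]
  rw [← (measurePreserving_mul_left hud).lintegral_comp
    (((measurable_hitCount hT ℓ K ε S).pow_const 2).indicator (measurableSet_bddWinL _ L))]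
  refine lintegral_congr fun A => ?_
  classical
  simp only [Set.indicator_apply, bddWinL, Set.mem_ofPred_eq, hinv]
  rw [hu, Matrix.mul_assoc]

lemma lintegral_cuspCount_le {κ Λ L : ℝ} (hκ : 0 < κ) (hκ1 : κ ≤ 1) (hL : 0 ≤ L) {w : M3} (hw : w.det = 1)
    {S : Finset SL3Z} (hΛ : ∀ γ ∈ S, ∀ θ ∈ sq01, EBdd Λ (toR γ.1 * (ntr θ * w)).adjugate)
    {M : ℕ} (hM : 36 * L ^ 2 * Λ ≤ 2 ^ M) :
    ∫⁻ A in bddWin L, cuspCount κ S (w * A) ≤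
      S.card * ENNReal.ofReal (27648 * L ^ 6 * κ ^ 3 * (M + 1)) := by
  have hmeas : ∀ γ ∈ S, Measurable fun A =>
      volume {θ | θ ∈ sq01 ∧ Cusp κ (toR γ.1 * (ntr θ * (w * A)))} := fun γ _ =>
    measurable_measure_prodMk_left (measurableSet_cusp_prod κ (toR γ.1) w)
  simp only [cuspCount]
  rw [lintegral_finsetSum _ hmeas, ← nsmul_eq_mul]
  refine Finset.sum_le_card_nsmul _ _ _ fun γ hγ => ?_
  have hms := measurableSet_cusp_prod κ (toR γ.1) w
  have h1 := Measure.prod_apply (μ := volume.restrict (bddWin L)) (ν := (volume : Measure (Fin 2 → ℝ))) hms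
  have h2 := Measure.prod_apply_symm (μ := volume.restrict (bddWin L))
    (ν := (volume : Measure (Fin 2 → ℝ))) hms
  rw [h1] at h2
  refine (le_of_eq h2).trans ?_
  refine (lintegral_mono (g := sq01.indicator fun _ => ENNReal.ofReal (27648 * L ^ 6 * κ ^ 3 * (M + 1)))
    fun θ => ?_).trans
    (by rw [lintegral_indicator measurableSet_sq01, lintegral_const, Measure.restrict_apply_univ,
      volume_sq01, mul_one])
  by_cases hθ : θ ∈ sq01
  · rw [Set.indicator_of_mem hθ]
    have hd : (toR γ.1 * (ntr θ * w)).det = 1 := by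
      rw [Matrix.det_mul, Matrix.det_mul, det_ntr, hw, toR_det_SL]; norm_num
    refine le_trans ?_ (volume_cusp_le hd (hΛ γ hγ θ hθ) hκ hκ1 hL hM)
    rw [Measure.restrict_apply' (measurableSet_bddWin L)]
    refine measure_mono ?_
    rintro A ⟨hA, hA2⟩
    refine ⟨hA2, ?_⟩
    rw [Matrix.mul_assoc, Matrix.mul_assoc]
    exact hA.2
  · rw [Set.indicator_of_notMem hθ]
    refine le_of_eq ?_
    convert measure_empty (μ := volume.restrict (bddWin L))
    ext A
    simp [hθ]

lemma hit_measure_lower {h : ℕ} (hh : 1 ≤ h) {S : Finset SL3Z} (hS : ∀ γ ∈ S, ColBox h γ.1) {ℓ : ℤ}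
    (hℓ : ℓ ≠ 0) {T : Fin 2 → ℝ → ℝ} (hTm : ∀ i, Measurable (T i)) {κ K₂ K ε : ℝ} (hκ : 0 < κ) (hκ1 : κ ≤ 1)
    (hK₂ : K₂ = 288 * (9 * |(ℓ : ℝ)| / κ ^ 2) ^ 3) (hT : ∀ i t, |T i t| + 1 ≤ K₂)
    (hK : 543 * K₂ ^ 5 ≤ K) (hh3 : 90 * K₂ ^ 4 ≤ (h : ℝ) ^ 3) (hε : 0 < ε) (hε1 : ε ≤ 1)
    {B : M3} (hB : B ∈ detWin) (hc : 8 * cuspCount κ S B ≤ S.card) :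
    ENNReal.ofReal (4 * ε ^ 2 / (144 * K₂ ^ 3)) * S.card ≤ 8 * (ENNReal.ofReal ((180 * K₂ ^ 4) ^ 2) *
      ∫⁻ θ in sq01, hitCount T ℓ K ε S (ntr θ * B)) := by
  have hsum : ∫⁻ θ in sq01, hitCount T ℓ K ε S (ntr θ * B) =
      ∑ γ ∈ S, volume {θ | θ ∈ sq01 ∧ ntr θ * B ∈ hitFor T ℓ K ε γ} := by
    have hmeas : ∀ γ ∈ S, Measurable fun θ =>
        (hitFor T ℓ K ε γ).indicator (1 : M3 → ENNReal) (ntr θ * B) := fun γ _ =>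
      (measurable_one.indicator (measurableSet_hitFor hTm ℓ K ε γ)).comp (measurable_ntr_mul B)
    simp only [hitCount]
    rw [lintegral_finsetSum _ hmeas]
    refine Finset.sum_congr rfl fun γ _ => ?_
    have hm : MeasurableSet {θ | ntr θ * B ∈ hitFor T ℓ K ε γ} :=
      measurable_ntr_mul B (measurableSet_hitFor hTm ℓ K ε γ)
    have : ∀ θ, (hitFor T ℓ K ε γ).indicator (1 : M3 → ENNReal) (ntr θ * B) =
        {θ | ntr θ * B ∈ hitFor T ℓ K ε γ}.indicator 1 θ := fun θ => rfl
    simp only [this]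
    rw [lintegral_indicator_one hm, Measure.restrict_apply hm, Set.inter_comm]
    rfl
  have hsplit : (S.card : ENNReal) ≤ 8 * ∑ γ ∈ S, volume {θ | θ ∈ sqMid ∧ ¬Cusp κ (toR γ.1 * (ntr θ * B))} := by
    have h1 : ∀ γ ∈ S, ENNReal.ofReal (1 / 4) ≤
        volume {θ | θ ∈ sqMid ∧ ¬Cusp κ (toR γ.1 * (ntr θ * B))} +
        volume {θ | θ ∈ sq01 ∧ Cusp κ (toR γ.1 * (ntr θ * B))} := by
      intro γ _
      rw [← volume_sqMid]
      refine (measure_mono ?_).trans (measure_union_le _ _)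
      intro θ hθ
      by_cases hcu : Cusp κ (toR γ.1 * (ntr θ * B))
      · exact Or.inr ⟨fun i => ⟨by linarith [(hθ i).1], by linarith [(hθ i).2]⟩, hcu⟩
      · exact Or.inl ⟨hθ, hcu⟩
    have h2 := Finset.sum_le_sum h1
    rw [Finset.sum_add_distrib, Finset.sum_const, nsmul_eq_mul] at h2
    have h3 : (8 : ENNReal) * (S.card * ENNReal.ofReal (1 / 4)) = S.card + S.card := by
      rw [mul_left_comm, show (8 : ENNReal) = ENNReal.ofReal 8 by simp, ← ENNReal.ofReal_mul (by norm_num),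
        show (8 * (1 / 4) : ℝ) = 2 by norm_num]
      simp [mul_two]
    have h4 := mul_le_mul_right h2 (8 : ENNReal)
    rw [h3, mul_add] at h4
    have h5 : (S.card + S.card : ENNReal) ≤ 8 * ∑ γ ∈ S, volume {θ | θ ∈ sqMid ∧
        ¬Cusp κ (toR γ.1 * (ntr θ * B))} + S.card := h4.trans (add_le_add le_rfl hc)
    exact (ENNReal.add_le_add_iff_right (ENNReal.natCast_ne_top _)).1 h5
  refine (mul_le_mul_right hsplit _).trans ?_
  rw [mul_left_comm, hsum]
  refine mul_le_mul_right ?_ _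
  rw [Finset.mul_sum, Finset.mul_sum]
  refine Finset.sum_le_sum fun γ hγ => ?_
  exact first_moment (hS γ hγ) hh hℓ hTm hκ hκ1 hK₂ hT hK hh3 hε hε1 hB.1 hB.2

lemma orbit_hit_lower {h : ℕ} (hh : 1 ≤ h) {S : Finset SL3Z} (hS : ∀ γ ∈ S, ColBox h γ.1) {ℓ : ℤ}
    (hℓ : ℓ ≠ 0) {T : Fin 2 → ℝ → ℝ} (hTm : ∀ i, Measurable (T i)) {κ K₂ K ε : ℝ} (hκ : 0 < κ) (hκ1 : κ ≤ 1)
    (hK₂ : K₂ = 288 * (9 * |(ℓ : ℝ)| / κ ^ 2) ^ 3) (hT : ∀ i t, |T i t| + 1 ≤ K₂)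
    (hK : 543 * K₂ ^ 5 ≤ K) (hh3 : 90 * K₂ ^ 4 ≤ (h : ℝ) ^ 3) (hε : 0 < ε) (hε1 : ε ≤ 1)
    {B : M3} (hB : B ∈ detWin) (hc : 8 * cuspCount κ S B ≤ S.card) {Z κ₀ : ℝ} (hZ : 0 < Z)
    (hsq : sqCount T ℓ K ε S B ≤ ENNReal.ofReal Z)
    (hκ₀ : κ₀ * (Z * (8 * (180 * K₂ ^ 4) ^ 2) ^ 2) ≤ (4 * ε ^ 2 / (144 * K₂ ^ 3) * S.card) ^ 2) :
    ENNReal.ofReal κ₀ ≤ volume (sq01 ∩ orbSet (hitSet T ℓ K ε S) B) := by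
  have hK₂p : 0 < K₂ := by have := hT 0 0; have := abs_nonneg (T 0 0); linarith
  have h1 := hit_measure_lower hh hS hℓ hTm hκ hκ1 hK₂ hT hK hh3 hε hε1 hB hc
  have h2 := sq_lintegral_le (μ := volume.restrict sq01) (f := fun θ => hitCount T ℓ K ε S (ntr θ * B))
    ((measurable_hitCount hTm ℓ K ε S).comp (measurable_ntr_mul B))
  have h3 : (volume.restrict sq01) {θ | hitCount T ℓ K ε S (ntr θ * B) ≠ 0} =
      volume (sq01 ∩ orbSet (hitSet T ℓ K ε S) B) := by
    rw [Measure.restrict_apply' measurableSet_sq01, Set.inter_comm]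
    congr 2
    ext θ
    exact hitCount_ne_zero
  rw [h3] at h2
  obtain ⟨I, hI⟩ : ∃ I, I = ∫⁻ θ in sq01, hitCount T ℓ K ε S (ntr θ * B) := ⟨_, rfl⟩
  rw [← hI] at h1 h2
  have h4 : I ^ 2 ≤ volume (sq01 ∩ orbSet (hitSet T ℓ K ε S) B) * ENNReal.ofReal Z :=
    h2.trans (mul_le_mul_right hsq _)
  have hD : 0 < Z * (8 * (180 * K₂ ^ 4) ^ 2) ^ 2 := by positivity
  have h5 : ENNReal.ofReal κ₀ * ENNReal.ofReal (Z * (8 * (180 * K₂ ^ 4) ^ 2) ^ 2) ≤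
      volume (sq01 ∩ orbSet (hitSet T ℓ K ε S) B) * ENNReal.ofReal (Z * (8 * (180 * K₂ ^ 4) ^ 2) ^ 2) := by
    calc ENNReal.ofReal κ₀ * ENNReal.ofReal (Z * (8 * (180 * K₂ ^ 4) ^ 2) ^ 2)
        = ENNReal.ofReal (κ₀ * (Z * (8 * (180 * K₂ ^ 4) ^ 2) ^ 2)) := (ENNReal.ofReal_mul' hD.le).symm
      _ ≤ ENNReal.ofReal ((4 * ε ^ 2 / (144 * K₂ ^ 3) * S.card) ^ 2) := ENNReal.ofReal_le_ofReal hκ₀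
      _ = (ENNReal.ofReal (4 * ε ^ 2 / (144 * K₂ ^ 3)) * S.card) ^ 2 := by
          rw [ENNReal.ofReal_pow (by positivity), ENNReal.ofReal_mul (by positivity), ENNReal.ofReal_natCast]
      _ ≤ (8 * (ENNReal.ofReal ((180 * K₂ ^ 4) ^ 2) * I)) ^ 2 := pow_le_pow_left' h1 2
      _ = ENNReal.ofReal ((8 * (180 * K₂ ^ 4) ^ 2) ^ 2) * I ^ 2 := by
          rw [← mul_assoc, mul_pow, ENNReal.ofReal_pow (p := 8 * (180 * K₂ ^ 4) ^ 2) (by positivity),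
            ENNReal.ofReal_mul (by norm_num), ENNReal.ofReal_ofNat]
      _ ≤ ENNReal.ofReal ((8 * (180 * K₂ ^ 4) ^ 2) ^ 2) *
          (volume (sq01 ∩ orbSet (hitSet T ℓ K ε S) B) * ENNReal.ofReal Z) := mul_le_mul_right h4 _
      _ = _ := by rw [ENNReal.ofReal_mul hZ.le, mul_comm, mul_assoc]
  refine (ENNReal.mul_le_mul_iff_left ?_ ENNReal.ofReal_ne_top).1 h5
  exact (ENNReal.ofReal_pos.2 hD).ne'

lemma avoid_le_sum {E : ℕ → Set (Fin 2 → ℝ)} (hE : ∀ i, MeasurableSet (E i)) {n : ℕ} (hn : n ≠ 0)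
    {k : ENNReal} (P : ℕ → Prop) [DecidablePred P]
    (hP : ∀ i < n, ¬P i → k ≤ volume (sq01 ∩ E i)) :
    n * k ^ 2 * volume (avoid E n) ≤ 2 * k ^ 2 * ∑ i ∈ Finset.range n, (if P i then 1 else 0) +
      8 * (1 + ∑ i ∈ Finset.range n, coneEnergy (E i) (3 * i)) := by
  have hnt : (n : ENNReal) ≠ ⊤ := ENNReal.natCast_ne_top n
  have hn0 : (n : ENNReal) ≠ 0 := by exact_mod_cast hn
  have hsum : (∑ i ∈ Finset.range n, (if P i then 1 else 0) : ENNReal) =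
      (((Finset.range n).filter P).card : ENNReal) := by simp
  rw [hsum]
  by_cases hb : n ≤ 2 * ((Finset.range n).filter P).card
  · refine le_trans ?_ le_self_add
    have hv : volume (avoid E n) ≤ 1 := by
      rw [← volume_sq01]; exact measure_mono fun τ hτ => hτ.1
    have hb' : (n : ENNReal) ≤ 2 * ((Finset.range n).filter P).card := by exact_mod_cast hb
    calc n * k ^ 2 * volume (avoid E n) ≤ n * k ^ 2 * 1 := mul_le_mul_right hv _
      _ = n * k ^ 2 := mul_one _
      _ ≤ 2 * ((Finset.range n).filter P).card * k ^ 2 := mul_le_mul_left hb' _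
      _ = _ := by ring
  · refine le_trans ?_ le_add_self
    have hcard := Finset.card_filter_add_card_filter_not (s := Finset.range n) P
    rw [Finset.card_range] at hcard
    have hgood : (n : ENNReal) ≤ 2 * ((Finset.range n).filter fun i => ¬P i).card := by
      have : n ≤ 2 * ((Finset.range n).filter fun i => ¬P i).card := by omega
      exact_mod_cast this
    have hs : (((Finset.range n).filter fun i => ¬P i).card : ENNReal) * k ≤
        ∑ i ∈ Finset.range n, volume (sq01 ∩ E i) := by
      rw [← nsmul_eq_mul]
      refine (Finset.card_nsmul_le_sum _ (fun i => volume (sq01 ∩ E i)) _ fun i hi => ?_).trans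
        (Finset.sum_le_sum_of_subset (Finset.filter_subset _ _))
      rw [Finset.mem_filter, Finset.mem_range] at hi
      exact hP i hi.1 hi.2
    have h1 : n * k ≤ 2 * ∑ i ∈ Finset.range n, volume (sq01 ∩ E i) := by
      calc n * k ≤ 2 * ((Finset.range n).filter fun i => ¬P i).card * k := mul_le_mul_left hgood _
        _ = 2 * (((Finset.range n).filter fun i => ¬P i).card * k) := mul_assoc _ _ _
        _ ≤ _ := mul_le_mul_right hs _
    have h2 := volume_avoid_le hE n
    refine (ENNReal.mul_le_mul_iff_right hn0 hnt).1 ?_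
    calc (n : ENNReal) * (n * k ^ 2 * volume (avoid E n)) = (n * k) ^ 2 * volume (avoid E n) := by ring
      _ ≤ (2 * ∑ i ∈ Finset.range n, volume (sq01 ∩ E i)) ^ 2 * volume (avoid E n) :=
          mul_le_mul_left (pow_le_pow_left' h1 2) _
      _ = 4 * ((∑ i ∈ Finset.range n, volume (sq01 ∩ E i)) ^ 2 * volume (avoid E n)) := by ring
      _ ≤ 4 * (2 * n + 2 * n * ∑ i ∈ Finset.range n, coneEnergy (E i) (3 * i)) := mul_le_mul_right h2 _
      _ = _ := by ring

section Energy

open UnitAddTorus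

lemma measurable_coneEnergy {H : Set M3} (hH : MeasurableSet H) (a : ℤ) :
    Measurable fun B => coneEnergy (orbSet H B) a := by
  classical
  refine Measurable.tsum fun k => ?_
  split_ifs
  swap
  · exact measurable_const
  refine Measurable.pow_const (Measurable.enorm ?_) 2
  refine (StronglyMeasurable.integral_prod_right' (ν := volume.restrict sq01)
    (f := fun p : M3 × (Fin 2 → ℝ) =>
      mFourier (-k) (toTorus p.2) * (orbSet H p.1).indicator (1 : (Fin 2 → ℝ) → ℂ) p.2) ?_).measurable
  refine Measurable.stronglyMeasurable (Measurable.mul ?_ ?_)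
  · refine (mFourier (-k)).continuous.measurable.comp ?_
    exact measurable_pi_lambda _ fun i =>
      AddCircle.measurable_mk'.comp ((measurable_pi_apply i).comp measurable_snd)
  · have hm : Measurable fun p : M3 × (Fin 2 → ℝ) => ntr p.2 * p.1 :=
      ((continuous_ntr.comp continuous_snd).matrix_mul continuous_fst).measurable
    exact (measurable_one.indicator hH : Measurable (H.indicator (1 : M3 → ℂ))).comp hm

lemma orbSet_mul_right {H : Set M3} (hinv : ∀ A (γ : SL3Z), A * toR γ.1 ∈ H ↔ A ∈ H) (B : M3) (γ : SL3Z) :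
    orbSet H (B * toR γ.1) = orbSet H B := by
  ext θ
  change ntr θ * (B * toR γ.1) ∈ H ↔ ntr θ * B ∈ H
  rw [← Matrix.mul_assoc, hinv]

lemma lintegral_coneEnergy_le {H : Set M3} (hH : MeasurableSet H)
    (hinv : ∀ A (γ : SL3Z), A * toR γ.1 ∈ H ↔ A ∈ H) {L : ℝ} (a : ℤ) {m : ℕ}
    (hmult : ∀ (B : M3) (F : Finset SL3Z), (∀ γ ∈ F, B * toR γ.1 ∈ bddWin L) → F.card ≤ m)
    {κ : ℝ} (hκ : 0 < κ) (hκ1 : κ ≤ 1) {w : M3} (hw : w.det = 1) :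
    ∫⁻ A in bddWin L, coneEnergy (orbSet H (w * A)) a ≤
      volume {A | A ∈ bddWin L ∧ Cusp κ (w * A)} +
        m * ∫⁻ B in bddWin (3 / κ ^ 2), coneEnergy (orbSet H B) a := by
  have hΦ := (measurable_coneEnergy hH a).comp (measurable_mul_left w)
  have hC : MeasurableSet {A | A ∈ bddWin L ∧ Cusp κ (w * A)} :=
    (measurableSet_bddWin L).inter (measurable_mul_left w (isOpen_cusp κ).measurableSet)
  have hR : MeasurableSet {A | A ∈ bddWin L ∧ ¬Cusp κ (w * A)} :=
    (measurableSet_bddWin L).inter (measurable_mul_left w (isOpen_cusp κ).measurableSet).compl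
  have hE : MeasurableSet {A | w * A ∈ bddWin (3 / κ ^ 2)} := measurable_mul_left w (measurableSet_bddWin _)
  have hsub : bddWin L ⊆ {A | A ∈ bddWin L ∧ Cusp κ (w * A)} ∪ {A | A ∈ bddWin L ∧ ¬Cusp κ (w * A)} := by
    intro A hA
    by_cases h : Cusp κ (w * A)
    · exact Or.inl ⟨hA, h⟩
    · exact Or.inr ⟨hA, h⟩
  refine (lintegral_mono_set hsub).trans ((lintegral_union_le _ _ _).trans (add_le_add ?_ ?_))
  · refine (lintegral_mono (g := fun _ => 1) fun A => ?_).trans (by simp)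
    exact coneEnergy_le (measurableSet_orbSet hH _) a
  · refine (lintegral_fold_le (Φ := fun A => coneEnergy (orbSet H (w * A)) a) hR hE hΦ ?_ ?_ ?_).trans
      (mul_le_mul_right (le_of_eq ?_) _)
    · intro A γ
      rw [← Matrix.mul_assoc, orbSet_mul_right hinv]
    · rintro A ⟨hA, hA2⟩
      have hwd : w * A ∈ detWin := (mul_left_mem_detWin hw).2 hA.2
      obtain ⟨γ, hγ⟩ := exists_reduced (B := w * A) (by nlinarith [hwd.1, hwd.2]) hκ hκ1 hA2
      refine ⟨γ, ?_⟩
      change w * (A * toR γ.1) ∈ bddWin (3 / κ ^ 2)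
      rw [← Matrix.mul_assoc]
      exact ⟨hγ, (mul_right_mem_detWin (toR_det_SL γ)).2 hwd⟩
    · intro B F hF
      exact hmult B F fun γ hγ => (hF γ hγ).1
    · rw [← lintegral_indicator hE, ← lintegral_indicator (measurableSet_bddWin _),
        ← (measurePreserving_mul_left hw).lintegral_comp
          ((measurable_coneEnergy hH a).indicator (measurableSet_bddWin _))]
      rfl

end Energy

lemma hitSet_mul_right {T : Fin 2 → ℝ → ℝ} {ℓ : ℤ} {K ε : ℝ} {S : Finset SL3Z} (A : M3) (γ : SL3Z) :
    A * toR γ.1 ∈ hitSet T ℓ K ε S ↔ A ∈ hitSet T ℓ K ε S := by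
  simp only [hitSet, Set.mem_iUnion, hitFor_mul_right]

/-- The orbit sets of the translates of `A` by the elements `wMat (3 * i)`. -/
def orbFam (H : Set M3) (A : M3) (i : ℕ) : Set (Fin 2 → ℝ) := orbSet H (toR (wMat (3 * i)).1 * A)

lemma lintegral_avoid_le {H : Set M3} (hH : MeasurableSet H)
    (hinv : ∀ A (γ : SL3Z), A * toR γ.1 ∈ H ↔ A ∈ H) {L : ℝ} {n : ℕ} (hn : n ≠ 0)
    {bad : ℕ → Set M3} (hbad : ∀ i, MeasurableSet (bad i)) {k : ENNReal} (hk : k ≠ ⊤)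
    (hgood : ∀ i < n, ∀ A ∈ bddWin L, A ∉ bad i → k ≤ volume (sq01 ∩ orbFam H A i))
    {β χ : ENNReal} (hβ : ∀ i < n, volume (bad i ∩ bddWin L) ≤ β) {m : ℕ}
    (hmult : ∀ (B : M3) (F : Finset SL3Z), (∀ γ ∈ F, B * toR γ.1 ∈ bddWin L) → F.card ≤ m)
    {κ : ℝ} (hκ : 0 < κ) (hκ1 : κ ≤ 1)
    (hχ : ∀ i < n, volume {A | A ∈ bddWin L ∧ Cusp κ (toR (wMat (3 * i)).1 * A)} ≤ χ) :
    n * k ^ 2 * ∫⁻ A in bddWin L, volume (avoid (orbFam H A) n) ≤ 2 * k ^ 2 * (n * β) +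
      8 * (volume (bddWin L) + (n * χ + m * volume (bddWin (3 / κ ^ 2)))) := by
  classical
  have hcm : ∀ i : ℕ, Measurable fun A => coneEnergy (orbFam H A i) (3 * i) := fun i =>
    (measurable_coneEnergy hH _).comp (measurable_mul_left _)
  have hbm : ∀ i, Measurable ((bad i).indicator (1 : M3 → ENNReal)) := fun i =>
    measurable_one.indicator (hbad i)
  rw [← lintegral_const_mul' _ _ (ENNReal.mul_ne_top (ENNReal.natCast_ne_top n) (ENNReal.pow_ne_top hk))]
  have hpt : ∀ A ∈ bddWin L, n * k ^ 2 * volume (avoid (orbFam H A) n) ≤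
      2 * k ^ 2 * ∑ i ∈ Finset.range n, (bad i).indicator 1 A +
      8 * (1 + ∑ i ∈ Finset.range n, coneEnergy (orbFam H A i) (3 * i)) := by
    intro A hA
    exact avoid_le_sum (fun i => measurableSet_orbSet hH _) hn (fun i => A ∈ bad i)
      fun i hi hi2 => hgood i hi A hA hi2
  refine (setLIntegral_mono' (measurableSet_bddWin L) hpt).trans ?_
  have hm1 : Measurable fun A => ∑ i ∈ Finset.range n, (bad i).indicator (1 : M3 → ENNReal) A :=
    Finset.measurable_fun_sum _ fun i _ => hbm i
  have hm2 : Measurable fun A => ∑ i ∈ Finset.range n, coneEnergy (orbFam H A i) (3 * i) :=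
    Finset.measurable_fun_sum _ fun i _ => hcm i
  have hm3 : Measurable fun A => 1 + ∑ i ∈ Finset.range n, coneEnergy (orbFam H A i) (3 * i) := hm2.const_add 1
  rw [lintegral_add_left (hm1.const_mul _), lintegral_const_mul _ hm1,
    lintegral_const_mul _ hm3, lintegral_add_left measurable_const,
    lintegral_finsetSum _ fun i _ => hbm i, lintegral_finsetSum _ fun i _ => hcm i, setLIntegral_one]
  refine add_le_add (mul_le_mul_right ?_ _) (mul_le_mul_right (add_le_add le_rfl ?_) _)
  · have h1 : ∀ i ∈ Finset.range n, ∫⁻ A in bddWin L, (bad i).indicator 1 A ≤ β := fun i hi => by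
      rw [lintegral_indicator_one (hbad i), Measure.restrict_apply (hbad i)]
      exact hβ i (Finset.mem_range.1 hi)
    refine (Finset.sum_le_card_nsmul _ _ _ h1).trans ?_
    rw [Finset.card_range, nsmul_eq_mul]
  · have h1 : ∀ i ∈ Finset.range n, ∫⁻ A in bddWin L, coneEnergy (orbFam H A i) (3 * i) ≤
        χ + m * ∫⁻ B in bddWin (3 / κ ^ 2), coneEnergy (orbSet H B) (3 * i) := fun i hi =>
      (lintegral_coneEnergy_le hH hinv _ hmult hκ hκ1 (toR_det_SL (wMat (3 * i)))).trans
        (add_le_add (hχ i (Finset.mem_range.1 hi)) le_rfl)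
    refine (Finset.sum_le_sum h1).trans ?_
    rw [Finset.sum_add_distrib, Finset.sum_const, Finset.card_range, nsmul_eq_mul, ← Finset.mul_sum,
      ← lintegral_finsetSum _ fun i _ => measurable_coneEnergy hH _]
    refine add_le_add le_rfl (mul_le_mul_right ?_ _)
    refine (lintegral_mono (g := fun _ => 1) fun B => ?_).trans (by simp)
    exact sum_coneEnergy_le (measurableSet_orbSet hH B) n

lemma eBdd_ntr {θ : Fin 2 → ℝ} (hθ : θ ∈ sq01) : EBdd 1 (ntr θ) := by
  have h0 := hθ 0
  have h1 := hθ 1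
  intro i j
  fin_cases i <;> fin_cases j <;> simp [ntr] <;> rw [abs_of_pos] <;>
    first | exact h0.2 | exact h1.2 | exact h0.1 | exact h1.1

lemma eBdd_wMat {i n : ℕ} (hi : i < n) : EBdd (9 * (n : ℝ) ^ 2) (toR (wMat (3 * i)).1) := by
  have hin : (i : ℝ) + 1 ≤ n := by exact_mod_cast hi
  have hi0 : (0 : ℝ) ≤ i := Nat.cast_nonneg i
  intro p q
  rw [abs_le]
  fin_cases p <;> fin_cases q <;> simp [wMat] <;> (try constructor) <;> nlinarith

lemma eBdd_adjugate_orbit {h : ℕ} (hh : 1 ≤ h) {γ : SL3Z} (H : ColBox h γ.1) {θ : Fin 2 → ℝ} (hθ : θ ∈ sq01)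
    {i n : ℕ} (hi : i < n) : EBdd (2 * (1215 * h * (n : ℝ) ^ 2) ^ 2)
      (toR γ.1 * (ntr θ * toR (wMat (3 * i)).1)).adjugate := by
  have := (H.eBdd).mul ((eBdd_ntr hθ).mul (eBdd_wMat hi))
  refine (this.adjugate).mono (le_of_eq ?_)
  ring

lemma eBdd_adjugate_wMat {i n : ℕ} (hi : i < n) {h : ℕ} (hh : 1 ≤ h) :
    EBdd (2 * (1215 * h * (n : ℝ) ^ 2) ^ 2) (toR (wMat (3 * i)).1).adjugate := by
  refine ((eBdd_wMat hi).adjugate).mono ?_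
  have : (1 : ℝ) ≤ h := by exact_mod_cast hh
  have hn : (0 : ℝ) ≤ (n : ℝ) ^ 2 := by positivity
  gcongr
  linarith

/-- The matrices whose orbit under `wMat (3 * i)` is cuspidal or has a large second moment. -/
def badOrb (T : Fin 2 → ℝ → ℝ) (ℓ : ℤ) (κ K ε Z : ℝ) (S : Finset SL3Z) (i : ℕ) : Set M3 :=
  {A | (S.card : ENNReal) < 8 * cuspCount κ S (toR (wMat (3 * i)).1 * A)} ∪
    {A | ENNReal.ofReal Z < sqCount T ℓ K ε S (toR (wMat (3 * i)).1 * A)}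

lemma measurableSet_badOrb {T : Fin 2 → ℝ → ℝ} (hT : ∀ i, Measurable (T i)) (ℓ : ℤ) (κ K ε Z : ℝ)
    (S : Finset SL3Z) (i : ℕ) : MeasurableSet (badOrb T ℓ κ K ε Z S i) :=
  (measurableSet_lt measurable_const ((measurable_cuspCount κ S _).const_mul 8)).union
    (measurableSet_lt measurable_const (measurable_sqCount hT ℓ K ε S _))

lemma volume_badOrb_le {T : Fin 2 → ℝ → ℝ} (hT : ∀ i, Measurable (T i)) {ℓ : ℤ} (hℓ : ℓ ≠ 0)
    {j : ℕ} {S : Finset SL3Z} (hS0 : S.Nonempty) (hS : ∀ γ ∈ S, ColBox (2 ^ j) γ.1) {κ K ε Z L δ : ℝ}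
    (hK : BigFor ℓ K) (hκ : 0 < κ) (hκ1 : κ ≤ 1) (hε : 0 < ε) (hε1 : ε ≤ 1) (hεh : ε * (2 ^ j) ^ 3 ≤ 1)
    (hL : 1 ≤ L) (hZ : 0 < Z) (hδ : 0 ≤ δ) (hZδ : (25 * L ^ 3) ^ 9 * (K ^ 186 * ε ^ 2) *
        (S.card * (4 * (270 * 432 ^ 2) * (3 * j + 15))) ≤ δ * Z) {i n M : ℕ} (hi : i < n)
    (hM : 36 * L ^ 2 * (2 * (1215 * (2 ^ j : ℕ) * (n : ℝ) ^ 2) ^ 2) ≤ 2 ^ M) :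
    volume (badOrb T ℓ κ K ε Z S i ∩ bddWin L) ≤
      ENNReal.ofReal (8 * (27648 * L ^ 6 * κ ^ 3 * (M + 1)) + δ) := by
  have hw := toR_det_SL (wMat (3 * i))
  have hcard : (S.card : ENNReal) ≠ 0 := by exact_mod_cast hS0.card_pos.ne'
  rw [badOrb, Set.union_inter_distrib_right, ENNReal.ofReal_add (by positivity) hδ]
  refine (measure_union_le _ _).trans (add_le_add ?_ ?_)
  · have h1 := lintegral_cuspCount_le hκ hκ1 (by linarith : (0 : ℝ) ≤ L) hw (S := S)
      (fun γ hγ θ hθ => eBdd_adjugate_orbit Nat.one_le_two_pow (hS γ hγ) hθ hi) hM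
    have h2 := mul_meas_ge_le_lintegral (μ := volume.restrict (bddWin L))
      ((measurable_cuspCount κ S (toR (wMat (3 * i)).1)).const_mul 8) S.card
    rw [lintegral_const_mul _ (measurable_cuspCount κ S _)] at h2
    have h3 := h2.trans (mul_le_mul_right h1 8)
    rw [mul_left_comm] at h3
    have h4 := (ENNReal.mul_le_mul_iff_right hcard (ENNReal.natCast_ne_top _)).1 h3
    rw [Measure.restrict_apply' (measurableSet_bddWin L)] at h4
    rw [ENNReal.ofReal_mul (by norm_num), ENNReal.ofReal_ofNat]
    refine le_trans (measure_mono (Set.inter_subset_inter_left _ ?_)) h4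
    exact fun A hA => (Set.mem_ofPred_eq ▸ hA : _ < _).le
  · have h1 := lintegral_sqCount_le hT hℓ hS hK hε hε1 hεh hw hL
    have h2 := mul_meas_ge_le_lintegral (μ := volume.restrict (bddWin L))
      (measurable_sqCount hT ℓ K ε S (toR (wMat (3 * i)).1)) (ENNReal.ofReal Z)
    have h3 := h2.trans (h1.trans (ENNReal.ofReal_le_ofReal hZδ))
    rw [mul_comm δ, ENNReal.ofReal_mul hZ.le] at h3
    have h4 := (ENNReal.mul_le_mul_iff_right (ENNReal.ofReal_pos.2 hZ).ne' ENNReal.ofReal_ne_top).1 h3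
    rw [Measure.restrict_apply' (measurableSet_bddWin L)] at h4
    refine le_trans (measure_mono (Set.inter_subset_inter_left _ ?_)) h4
    exact fun A hA => (Set.mem_ofPred_eq ▸ hA : _ < _).le

lemma volume_bddWin_le {L : ℝ} (hL : 0 ≤ L) : volume (bddWin L) ≤ ENNReal.ofReal ((2 * L) ^ 9) := by
  rw [← volume_EBdd hL]; exact measure_mono Set.inter_subset_left

lemma eventually_mul_pow_le_two_pow (P : ℕ) : ∀ᶠ j : ℕ in Filter.atTop, (j : ℝ) ^ P ≤ 2 ^ j := by
  have h := tendsto_pow_const_div_const_pow_of_one_lt P (one_lt_two : (1 : ℝ) < 2)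
  filter_upwards [h.eventually_le_const one_pos] with j hj
  rwa [div_le_one (by positivity)] at hj

lemma kappa_condition {J C c L s ε : ℝ} (hJ : 1 ≤ J) (hc : 1 ≤ c) (hL : 1 ≤ L) (hs : 1 / 4096 ≤ ε ^ 2 * s)
    (hC : 0 ≤ C) (hJc : 4096 * ((25 * L ^ 3) ^ 9 * C * 18 * (64 * 180 ^ 4) * 1296 * c ^ 22) ≤ J) :
    1 / J ^ 5902 * (J ^ 2 * ((25 * L ^ 3) ^ 9 * ((J ^ 31) ^ 186 * ε ^ 2) * (s * (C * (3 * J + 15)))) *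
      (8 * (180 * (c * J ^ 6) ^ 4) ^ 2) ^ 2) ≤ (4 * ε ^ 2 / (144 * (c * J ^ 6) ^ 3) * s) ^ 2 := by
  have hJ0 : 0 < J := by linarith
  have hc0 : 0 < c := by linarith
  obtain ⟨q, hq⟩ : ∃ q, q = ε ^ 2 * s := ⟨_, rfl⟩
  have hq0 : 0 < q := by rw [hq]; linarith
  obtain ⟨d, hd⟩ : ∃ d, d = (25 * L ^ 3) ^ 9 := ⟨_, rfl⟩
  have hd0 : 0 < d := by rw [hd]; positivity
  rw [← hd] at hJc ⊢
  have e1 : (4 * ε ^ 2 / (144 * (c * J ^ 6) ^ 3) * s) ^ 2 = q ^ 2 / (1296 * c ^ 6 * J ^ 36) := by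
    rw [hq]; field_simp; ring
  have e2 : J ^ 2 * (d * ((J ^ 31) ^ 186 * ε ^ 2) * (s * (C * (3 * J + 15)))) *
      (8 * (180 * (c * J ^ 6) ^ 4) ^ 2) ^ 2 =
      q * (d * C * (64 * 180 ^ 4) * c ^ 16) * J ^ 5864 * (3 * J + 15) := by
    rw [hq]; ring
  rw [e1, e2, one_div_mul_eq_div, div_le_div_iff₀ (by positivity) (by positivity)]
  have h1 : 3 * J + 15 ≤ 18 * J := by linarith
  calc q * (d * C * (64 * 180 ^ 4) * c ^ 16) * J ^ 5864 * (3 * J + 15) * (1296 * c ^ 6 * J ^ 36)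
      ≤ q * (d * C * (64 * 180 ^ 4) * c ^ 16) * J ^ 5864 * (18 * J) * (1296 * c ^ 6 * J ^ 36) := by
        gcongr
    _ = q * J ^ 5901 * (1 / 4096) * (4096 * (d * C * 18 * (64 * 180 ^ 4) * 1296 * c ^ 22)) := by ring
    _ ≤ q * J ^ 5901 * q * J := by
        rw [← hq] at hs
        gcongr
    _ = q ^ 2 * J ^ 5902 := by ring

lemma final_condition {J L : ℝ} (hJ : 1 ≤ J) (hL : 1 ≤ L) {m : ℝ} (hm : m ≤ (25 * L ^ 3) ^ 9)
    (h1 : 8 * 27648 * 4 * L ^ 6 ≤ J) (h2 : 8 * ((2 * L) ^ 9 + (25 * L ^ 3) ^ 9 * 6 ^ 9) ≤ J) :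
    2 * (1 / J ^ 5902) ^ 2 * (J ^ 82655 * (8 * (27648 * L ^ 6 * (1 / J) ^ 3 * (3 * J + 1)) + 1 / J ^ 2)) +
      8 * ((2 * L) ^ 9 + (J ^ 82655 * (27648 * L ^ 6 * (1 / J ^ 3936) ^ 3 * (3 * J + 1)) +
        m * (2 * (3 / (1 / J ^ 3936) ^ 2)) ^ 9)) ≤
      J ^ 82655 * (1 / J ^ 5902) ^ 2 * ((2 * (8 * 27648 * 4 * L ^ 6 + 1) + 2) / J ^ 2) := by
  have hJ0 : 0 < J := by linarith
  have hJ1 : 3 * J + 1 ≤ 4 * J := by linarith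
  have t1 : 8 * (27648 * L ^ 6 * (1 / J) ^ 3 * (3 * J + 1)) + 1 / J ^ 2 ≤
      (8 * 27648 * 4 * L ^ 6 + 1) / J ^ 2 := by
    calc 8 * (27648 * L ^ 6 * (1 / J) ^ 3 * (3 * J + 1)) + 1 / J ^ 2
        ≤ 8 * (27648 * L ^ 6 * (1 / J) ^ 3 * (4 * J)) + 1 / J ^ 2 := by gcongr
      _ = (8 * 27648 * 4 * L ^ 6 + 1) / J ^ 2 := by field_simp
  have t2 : 8 * (27648 * L ^ 6 * (1 / J ^ 3936) ^ 3 * (3 * J + 1)) ≤ (1 / J ^ 5902) ^ 2 * (1 / J ^ 2) := by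
    calc 8 * (27648 * L ^ 6 * (1 / J ^ 3936) ^ 3 * (3 * J + 1))
        ≤ 8 * (27648 * L ^ 6 * (1 / J ^ 3936) ^ 3 * (4 * J)) := by gcongr
      _ = 8 * 27648 * 4 * L ^ 6 * ((1 / J ^ 3936) ^ 3 * J) := by ring
      _ ≤ J * ((1 / J ^ 3936) ^ 3 * J) := by gcongr
      _ = (1 / J ^ 5902) ^ 2 * (1 / J ^ 2) := by
          rw [div_pow, div_pow, ← pow_mul, ← pow_mul, one_pow, one_pow]
          rw [div_mul_div_comm, ← pow_add, mul_one, one_div_mul_eq_div, ← mul_div_assoc,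
            div_eq_div_iff (by positivity) (by positivity)]
          ring
  have t3 : 8 * ((2 * L) ^ 9 + m * (2 * (3 / (1 / J ^ 3936) ^ 2)) ^ 9) ≤
      J ^ 82655 * (1 / J ^ 5902) ^ 2 * (1 / J ^ 2) := by
    have e : (2 * (3 / (1 / J ^ 3936) ^ 2)) ^ 9 = 6 ^ 9 * J ^ 70848 := by
      rw [one_div, inv_pow, div_inv_eq_mul]; ring
    have e' : J ^ 82655 * (1 / J ^ 5902) ^ 2 * (1 / J ^ 2) = J ^ 70849 := by
      rw [one_div, one_div, inv_pow, ← pow_mul, mul_assoc, ← mul_inv, ← pow_add,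
        ← div_eq_mul_inv, div_eq_iff (by positivity), ← pow_add]
    rw [e, e']
    have hp : (1 : ℝ) ≤ J ^ 70848 := one_le_pow₀ hJ
    calc 8 * ((2 * L) ^ 9 + m * (6 ^ 9 * J ^ 70848))
        ≤ 8 * ((2 * L) ^ 9 * J ^ 70848 + (25 * L ^ 3) ^ 9 * (6 ^ 9 * J ^ 70848)) := by
          have : (2 * L) ^ 9 ≤ (2 * L) ^ 9 * J ^ 70848 := le_mul_of_one_le_right (by positivity) hp
          gcongr
      _ = 8 * ((2 * L) ^ 9 + (25 * L ^ 3) ^ 9 * 6 ^ 9) * J ^ 70848 := by ring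
      _ ≤ J * J ^ 70848 := by gcongr
      _ = J ^ 70849 := by ring
  obtain ⟨k, hk⟩ : ∃ k, k = (1 / J ^ 5902) ^ 2 := ⟨_, rfl⟩
  have hk0 : 0 < k := by rw [hk]; positivity
  obtain ⟨N, hN⟩ : ∃ N, N = J ^ 82655 := ⟨_, rfl⟩
  have hN0 : 0 < N := by rw [hN]; positivity
  rw [← hk] at t2 t3 ⊢
  rw [← hN] at t3 ⊢
  have a1 := mul_le_mul_of_nonneg_left t1 (by positivity : 0 ≤ 2 * k * N)
  have a2 := mul_le_mul_of_nonneg_left t2 hN0.le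
  have e3 : N * k * ((2 * (8 * 27648 * 4 * L ^ 6 + 1) + 2) / J ^ 2) =
      2 * k * N * ((8 * 27648 * 4 * L ^ 6 + 1) / J ^ 2) + N * (k * (1 / J ^ 2)) + N * k * (1 / J ^ 2) := by
    ring
  rw [e3]
  linarith

lemma lintegral_avoid_le_of_large {T : Fin 2 → ℝ → ℝ} (hT : ∀ i, Measurable (T i)) {ℓ : ℤ} (hℓ : ℓ ≠ 0)
    {τ : ℝ} (hτ : ∀ i t, |T i t| + 1 ≤ τ) {L : ℝ} (hL : 1 ≤ L) {c : ℝ} (hc : c = 288 * (9 * |(ℓ : ℝ)|) ^ 3)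
    {j : ℕ} (hJ : 1 ≤ (j : ℝ)) (hτJ : τ ≤ j) (hBig : BigFor ℓ j) (h543 : 543 * c ^ 5 ≤ j)
    (h90 : 90 * c ^ 4 ≤ j) (h25 : (j : ℝ) ^ 25 ≤ 2 ^ j) (h118 : 118 ≤ 2 ^ j)
    (hkap : 4096 * ((25 * L ^ 3) ^ 9 * (4 * (270 * 432 ^ 2)) * 18 * (64 * 180 ^ 4) * 1296 * c ^ 22) ≤ j)
    (h1 : 8 * 27648 * 4 * L ^ 6 ≤ j) (h2 : 8 * ((2 * L) ^ 9 + (25 * L ^ 3) ^ 9 * 6 ^ 9) ≤ j)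
    (hM1 : 72 * 1215 ^ 2 * L ^ 2 ≤ j) (hM2 : (j : ℝ) ^ 330621 ≤ 2 ^ j) :
    ∃ S : Finset SL3Z, (∀ γ ∈ S, ColBox (2 ^ j) γ.1) ∧
      ∫⁻ A in bddWin L, volume (avoid (orbFam (hitSet T ℓ ((j : ℝ) ^ 31) (1 / 8 ^ j) S) A) (j ^ 82655)) ≤
        ENNReal.ofReal ((2 * (8 * 27648 * 4 * L ^ 6 + 1) + 2) / (j : ℝ) ^ 2) := by
  obtain ⟨S, hcard, hS⟩ := exists_many_SL3Z (2 ^ j) h118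
  refine ⟨S, hS, ?_⟩
  obtain ⟨J, hJdef⟩ : ∃ J : ℝ, J = j := ⟨_, rfl⟩
  rw [← hJdef] at hJ hτJ hBig h543 h90 h25 hkap h1 h2 hM1 hM2 ⊢
  have hJ0 : 0 < J := by linarith
  have hℓ1 : (1 : ℝ) ≤ |(ℓ : ℝ)| := by exact_mod_cast Int.one_le_abs hℓ
  have hc1 : 1 ≤ c := by
    rw [hc]
    have : (1 : ℝ) ≤ (9 * |(ℓ : ℝ)|) ^ 3 := one_le_pow₀ (by linarith)
    linarith
  obtain ⟨ε, hε⟩ : ∃ ε : ℝ, ε = 1 / 8 ^ j := ⟨_, rfl⟩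
  have hε0 : 0 < ε := by rw [hε]; positivity
  have hε1 : ε ≤ 1 := by
    rw [hε, div_le_one (by positivity)]; exact one_le_pow₀ (by norm_num)
  have h8 : (8 : ℝ) ^ j = (2 ^ j) ^ 3 := by rw [← pow_mul, mul_comm, pow_mul]; norm_num
  have hεh : ε * (2 ^ j) ^ 3 ≤ 1 := by
    rw [hε, ← h8, one_div, inv_mul_cancel₀ (by positivity)]
  obtain ⟨s, hs⟩ : ∃ s : ℝ, s = S.card := ⟨_, rfl⟩
  have hsR : ((2 : ℝ) ^ j) ^ 6 ≤ 4096 * s := by rw [hs]; exact_mod_cast hcard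
  have hs1 : 1 / 4096 ≤ ε ^ 2 * s := by
    have : ε ^ 2 * (((2 : ℝ) ^ j) ^ 6) = 1 := by
      rw [hε, h8]; field_simp
    have h3 := mul_le_mul_of_nonneg_left hsR (by positivity : 0 ≤ ε ^ 2)
    linarith
  have hs0 : 0 < s := by
    have : (0 : ℝ) < ((2 : ℝ) ^ j) ^ 6 := by positivity
    linarith
  have hS0 : S.Nonempty := by
    rw [← Finset.card_pos]; rw [hs] at hs0; exact_mod_cast hs0
  rw [← hε]
  have hJJ : J ≤ J ^ 31 := le_self_pow₀ hJ (by norm_num)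
  have hK2 : c * J ^ 6 = 288 * (9 * |(ℓ : ℝ)| / (1 / J) ^ 2) ^ 3 := by
    rw [hc]; field_simp
  have hκ1 : 1 / J ≤ 1 := by rw [div_le_one hJ0]; exact hJ
  have hTK : ∀ i t, |T i t| + 1 ≤ c * J ^ 6 := fun i t => by
    have e1 : J ≤ J ^ 6 := le_self_pow₀ hJ (by norm_num)
    have e2 : J ^ 6 ≤ c * J ^ 6 := le_mul_of_one_le_left (by positivity) hc1
    linarith [hτ i t]
  have hKK : 543 * (c * J ^ 6) ^ 5 ≤ J ^ 31 := by
    calc 543 * (c * J ^ 6) ^ 5 = 543 * c ^ 5 * J ^ 30 := by ring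
      _ ≤ J * J ^ 30 := by gcongr
      _ = J ^ 31 := by ring
  have hhh : 90 * (c * J ^ 6) ^ 4 ≤ (((2 ^ j : ℕ) : ℝ)) ^ 3 := by
    push_cast
    have e1 : (1 : ℝ) ≤ 2 ^ j := one_le_pow₀ (by norm_num)
    calc 90 * (c * J ^ 6) ^ 4 = 90 * c ^ 4 * J ^ 24 := by ring
      _ ≤ J * J ^ 24 := by gcongr
      _ = J ^ 25 := by ring
      _ ≤ 2 ^ j := h25
      _ ≤ (2 ^ j) ^ 3 := le_self_pow₀ e1 (by norm_num)
  obtain ⟨Z, hZ⟩ : ∃ Z : ℝ, Z = J ^ 2 * ((25 * L ^ 3) ^ 9 * ((J ^ 31) ^ 186 * ε ^ 2) *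
      (s * (4 * (270 * 432 ^ 2) * (3 * J + 15)))) := ⟨_, rfl⟩
  have hZ0 : 0 < Z := by rw [hZ]; positivity
  have hkc := kappa_condition (C := 4 * (270 * 432 ^ 2)) hJ hc1 hL hs1 (by norm_num) hkap
  rw [← hZ] at hkc
  obtain ⟨m, hm, hmult⟩ := exists_multiplicity hL
  have hM : ∀ n : ℕ, (n : ℝ) = J ^ 82655 →
      36 * L ^ 2 * (2 * (1215 * (2 ^ j : ℕ) * (n : ℝ) ^ 2) ^ 2) ≤ 2 ^ (3 * j) := by
    intro n hn
    rw [hn]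
    push_cast
    calc 36 * L ^ 2 * (2 * (1215 * 2 ^ j * (J ^ 82655) ^ 2) ^ 2)
        = 72 * 1215 ^ 2 * L ^ 2 * J ^ 330620 * (2 ^ j) ^ 2 := by ring
      _ ≤ J * J ^ 330620 * (2 ^ j) ^ 2 := by gcongr
      _ = J ^ 330621 * (2 ^ j) ^ 2 := by ring
      _ ≤ 2 ^ j * (2 ^ j) ^ 2 := by gcongr
      _ = 2 ^ (3 * j) := by rw [mul_comm 3 j, pow_mul]; ring
  obtain ⟨n, hn⟩ : ∃ n : ℕ, n = j ^ 82655 := ⟨_, rfl⟩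
  have hnR : (n : ℝ) = J ^ 82655 := by rw [hn, Nat.cast_pow, hJdef]
  have hn0 : n ≠ 0 := by
    intro h0
    rw [h0, Nat.cast_zero] at hnR
    have : 0 < J ^ 82655 := by positivity
    linarith
  rw [← hn]
  have hMn := hM n hnR
  have hJ3936 : 1 / J ^ 3936 ≤ 1 := by
    rw [div_le_one (by positivity)]; exact one_le_pow₀ hJ
  have key := lintegral_avoid_le (H := hitSet T ℓ (J ^ 31) ε S) (measurableSet_hitSet hT ℓ _ ε S)
    hitSet_mul_right (L := L) hn0
    (bad := badOrb T ℓ (1 / J) (J ^ 31) ε Z S) (measurableSet_badOrb hT ℓ _ _ ε Z S)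
    (k := ENNReal.ofReal (1 / J ^ 5902)) ENNReal.ofReal_ne_top
    (fun i hi A hA hAb => ?_)
    (β := ENNReal.ofReal (8 * (27648 * L ^ 6 * (1 / J) ^ 3 * (3 * J + 1)) + 1 / J ^ 2))
    (χ := ENNReal.ofReal (27648 * L ^ 6 * (1 / J ^ 3936) ^ 3 * (3 * J + 1)))
    (fun i hi => ?_) hmult (κ := 1 / J ^ 3936) (by positivity) hJ3936 (fun i hi => ?_)
  · have hfin := final_condition hJ hL hm h1 h2
    have hv1 := volume_bddWin_le (L := L) (by linarith)
    have hv2 := volume_bddWin_le (L := 3 / (1 / J ^ 3936) ^ 2) (by positivity)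
    have hnE : (n : ENNReal) = ENNReal.ofReal (J ^ 82655) := by
      rw [← hnR, ENNReal.ofReal_natCast]
    have hmE : (m : ENNReal) = ENNReal.ofReal m := by rw [ENNReal.ofReal_natCast]
    have hlast : (n : ENNReal) * ENNReal.ofReal (1 / J ^ 5902) ^ 2 *
        ∫⁻ A in bddWin L, volume (avoid (orbFam (hitSet T ℓ (J ^ 31) ε S) A) n) ≤
        (n : ENNReal) * ENNReal.ofReal (1 / J ^ 5902) ^ 2 *
        ENNReal.ofReal ((2 * (8 * 27648 * 4 * L ^ 6 + 1) + 2) / J ^ 2) := by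
      refine key.trans ?_
      have e2 : (2 : ENNReal) = ENNReal.ofReal 2 := by norm_num
      have e8 : (8 : ENNReal) = ENNReal.ofReal 8 := by norm_num
      calc _ ≤ 2 * ENNReal.ofReal (1 / J ^ 5902) ^ 2 * (n * ENNReal.ofReal
            (8 * (27648 * L ^ 6 * (1 / J) ^ 3 * (3 * J + 1)) + 1 / J ^ 2)) +
            8 * (ENNReal.ofReal ((2 * L) ^ 9) + (n * ENNReal.ofReal
              (27648 * L ^ 6 * (1 / J ^ 3936) ^ 3 * (3 * J + 1)) +
              m * ENNReal.ofReal ((2 * (3 / (1 / J ^ 3936) ^ 2)) ^ 9))) := by gcongr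
        _ = ENNReal.ofReal (2 * (1 / J ^ 5902) ^ 2 * (J ^ 82655 *
              (8 * (27648 * L ^ 6 * (1 / J) ^ 3 * (3 * J + 1)) + 1 / J ^ 2)) +
            8 * ((2 * L) ^ 9 + (J ^ 82655 * (27648 * L ^ 6 * (1 / J ^ 3936) ^ 3 * (3 * J + 1)) +
              m * (2 * (3 / (1 / J ^ 3936) ^ 2)) ^ 9))) := by
            rw [hnE, hmE, e2, e8, ← ENNReal.ofReal_pow (by positivity),
              ← ENNReal.ofReal_mul (by positivity), ← ENNReal.ofReal_mul (by positivity),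
              ← ENNReal.ofReal_mul (by positivity), ← ENNReal.ofReal_mul (by positivity),
              ← ENNReal.ofReal_mul (by positivity), ← ENNReal.ofReal_add (by positivity) (by positivity),
              ← ENNReal.ofReal_add (by positivity) (by positivity), ← ENNReal.ofReal_mul (by positivity),
              ← ENNReal.ofReal_add (by positivity) (by positivity)]
        _ ≤ ENNReal.ofReal (J ^ 82655 * (1 / J ^ 5902) ^ 2 *
              ((2 * (8 * 27648 * 4 * L ^ 6 + 1) + 2) / J ^ 2)) := ENNReal.ofReal_le_ofReal hfin
        _ = _ := by
            rw [hnE, ← ENNReal.ofReal_pow (by positivity),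
              ← ENNReal.ofReal_mul (by positivity), ← ENNReal.ofReal_mul (by positivity)]
    have hk0 : ENNReal.ofReal (1 / J ^ 5902) ≠ 0 := by
      rw [Ne, ENNReal.ofReal_eq_zero, not_le]; positivity
    refine (ENNReal.mul_le_mul_iff_right (mul_ne_zero (by exact_mod_cast hn0) (pow_ne_zero 2 hk0))
      (ENNReal.mul_ne_top (ENNReal.natCast_ne_top n) (ENNReal.pow_ne_top ENNReal.ofReal_ne_top))).1 hlast
  · rw [badOrb, Set.mem_union, not_or] at hAb
    refine orbit_hit_lower (h := 2 ^ j) Nat.one_le_two_pow hS hℓ hT (by positivity) hκ1 hK2 hTK hKK hhh hε0 hε1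
      (mul_left_mem_detWin (toR_det_SL _) |>.2 hA.2) (not_lt.1 hAb.1) hZ0 (not_lt.1 hAb.2) ?_
    rw [← hs]; exact hkc
  · have := volume_badOrb_le hT hℓ hS0 hS (hBig.mono hJJ) (κ := 1 / J) (by positivity) hκ1 hε0 hε1 hεh hL hZ0
      (δ := 1 / J ^ 2) (by positivity) ?_ hi hMn
    · convert this using 3
      push_cast; rw [hJdef]
    · rw [hZ, hs, ← hJdef, one_div, inv_mul_cancel_left₀ (pow_ne_zero 2 hJ0.ne')]
  · have := volume_cusp_le (w := toR (wMat (3 * i)).1) (toR_det_SL _) (eBdd_adjugate_wMat hi (h := 2 ^ j)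
      Nat.one_le_two_pow) (κ := 1 / J ^ 3936) (by positivity) hJ3936 (L := L) (by linarith) hMn
    convert this using 3
    push_cast; rw [hJdef]

lemma eventually_lintegral_avoid_le {T : Fin 2 → ℝ → ℝ} (hT : ∀ i, Measurable (T i)) {ℓ : ℤ} (hℓ : ℓ ≠ 0)
    {τ : ℝ} (hτ : ∀ i t, |T i t| + 1 ≤ τ) {L : ℝ} (hL : 1 ≤ L) :
    ∃ C : ℝ, ∀ᶠ j : ℕ in Filter.atTop, ∃ S : Finset SL3Z, (∀ γ ∈ S, ColBox (2 ^ j) γ.1) ∧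
      ∫⁻ A in bddWin L, volume (avoid (orbFam (hitSet T ℓ ((j : ℝ) ^ 31) (1 / 8 ^ j) S) A) (j ^ 82655)) ≤
        ENNReal.ofReal (C / (j : ℝ) ^ 2) := by
  refine ⟨2 * (8 * 27648 * 4 * L ^ 6 + 1) + 2, ?_⟩
  have big : ∀ x : ℝ, ∀ᶠ j : ℕ in Filter.atTop, x ≤ j := fun x =>
    tendsto_natCast_atTop_atTop.eventually_ge_atTop x
  filter_upwards [big 1, big τ, big 1000, big (9 * |(ℓ : ℝ)|), big ((detSet ℓ).ncard : ℝ),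
    big (543 * (288 * (9 * |(ℓ : ℝ)|) ^ 3) ^ 5), big (90 * (288 * (9 * |(ℓ : ℝ)|) ^ 3) ^ 4),
    eventually_mul_pow_le_two_pow 25, Filter.eventually_ge_atTop 7,
    big (4096 * ((25 * L ^ 3) ^ 9 * (4 * (270 * 432 ^ 2)) * 18 * (64 * 180 ^ 4) * 1296 *
      (288 * (9 * |(ℓ : ℝ)|) ^ 3) ^ 22)),
    big (8 * 27648 * 4 * L ^ 6), big (8 * ((2 * L) ^ 9 + (25 * L ^ 3) ^ 9 * 6 ^ 9)),
    big (72 * 1215 ^ 2 * L ^ 2), eventually_mul_pow_le_two_pow 330621]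
    with j b1 b2 b3 b4 b5 b6 b7 b8 b9 b10 b11 b12 b13 b14
  exact lintegral_avoid_le_of_large hT hℓ hτ hL rfl b1 b2 ⟨b3, b4, b5⟩ b6 b7 b8
    (le_trans (by norm_num) (Nat.pow_le_pow_right (by norm_num) b9 : 2 ^ 7 ≤ 2 ^ j)) b10 b11 b12 b13 b14

/-- The matrices `A` for which some integral `x` of determinant `ℓ` and entries at most `Y` solves
the approximation problem for `A * x`. -/
def goodSet (T : Fin 2 → ℝ → ℝ) (ℓ : ℤ) (ε Y : ℝ) : Set M3 :=
  {A | ∃ x : Z3, x.det = ℓ ∧ |(A * toR x).trace - T 0 (A * toR x).det| < ε ∧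
    |(A * toR x).adjugate.trace - T 1 (A * toR x).det| < ε ∧ EBdd Y (toR x)}

lemma measurableSet_goodSet {T : Fin 2 → ℝ → ℝ} (hT : ∀ i, Measurable (T i)) (ℓ : ℤ) (ε Y : ℝ) :
    MeasurableSet (goodSet T ℓ ε Y) := by
  have : goodSet T ℓ ε Y = ⋃ x : Z3, {A | x.det = ℓ ∧ |(A * toR x).trace - T 0 (A * toR x).det| < ε ∧
      |(A * toR x).adjugate.trace - T 1 (A * toR x).det| < ε ∧ EBdd Y (toR x)} := by
    ext A; simp [goodSet]
  rw [this]
  refine MeasurableSet.iUnion fun x => ?_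
  have hm : Measurable fun A : M3 => A * toR x := measurable_mul_right _
  have htr : Measurable fun A : M3 => A.trace := (continuous_id.matrix_trace).measurable
  have hadj : Measurable fun A : M3 => A.adjugate.trace :=
    ((continuous_id.matrix_adjugate).matrix_trace).measurable
  have hTd : ∀ i, Measurable fun A : M3 => T i A.det := fun i => (hT i).comp measurable_det
  exact (MeasurableSet.const _).inter ((measurableSet_lt (((htr.sub (hTd 0)).comp hm).abs)
    measurable_const).inter ((measurableSet_lt (((hadj.sub (hTd 1)).comp hm).abs)
    measurable_const).inter (MeasurableSet.const _)))

lemma goodSet_mono {T : Fin 2 → ℝ → ℝ} {ℓ : ℤ} {ε Y Y' : ℝ} (h : Y ≤ Y') :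
    goodSet T ℓ ε Y ⊆ goodSet T ℓ ε Y' := fun _ ⟨x, h1, h2, h3, h4⟩ => ⟨x, h1, h2, h3, h4.mono h⟩

/-- The integral points of the unipotent group `ntr`. -/
def ntrZ (m : Fin 2 → ℤ) : SL3Z := ⟨!![1, 0, m 0; 0, 1, m 1; 0, 0, 1], by simp [Matrix.det_fin_three]⟩

lemma toR_ntrZ (m : Fin 2 → ℤ) : toR (ntrZ m).1 = ntr fun l => m l := by
  ext i j
  fin_cases i <;> fin_cases j <;> simp [ntrZ, ntr]

lemma abs_planeMap_le {i n : ℕ} (hi : i < n) {τ : Fin 2 → ℝ} (hτ : τ ∈ sq01) (l : Fin 2) :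
    |planeMap (3 * i) τ l| ≤ 13 * (n : ℝ) ^ 2 := by
  have hin : (i : ℝ) + 1 ≤ n := by exact_mod_cast hi
  have hi0 : (0 : ℝ) ≤ i := Nat.cast_nonneg i
  obtain ⟨a0, a1⟩ := hτ 0
  obtain ⟨b0, b1⟩ := hτ 1
  have h1 : (i : ℝ) * τ 0 ≤ i := mul_le_of_le_one_right hi0 a1
  have h2 : (i : ℝ) * τ 1 ≤ i := mul_le_of_le_one_right hi0 b1
  have h3 : (i : ℝ) ^ 2 * τ 0 ≤ i ^ 2 := mul_le_of_le_one_right (by positivity) a1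
  have h4 : 0 ≤ (i : ℝ) * τ 0 := by positivity
  have h5 : 0 ≤ (i : ℝ) * τ 1 := by positivity
  have h6 : 0 ≤ (i : ℝ) ^ 2 * τ 0 := by positivity
  have h7 : ((i : ℝ) + 1) ^ 2 ≤ (n : ℝ) ^ 2 := by gcongr
  have h8 : (0 : ℝ) ≤ (i : ℝ) ^ 2 := by positivity
  rw [abs_le]
  fin_cases l <;> simp [planeMap] <;> constructor <;> nlinarith

lemma eBdd_ntrZ {i n : ℕ} (hi : i < n) {τ : Fin 2 → ℝ} (hτ : τ ∈ sq01) {m : Fin 2 → ℤ}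
    (hm : (fun l => planeMap (3 * i) τ l + m l) ∈ sq01) : EBdd (14 * (n : ℝ) ^ 2) (toR (ntrZ m).1) := by
  have hn : (1 : ℝ) ≤ n := by exact_mod_cast (Nat.succ_le_of_lt (Nat.zero_lt_of_lt hi))
  have hn2 : (1 : ℝ) ≤ (n : ℝ) ^ 2 := one_le_pow₀ hn
  have key : ∀ l, |(m l : ℝ)| ≤ 14 * (n : ℝ) ^ 2 := fun l => by
    have h1 := abs_le.1 (abs_planeMap_le hi hτ l)
    have h2 := (hm l).1
    have h3 := (hm l).2
    simp only at h2 h3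
    rw [abs_le]
    constructor <;> linarith
  have k0 := key 0
  have k1 := key 1
  have k2 : (1 : ℝ) ≤ 14 * (n : ℝ) ^ 2 := by linarith
  intro p q
  fin_cases p <;> fin_cases q <;> simp [ntrZ] <;> assumption

lemma mem_goodSet_of_not_mem_avoid {T : Fin 2 → ℝ → ℝ} {ℓ : ℤ} {K ε R : ℝ} {h n : ℕ} {S : Finset SL3Z}
    (hS : ∀ γ ∈ S, ColBox h γ.1) {A : M3} {τ : Fin 2 → ℝ} (hτ : τ ∈ sq01)
    (hA : ntr τ * A ∈ bddWin R) (hav : τ ∉ avoid (orbFam (hitSet T ℓ K ε S) A) n) :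
    ntr τ * A ∈ goodSet T ℓ ε (12 * R ^ 2 * (18 * (17010 * h * (n : ℝ) ^ 4) ^ 3 * K)) := by
  have : ∃ i < n, ∃ m : Fin 2 → ℤ, (fun l => planeMap (3 * i) τ l + m l) ∈ sq01 ∧
      (fun l => planeMap (3 * i) τ l + m l) ∈ orbFam (hitSet T ℓ K ε S) A i := by
    by_contra hcon
    push Not at hcon
    exact hav ⟨hτ, hcon⟩
  obtain ⟨i, hi, m, hm, hmem⟩ := this
  rw [orbFam, orbSet, Set.mem_ofPred_eq, hitSet, Set.mem_iUnion₂] at hmem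
  obtain ⟨γ, hγ, γ₂, x, hx, hX⟩ := hmem
  have hθ : ntr (fun l => planeMap (3 * i) τ l + m l) * (toR (wMat (3 * i)).1 * A) =
      toR (ntrZ m).1 * toR (wMat (3 * i)).1 * (ntr τ * A) := by
    have e1 : (fun l => planeMap (3 * i) τ l + (m l : ℝ)) = (fun l => (m l : ℝ)) + planeMap (3 * i) τ := by
      ext l; simp [add_comm]
    rw [e1, ← ntr_mul_ntr, toR_ntrZ, Matrix.mul_assoc, ← Matrix.mul_assoc (ntr (planeMap _ _)),
      ← wMat_mul_ntr]
    simp only [Matrix.mul_assoc]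
  rw [hθ] at hX
  obtain ⟨A', hA'⟩ : ∃ A', A' = ntr τ * A := ⟨_, rfl⟩
  rw [← hA'] at hX hA ⊢
  obtain ⟨g, hg⟩ : ∃ g : SL3Z, g = γ * (ntrZ m * wMat (3 * i)) := ⟨_, rfl⟩
  have hgR : toR g.1 = toR γ.1 * (toR (ntrZ m).1 * toR (wMat (3 * i)).1) := by
    rw [hg, Matrix.SpecialLinearGroup.coe_mul, Matrix.SpecialLinearGroup.coe_mul, toR_mul, toR_mul]
  have hgB : EBdd (17010 * h * (n : ℝ) ^ 4) (toR g.1) := by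
    rw [hgR]
    refine ((hS γ hγ).eBdd.mul ((eBdd_ntrZ hi hτ hm).mul (eBdd_wMat hi))).mono (le_of_eq ?_)
    ring
  obtain ⟨X, hXe⟩ : ∃ X, X = toR g.1 * (A' * toR (γ₂.1 * x)) := ⟨_, rfl⟩
  have hXX : toR γ.1 * (toR (ntrZ m).1 * toR (wMat (3 * i)).1 * A') * toR γ₂.1 * toR x = X := by
    rw [hXe, hgR, toR_mul]; simp only [Matrix.mul_assoc]
  rw [hXX] at hX
  obtain ⟨hXK, -, htr, hadj⟩ := hX
  have hY : A' * toR (γ₂.1 * x * g.1) = A' * toR (γ₂.1 * x) * toR g.1 := by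
    rw [toR_mul _ g.1, Matrix.mul_assoc]
  have hYtr : (A' * toR (γ₂.1 * x) * toR g.1).trace = X.trace := by
    rw [hXe, Matrix.trace_mul_comm]
  have hYdet : (A' * toR (γ₂.1 * x) * toR g.1).det = X.det := by
    rw [hXe, Matrix.det_mul_comm]
  have hYadj : (A' * toR (γ₂.1 * x) * toR g.1).adjugate.trace = X.adjugate.trace := by
    rw [hXe, Matrix.adjugate_mul_distrib, Matrix.adjugate_mul_distrib (toR g.1), Matrix.trace_mul_comm]
  refine ⟨γ₂.1 * x * g.1, ?_, ?_, ?_, ?_⟩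
  · rw [Matrix.det_mul, Matrix.det_mul, γ₂.2, g.2, hx.1]; simp
  · rw [hY, hYtr, hYdet]; exact htr
  · rw [hY, hYadj, hYdet]; exact hadj
  · refine hA.1.of_mul (L := 18 * (17010 * h * (n : ℝ) ^ 4) ^ 3 * K) ?_ (abs_det_of_mem_detWin hA.2)
    have e : A' * toR (γ₂.1 * x * g.1) = (toR g.1).adjugate * X * toR g.1 := by
      rw [hY, hXe, ← toR_inv, ← Matrix.mul_assoc (toR (g⁻¹).1), toR_inv_mul, Matrix.one_mul]
    rw [e]
    refine ((hgB.adjugate.mul hXK).mul hgB).mono (le_of_eq ?_)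
    ring

lemma bddWin_of_ntr_mul {R : ℝ} {τ : Fin 2 → ℝ} (hτ : τ ∈ sq01) {A : M3} (hA : ntr τ * A ∈ bddWin R) :
    A ∈ bddWin (3 * R) := by
  refine ⟨?_, (mul_left_mem_detWin (det_ntr τ)).1 hA.2⟩
  have e : A = ntr (-τ) * (ntr τ * A) := by
    rw [← Matrix.mul_assoc, ntr_mul_ntr, neg_add_cancel, ntr_zero, Matrix.one_mul]
  have h1 : EBdd 1 (ntr (-τ)) := by
    have h0 := hτ 0
    have h1 := hτ 1
    intro i j
    fin_cases i <;> fin_cases j <;> simp [ntr] <;> rw [abs_of_pos] <;>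
      first | exact h0.2 | exact h1.2 | exact h0.1 | exact h1.1
  change EBdd _ A
  rw [e]
  refine (h1.mul hA.1).mono (le_of_eq ?_)
  ring

lemma volume_compl_goodSet_le {T : Fin 2 → ℝ → ℝ} (hT : ∀ i, Measurable (T i)) {ℓ : ℤ} {K ε R : ℝ} {h n : ℕ}
    {S : Finset SL3Z} (hS : ∀ γ ∈ S, ColBox h γ.1) :
    volume ((goodSet T ℓ ε (12 * R ^ 2 * (18 * (17010 * h * (n : ℝ) ^ 4) ^ 3 * K)))ᶜ ∩ bddWin R) ≤
      ∫⁻ A in bddWin (3 * R), volume (avoid (orbFam (hitSet T ℓ K ε S) A) n) := by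
  obtain ⟨G, hG⟩ : ∃ G, G = (goodSet T ℓ ε (12 * R ^ 2 * (18 * (17010 * h * (n : ℝ) ^ 4) ^ 3 * K)))ᶜ ∩
    bddWin R := ⟨_, rfl⟩
  have hGm : MeasurableSet G := by
    rw [hG]; exact (measurableSet_goodSet hT ℓ _ _).compl.inter (measurableSet_bddWin R)
  have hfib := lintegral_measure_fiber (m := (volume : Measure M3)) (ν := volume.restrict sq01)
    (a := fun A τ => ntr τ * A) (((continuous_ntr.comp continuous_snd).matrix_mul continuous_fst).measurable)
    (fun τ => measurePreserving_mul_left (det_ntr τ)) hGm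
  rw [Measure.restrict_apply_univ, volume_sq01, one_mul] at hfib
  rw [← hG, ← hfib, ← lintegral_indicator (measurableSet_bddWin _)]
  refine lintegral_mono fun A => ?_
  rw [Measure.restrict_apply' measurableSet_sq01]
  classical
  rw [Set.indicator_apply]
  split_ifs with hA
  · refine measure_mono ?_
    rintro τ ⟨hτG, hτ⟩
    change ntr τ * A ∈ G at hτG
    rw [hG] at hτG
    by_contra hcon
    exact hτG.1 (mem_goodSet_of_not_mem_avoid hS hτ hτG.2 hcon)
  · refine le_of_eq (measure_mono_null (t := ∅) ?_ measure_empty)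
    rintro τ ⟨hτG, hτ⟩
    change ntr τ * A ∈ G at hτG
    rw [hG] at hτG
    exact hA (bddWin_of_ntr_mul hτ hτG.2)

lemma ae_bddWin_eventually_goodSet {T : Fin 2 → ℝ → ℝ} (hT : ∀ i, Measurable (T i)) {ℓ : ℤ} (hℓ : ℓ ≠ 0)
    {τ : ℝ} (hτ : ∀ i t, |T i t| + 1 ≤ τ) {R : ℝ} (hR : 1 ≤ R) :
    ∀ᵐ A : M3, A ∈ bddWin R →
      ∀ᶠ j : ℕ in Filter.atTop, A ∈ goodSet T ℓ (1 / 8 ^ j) (8 ^ j * (j : ℝ) ^ 991892) := by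
  obtain ⟨C, hC⟩ := eventually_lintegral_avoid_le hT hℓ hτ (L := 3 * R) (by linarith)
  have hbig : ∀ᶠ j : ℕ in Filter.atTop, 216 * 17010 ^ 3 * R ^ 2 ≤ (j : ℝ) :=
    tendsto_natCast_atTop_atTop.eventually_ge_atTop _
  have hvol : ∀ᶠ j : ℕ in Filter.atTop,
      volume ((goodSet T ℓ (1 / 8 ^ j) (8 ^ j * (j : ℝ) ^ 991892))ᶜ ∩ bddWin R) ≤
        ENNReal.ofReal (C / (j : ℝ) ^ 2) := by
    filter_upwards [hC, hbig] with j hj hJ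
    obtain ⟨S, hS, h_int⟩ := hj
    have hY : 12 * R ^ 2 * (18 * (17010 * ((2 ^ j : ℕ) : ℝ) * ((j ^ 82655 : ℕ) : ℝ) ^ 4) ^ 3 * (j : ℝ) ^ 31) ≤
        8 ^ j * (j : ℝ) ^ 991892 := by
      have h8 : (8 : ℝ) ^ j = (2 ^ j) ^ 3 := by rw [← pow_mul, mul_comm, pow_mul]; norm_num
      rw [Nat.cast_pow, Nat.cast_pow, h8]
      obtain ⟨J, hJd⟩ : ∃ J : ℝ, J = j := ⟨_, rfl⟩
      rw [← hJd] at hJ ⊢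
      have hJ0 : 0 ≤ J := le_trans (by positivity) hJ
      obtain ⟨q, hq⟩ : ∃ q : ℝ, q = 2 ^ j := ⟨_, rfl⟩
      have hq0 : 0 ≤ q := by rw [hq]; positivity
      rw [Nat.cast_ofNat, ← hq]
      calc 12 * R ^ 2 * (18 * (17010 * q * (J ^ 82655) ^ 4) ^ 3 * J ^ 31)
          = 216 * 17010 ^ 3 * R ^ 2 * (q ^ 3 * J ^ 991891) := by ring
        _ ≤ J * (q ^ 3 * J ^ 991891) := by gcongr
        _ = q ^ 3 * J ^ 991892 := by ring
    refine le_trans (measure_mono ?_) ((volume_compl_goodSet_le (K := (j : ℝ) ^ 31) (R := R)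
      (n := j ^ 82655) hT hS).trans h_int)
    exact Set.inter_subset_inter_left _ (Set.compl_subset_compl.2 (goodSet_mono hY))
  obtain ⟨N, hN⟩ := Filter.eventually_atTop.1 hvol
  have hsum : ∑' j : ℕ, volume ((goodSet T ℓ (1 / 8 ^ (j + N)) (8 ^ (j + N) *
      ((j + N : ℕ) : ℝ) ^ 991892))ᶜ ∩ bddWin R) ≠ ⊤ := by
    have hs : Summable fun j : ℕ => C / ((j + N : ℕ) : ℝ) ^ 2 := by
      have h2 : Summable fun j : ℕ => C / (j : ℝ) ^ 2 := by
        simpa [div_eq_mul_inv] using (Real.summable_one_div_nat_pow.2 one_lt_two).mul_left C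
      exact (summable_nat_add_iff N).2 h2
    exact ne_top_of_le_ne_top hs.tsum_ofReal_ne_top
      (ENNReal.tsum_le_tsum fun j => hN (j + N) (Nat.le_add_left _ _))
  filter_upwards [ae_eventually_notMem hsum] with A hA hAR
  obtain ⟨N', hN'⟩ := Filter.eventually_atTop.1 hA
  refine Filter.eventually_atTop.2 ⟨N' + N, fun j hj => ?_⟩
  obtain ⟨i, rfl⟩ : ∃ i, j = i + N := ⟨j - N, by omega⟩
  have := hN' i (by omega)
  by_contra hcon
  exact this ⟨hcon, hAR⟩

lemma ae_detWin_eventually_goodSet {T : Fin 2 → ℝ → ℝ} (hT : ∀ i, Measurable (T i)) {ℓ : ℤ} (hℓ : ℓ ≠ 0)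
    {τ : ℝ} (hτ : ∀ i t, |T i t| + 1 ≤ τ) :
    ∀ᵐ A : M3, A ∈ detWin →
      ∀ᶠ j : ℕ in Filter.atTop, A ∈ goodSet T ℓ (1 / 8 ^ j) (8 ^ j * (j : ℝ) ^ 991892) := by
  have h := ae_all_iff.2 fun r : ℕ => ae_bddWin_eventually_goodSet hT hℓ hτ (R := (r : ℝ) + 1)
    (by have : (0 : ℝ) ≤ r := Nat.cast_nonneg r
        linarith)
  filter_upwards [h] with A hA hAd
  obtain ⟨r, hr⟩ := exists_nat_ge (∑ i, ∑ j, |A i j|)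
  refine hA r ⟨fun i j => ?_, hAd⟩
  have h1 : |A i j| ≤ ∑ j, |A i j| :=
    Finset.single_le_sum (f := fun j => |A i j|) (fun _ _ => abs_nonneg _) (Finset.mem_univ j)
  have h2 : ∑ j, |A i j| ≤ ∑ i, ∑ j, |A i j| :=
    Finset.single_le_sum (f := fun i => ∑ j, |A i j|) (fun _ _ => Finset.sum_nonneg fun _ _ => abs_nonneg _)
      (Finset.mem_univ i)
  linarith

/-- The cube root of `t / ℓ` clipped to the determinant window. -/
noncomputable def rootOf (ℓ : ℤ) (t : ℝ) : ℝ := (max (1 / 2) (min 1 (t / ℓ))) ^ (1 / 3 : ℝ)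

lemma rootOf_mem {ℓ : ℤ} {t : ℝ} : 1 / 2 ≤ rootOf ℓ t ∧ rootOf ℓ t ≤ 1 := by
  have h1 : (1 / 2 : ℝ) ≤ max (1 / 2) (min 1 (t / ℓ)) := le_max_left _ _
  have h2 : max (1 / 2) (min 1 (t / ℓ)) ≤ (1 : ℝ) := max_le (by norm_num) (min_le_left _ _)
  refine ⟨?_, Real.rpow_le_one (by linarith) h2 (by norm_num)⟩
  exact h1.trans (Real.self_le_rpow_of_le_one (by linarith) h2 (by norm_num))

lemma rootOf_pow {ℓ : ℤ} (hℓ : ℓ ≠ 0) {d : ℝ} (h1 : 1 / 2 ≤ d) (h2 : d ≤ 1) : rootOf ℓ (d * ℓ) ^ 3 = d := by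
  have hℓ' : (ℓ : ℝ) ≠ 0 := by exact_mod_cast hℓ
  rw [rootOf, mul_div_cancel_right₀ _ hℓ', min_eq_right h2, max_eq_right h1, ← Real.rpow_natCast,
    ← Real.rpow_mul (by linarith)]
  norm_num

/-- The target values for a scaled matrix. -/
noncomputable def target (ℓ : ℤ) (ξ : ℝ × ℝ) : Fin 2 → ℝ → ℝ :=
  ![fun t => rootOf ℓ t * ξ.2, fun t => -(rootOf ℓ t ^ 2 * ξ.1)]

lemma measurable_target (ℓ : ℤ) (ξ : ℝ × ℝ) (i : Fin 2) : Measurable (target ℓ ξ i) := by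
  have hr : Measurable (rootOf ℓ) := by
    unfold rootOf; fun_prop
  fin_cases i
  · exact hr.mul_const _
  · exact ((hr.pow_const 2).mul_const _).neg

lemma abs_target_le (ℓ : ℤ) (ξ : ℝ × ℝ) (i : Fin 2) (t : ℝ) : |target ℓ ξ i t| + 1 ≤ |ξ.1| + |ξ.2| + 1 := by
  obtain ⟨h1, h2⟩ := rootOf_mem (ℓ := ℓ) (t := t)
  have h0 : 0 ≤ rootOf ℓ t := by linarith
  have h3 : rootOf ℓ t ^ 2 ≤ 1 := pow_le_one₀ h0 h2
  have a1 := abs_nonneg ξ.1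
  have a2 := abs_nonneg ξ.2
  fin_cases i
  · change |rootOf ℓ t * ξ.2| + 1 ≤ _
    rw [abs_mul, abs_of_nonneg h0]
    nlinarith
  · change |-(rootOf ℓ t ^ 2 * ξ.1)| + 1 ≤ _
    rw [abs_neg, abs_mul, abs_of_nonneg (by positivity)]
    nlinarith

/-- The scalar matrix problem: integral `x` of determinant `ℓ` and size below `Y` for which the trace and
the second invariant of `A * x` approximate `ξ` to within `ε`. -/
def Solves (ℓ : ℤ) (ξ : ℝ × ℝ) (A : M3) (ε Y : ℝ) : Prop :=
  ∃ x : Z3, x.det = ℓ ∧ |(A * toR x).trace - ξ.2| < ε ∧ |-(A * toR x).adjugate.trace - ξ.1| < ε ∧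
    EBdd Y (toR x)

lemma solves_of_mem_goodSet {ℓ : ℤ} (hℓ : ℓ ≠ 0) {ξ : ℝ × ℝ} {ε Y d : ℝ} {A : M3} (hA : A.det = 1)
    (h1 : 1 / 2 ≤ d) (h2 : d ≤ 1) (h : rootOf ℓ (d * ℓ) • A ∈ goodSet (target ℓ ξ) ℓ ε Y) :
    Solves ℓ ξ A (4 * ε) Y := by
  obtain ⟨x, hx, htr, hadj, hY⟩ := h
  obtain ⟨s, hs⟩ : ∃ s, s = rootOf ℓ (d * ℓ) := ⟨_, rfl⟩
  have hs3 : s ^ 3 = d := by rw [hs, rootOf_pow hℓ h1 h2]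
  have hs1 : 1 / 2 ≤ s := by rw [hs]; exact rootOf_mem.1
  have hdet : (s • A * toR x).det = d * ℓ := by
    rw [Matrix.det_mul, Matrix.det_smul, hA, toR_det, hx, Fintype.card_fin, hs3, mul_one]
  rw [← hs] at htr hadj
  rw [hdet] at htr hadj
  have t0 : target ℓ ξ 0 (d * ℓ) = s * ξ.2 := by rw [hs]; rfl
  have t1 : target ℓ ξ 1 (d * ℓ) = -(s ^ 2 * ξ.1) := by rw [hs]; rfl
  rw [t0, Matrix.smul_mul, Matrix.trace_smul, smul_eq_mul, ← mul_sub, abs_mul, abs_of_pos (by linarith)] at htr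
  have e : (s • A * toR x).adjugate.trace - -(s ^ 2 * ξ.1) =
      -(s ^ 2 * (-(A * toR x).adjugate.trace - ξ.1)) := by
    rw [Matrix.smul_mul, Matrix.adjugate_smul, Matrix.trace_smul, smul_eq_mul, Fintype.card_fin]; ring
  rw [t1, e, abs_neg, abs_mul, abs_of_nonneg (by positivity)] at hadj
  refine ⟨x, hx, ?_, ?_, hY⟩
  · nlinarith [abs_nonneg ((A * toR x).trace - ξ.2)]
  · have : 1 / 4 ≤ s ^ 2 := by nlinarith
    nlinarith [abs_nonneg (-(A * toR x).adjugate.trace - ξ.1)]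

lemma eventually_pow_lt_rpow {κ : ℝ} (hκ : 1 < κ) (a : ℕ) :
    ∀ᶠ j : ℕ in Filter.atTop, (8 : ℝ) ^ j * (j : ℝ) ^ a < (8 ^ j / 32) ^ κ := by
  have hr : (1 : ℝ) < 8 ^ (κ - 1) := Real.one_lt_rpow (by norm_num) (by linarith)
  have h := tendsto_pow_const_div_const_pow_of_one_lt a hr
  have hc : (0 : ℝ) < (32 ^ κ)⁻¹ := by positivity
  filter_upwards [h.eventually_lt_const hc] with j hj
  have h8 : (0 : ℝ) < 8 ^ j := by positivity
  rw [div_lt_iff₀ (by positivity)] at hj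
  rw [Real.div_rpow h8.le (by norm_num)]
  have e : ((8 : ℝ) ^ j) ^ κ = 8 ^ j * (8 ^ (κ - 1)) ^ j := by
    rw [← Real.rpow_natCast, ← Real.rpow_mul (by norm_num), ← Real.rpow_natCast (8 ^ (κ - 1)),
      ← Real.rpow_mul (by norm_num), ← Real.rpow_add (by norm_num)]
    congr 1; ring
  rw [e, mul_div_assoc]
  refine mul_lt_mul_of_pos_left ?_ h8
  rw [div_eq_inv_mul]; exact hj

lemma solves_of_eventually {ℓ : ℤ} {ξ : ℝ × ℝ} {A : M3} {κ : ℝ} (hκ : 1 < κ) {a : ℕ}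
    (h : ∀ᶠ j : ℕ in Filter.atTop, Solves ℓ ξ A (4 * (1 / 8 ^ j)) (8 ^ j * (j : ℝ) ^ a)) :
    ∃ ε₀ > 0, ∀ ε : ℝ, 0 < ε → ε < ε₀ → ∃ Y < ε ^ (-κ), Solves ℓ ξ A ε Y := by
  obtain ⟨N, hN⟩ := Filter.eventually_atTop.1 (h.and (eventually_pow_lt_rpow hκ a))
  refine ⟨4 / 8 ^ N, by positivity, fun ε hε hεN => ?_⟩
  have h8N : (1 : ℝ) ≤ 8 ^ N := one_le_pow₀ (by norm_num)
  have hx : 8 ^ N < 4 / ε := by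
    rw [lt_div_iff₀ hε]; rw [lt_div_iff₀ (by positivity)] at hεN; linarith
  obtain ⟨n, hn1, hn2⟩ := exists_nat_pow_near (x := 4 / ε) (y := 8) (by linarith) (by norm_num)
  have hNn : N ≤ n + 1 := by
    have : (8 : ℝ) ^ N < 8 ^ (n + 1) := hx.trans hn2
    exact ((pow_lt_pow_iff_right₀ (by norm_num : (1 : ℝ) < 8)).1 this).le
  obtain ⟨⟨x, h1, h2, h3, h4⟩, hlt⟩ := hN (n + 1) hNn
  have hp : (0 : ℝ) < 8 ^ (n + 1) := by positivity
  have he : 4 * (1 / 8 ^ (n + 1)) ≤ ε := by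
    rw [mul_one_div, div_le_iff₀ hp]
    rw [div_lt_iff₀ hε] at hn2; linarith
  refine ⟨_, hlt.trans_le ?_, x, h1, h2.trans_le he, h3.trans_le he, h4⟩
  rw [Real.rpow_neg hε.le, ← Real.inv_rpow hε.le]
  refine Real.rpow_le_rpow (by positivity) ?_ (by linarith)
  rw [pow_succ]
  rw [inv_eq_one_div]
  have : 4 / ε = 4 * (1 / ε) := by ring
  linarith

/-- The group `SL₃(ℝ)`. -/
abbrev SL3R := Matrix.SpecialLinearGroup (Fin 3) ℝ

instance : BorelSpace SL3R := ⟨rfl⟩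
instance : IsTopologicalGroup SL3R := Matrix.SpecialLinearGroup.topologicalGroup

lemma isClosedEmbedding_coe_SL3R : Topology.IsClosedEmbedding fun g : SL3R => (g : M3) :=
  (isClosed_eq continuous_id.matrix_det continuous_const :
    IsClosed {A : M3 | A.det = 1}).isClosedEmbedding_subtypeVal

instance : SecondCountableTopology SL3R :=
  isClosedEmbedding_coe_SL3R.toIsEmbedding.secondCountableTopology

instance : SigmaCompactSpace SL3R :=
  haveI : SigmaCompactSpace M3 := inferInstanceAs (SigmaCompactSpace (Fin 3 → Fin 3 → ℝ))
  isClosedEmbedding_coe_SL3R.sigmaCompactSpace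

/-- The matrices that succeed at all large scales. -/
def eventuallyGood (ℓ : ℤ) (ξ : ℝ × ℝ) : Set M3 :=
  {A | ∀ᶠ j : ℕ in Filter.atTop, A ∈ goodSet (target ℓ ξ) ℓ (1 / 8 ^ j) (8 ^ j * (j : ℝ) ^ 991892)}

lemma measurableSet_eventuallyGood (ℓ : ℤ) (ξ : ℝ × ℝ) : MeasurableSet (eventuallyGood ℓ ξ) := by
  have : eventuallyGood ℓ ξ = ⋃ N : ℕ, ⋂ j : ℕ, ⋂ _ : N ≤ j,
      goodSet (target ℓ ξ) ℓ (1 / 8 ^ j) (8 ^ j * (j : ℝ) ^ 991892) := by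
    ext A; simp [eventuallyGood, Filter.eventually_atTop]
  rw [this]
  exact MeasurableSet.iUnion fun N => MeasurableSet.iInter fun j => MeasurableSet.iInter fun _ =>
    measurableSet_goodSet (measurable_target ℓ ξ) ℓ _ _

lemma volume_detWin_ne_zero : volume detWin ≠ 0 := by
  have : (volume : Measure M3).IsOpenPosMeasure :=
    inferInstanceAs (volume : Measure (Fin 3 → Fin 3 → ℝ)).IsOpenPosMeasure
  have ho : IsOpen {A : M3 | 1 / 2 < A.det ∧ A.det < 1} :=
    (isOpen_lt continuous_const continuous_id.matrix_det).inter
      (isOpen_lt continuous_id.matrix_det continuous_const)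
  have hne : {A : M3 | 1 / 2 < A.det ∧ A.det < 1}.Nonempty := by
    refine ⟨Matrix.diagonal ![3 / 4, 1, 1], ?_⟩
    constructor <;> rw [Matrix.det_diagonal] <;> simp [Fin.prod_univ_three] <;> norm_num
  have h := ho.measure_pos volume hne
  intro h0
  exact h.ne' (measure_mono_null (fun A (hA : 1 / 2 < A.det ∧ A.det < 1) =>
    (⟨hA.1.le, hA.2.le⟩ : A ∈ detWin)) h0)

/-- A null set of matrices in the determinant window is missed by almost all `c • (g₂ * g₁⁻¹)`, for a
suitable scalar `c`. -/
lemma exists_scalar_ae_eventuallyGood {ℓ : ℤ} (hℓ : ℓ ≠ 0) (ξ : ℝ × ℝ) (μ : Measure (SL3R × SL3R))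
    [μ.IsHaarMeasure] : ∃ d : ℝ, 1 / 2 ≤ d ∧ d ≤ 1 ∧
      ∀ᵐ g ∂μ, rootOf ℓ (d * ℓ) • ((g.2 * g.1⁻¹ : SL3R) : M3) ∈ eventuallyGood ℓ ξ := by
  have h0 := ae_detWin_eventually_goodSet (measurable_target ℓ ξ) hℓ (abs_target_le ℓ ξ)
  have hmeas : MeasurableSet {A : M3 | A ∈ detWin → A ∈ eventuallyGood ℓ ξ} := by
    have : {A : M3 | A ∈ detWin → A ∈ eventuallyGood ℓ ξ} = detWinᶜ ∪ eventuallyGood ℓ ξ := by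
      ext A; simp [imp_iff_not_or]
    rw [this]
    exact measurableSet_detWin.compl.union (measurableSet_eventuallyGood ℓ ξ)
  have hmap : Measurable fun p : M3 × (SL3R × SL3R) => p.1 * ((p.2.2 * p.2.1⁻¹ : SL3R) : M3) := by
    have : Continuous fun p : M3 × (SL3R × SL3R) => p.1 * ((p.2.2 * p.2.1⁻¹ : SL3R) : M3) :=
      continuous_fst.matrix_mul (isClosedEmbedding_coe_SL3R.continuous.comp
        ((continuous_snd.comp continuous_snd).mul (continuous_fst.comp continuous_snd).inv))
    exact this.measurable
  have h1 : ∀ᵐ g ∂μ, ∀ᵐ A : M3, A * ((g.2 * g.1⁻¹ : SL3R) : M3) ∈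
      {A : M3 | A ∈ detWin → A ∈ eventuallyGood ℓ ξ} :=
    Filter.Eventually.of_forall fun g =>
      (measurePreserving_mul_right (g.2 * g.1⁻¹).2).quasiMeasurePreserving.ae h0
  have h2 : ∀ᵐ A : M3, ∀ᵐ g ∂μ, A * ((g.2 * g.1⁻¹ : SL3R) : M3) ∈
      {A : M3 | A ∈ detWin → A ∈ eventuallyGood ℓ ξ} :=
    (Measure.ae_ae_comm (μ := volume) (ν := μ) (p := fun (A : M3) g => A * ((g.2 * g.1⁻¹ : SL3R) : M3) ∈
      {A : M3 | A ∈ detWin → A ∈ eventuallyGood ℓ ξ}) (hmap hmeas)).2 h1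
  obtain ⟨A, hA, hAg⟩ : ∃ A ∈ detWin, ∀ᵐ g ∂μ, A * ((g.2 * g.1⁻¹ : SL3R) : M3) ∈
      {A : M3 | A ∈ detWin → A ∈ eventuallyGood ℓ ξ} := by
    by_contra hcon
    exact volume_detWin_ne_zero (measure_mono_null (fun A hA hAg => hcon ⟨A, hA, hAg⟩) (ae_iff.1 h2))
  refine ⟨A.det, hA.1, hA.2, ?_⟩
  obtain ⟨s, hs⟩ : ∃ s, s = rootOf ℓ (A.det * ℓ) := ⟨_, rfl⟩
  have hs3 : s ^ 3 = A.det := by rw [hs, rootOf_pow hℓ hA.1 hA.2]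
  have hs0 : s ≠ 0 := by
    rintro rfl
    have := hA.1
    rw [← hs3] at this
    norm_num at this
  obtain ⟨a, ha⟩ : ∃ a : SL3R, (a : M3) = s⁻¹ • A := ⟨⟨s⁻¹ • A, by
    rw [Matrix.det_smul, Fintype.card_fin, ← hs3, ← mul_pow, inv_mul_cancel₀ hs0, one_pow]⟩, rfl⟩
  have hAa : A = s • (a : M3) := by rw [ha, smul_smul, mul_inv_cancel₀ hs0, one_smul]
  have h3 := (measurePreserving_mul_left μ ((1, a⁻¹) : SL3R × SL3R)).quasiMeasurePreserving.ae hAg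
  filter_upwards [h3] with g hg
  have e : A * ((((1, a⁻¹) * g : SL3R × SL3R).2 * ((1, a⁻¹) * g : SL3R × SL3R).1⁻¹ : SL3R) : M3) =
      s • ((g.2 * g.1⁻¹ : SL3R) : M3) := by
    have : ((1, a⁻¹) * g : SL3R × SL3R).2 * ((1, a⁻¹) * g : SL3R × SL3R).1⁻¹ = a⁻¹ * (g.2 * g.1⁻¹) := by
      simp [mul_assoc]
    rw [this, hAa, Matrix.smul_mul, ← Matrix.SpecialLinearGroup.coe_mul, mul_inv_cancel_left]
  rw [e] at hg
  rw [← hs]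
  refine hg ⟨?_, ?_⟩ <;> rw [Matrix.det_smul, Fintype.card_fin, hs3, (g.2 * g.1⁻¹).2, mul_one]
  exacts [hA.1, hA.2]

lemma charF2_eq (x : M3) : charF2 x = x.trace := by
  rw [charF2, Matrix.trace_eq_neg_charpoly_coeff]; rfl

lemma charF1_eq (x : M3) : charF1 x = -x.adjugate.trace := by
  have h : x.charpoly = Polynomial.X ^ 3 - Polynomial.C x.trace * Polynomial.X ^ 2 +
      Polynomial.C x.adjugate.trace * Polynomial.X - Polynomial.C x.det := by
    rw [Matrix.charpoly, Matrix.det_fin_three, Matrix.det_fin_three x, Matrix.trace_fin_three,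
      Matrix.trace_fin_three, Matrix.adjugate_fin_three]
    simp
    ring
  rw [charF1, h]
  simp [Polynomial.coeff_C]

/-- **Theorem 3 (characteristic polynomial map, optimal density).**
Let `ℓ ∈ ℤ \ {0}`, `κ > 1`, `ξ ∈ ℝ²`. For Haar-almost every pair
`(g₁,g₂) ∈ SL(3,ℝ) × SL(3,ℝ)` there is `ε₀ > 0` such that for every `ε ∈ (0,ε₀)` there is an
integral matrix `x` with `det x = ℓ`, `‖(F₁(g₁⁻¹xg₂), F₂(g₁⁻¹xg₂)) − ξ‖ < ε`, `‖x‖ < ε^(−κ)`. -/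
theorem characteristic_polynomial_map_optimal_density
    (ℓ : ℤ) (hℓ : ℓ ≠ 0) (κ : ℝ) (hκ : 1 < κ) (ξ : ℝ × ℝ)
    (μ : Measure (Matrix.SpecialLinearGroup (Fin 3) ℝ × Matrix.SpecialLinearGroup (Fin 3) ℝ))
    [μ.IsHaarMeasure] :
    ∀ᵐ g ∂μ, ∃ ε₀ > 0, ∀ ε : ℝ, 0 < ε → ε < ε₀ →
      ∃ x : Matrix (Fin 3) (Fin 3) ℤ, x.det = ℓ ∧
        (let y : Matrix (Fin 3) (Fin 3) ℝ :=
          ((g.1⁻¹ : Matrix.SpecialLinearGroup (Fin 3) ℝ) : Matrix (Fin 3) (Fin 3) ℝ) *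
            (x.map fun a => (a : ℝ)) *
            ((g.2 : Matrix.SpecialLinearGroup (Fin 3) ℝ) : Matrix (Fin 3) (Fin 3) ℝ)
        ‖(charF1 y, charF2 y) - ξ‖ < ε) ∧
        ‖fun i j => ((x i j : ℝ))‖ < ε ^ (-κ) := by
  obtain ⟨d, hd1, hd2, hd⟩ := exists_scalar_ae_eventuallyGood hℓ ξ μ
  filter_upwards [hd] with g hg
  have hs : ∀ᶠ j : ℕ in Filter.atTop, Solves ℓ ξ ((g.2 * g.1⁻¹ : SL3R) : M3) (4 * (1 / 8 ^ j))
      (8 ^ j * (j : ℝ) ^ 991892) := by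
    filter_upwards [hg] with j hj
    exact solves_of_mem_goodSet hℓ (g.2 * g.1⁻¹).2 hd1 hd2 hj
  obtain ⟨ε₀, hε₀, H⟩ := solves_of_eventually hκ hs
  refine ⟨ε₀, hε₀, fun ε hε hεε => ?_⟩
  obtain ⟨Y, hY, x, hx, htr, hadj, hB⟩ := H ε hε hεε
  refine ⟨x, hx, ?_, ?_⟩
  · have e1 : (((g.1⁻¹ : SL3R) : M3) * toR x * (g.2 : M3)).trace =
        (((g.2 * g.1⁻¹ : SL3R) : M3) * toR x).trace := by
      rw [Matrix.trace_mul_comm, Matrix.SpecialLinearGroup.coe_mul, Matrix.mul_assoc]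
    have e2 : (((g.1⁻¹ : SL3R) : M3) * toR x * (g.2 : M3)).adjugate.trace =
        (((g.2 * g.1⁻¹ : SL3R) : M3) * toR x).adjugate.trace := by
      rw [Matrix.adjugate_mul_distrib, Matrix.trace_mul_comm, ← Matrix.adjugate_mul_distrib,
        Matrix.SpecialLinearGroup.coe_mul, Matrix.mul_assoc]
    change ‖(charF1 (((g.1⁻¹ : SL3R) : M3) * toR x * (g.2 : M3)),
      charF2 (((g.1⁻¹ : SL3R) : M3) * toR x * (g.2 : M3))) - ξ‖ < ε
    rw [charF1_eq, charF2_eq, e1, e2, Prod.norm_def]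
    exact max_lt hadj htr
  · refine lt_of_le_of_lt ?_ hY
    have hY0 : 0 ≤ Y := hB.nonneg
    exact (pi_norm_le_iff_of_nonneg hY0).2 fun i => (pi_norm_le_iff_of_nonneg hY0).2 fun j => hB i j
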